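/- Let Ω ⊂ ℝ² be a bounded, open, connected set with Lipschitz boundary and let u ∈ W^{1,1}(Ω;S¹). Assume: (i) there is a finite family ((x_i,y_i))_{i∈I} of pairs of points of cl(Ω) satisfying (P_f) such that ⟨Det(∇u),φ⟩ = π Σ_{i∈I} (φ(x_i) − φ(y_i)) for all φ ∈ Lip₀(Ω), and the points among the x_i, y_i lying in Ω are distinct and three by three not collinear; (ii) there exists ρ > 0 such that the closed discs of radius ρ centered at the points x_i ∈ Ω and y_j ∈ Ω are contained in Ω and pairwise disjoint, u(z) = (z − x_i)/|z − x_i| for a.e. z in B_ρ(x_i) whenever x_i ∈ Ω, and u(z) = ι((z − y_j)/|z − y_j|) for a.e. z in B_ρ(y_j) whenever y_j ∈ Ω, where ι(w₁,w₂) := (w₁,−w₂). Then 𝒜(u,Ω) ≤ ∫_Ω √(1 + |∇u|²) dx + ‖Det(∇u)‖_{flat,α}. -/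

import Mathlib

open MeasureTheory Metric Filter Set
open scoped ENNReal NNReal Topology Classical

noncomputable section

abbrev R2 := EuclideanSpace ℝ (Fin 2)

/-- `Ω ⊂ ℝ²` has Lipschitz boundary: near every boundary point, after a rigid motion,
`Ω` coincides with the open region strictly above the graph of a Lipschitz function. -/
def HasLipschitzBoundary (Ω : Set R2) : Prop :=
  ∀ p ∈ frontier Ω, ∃ r : ℝ, 0 < r ∧ ∃ (f : R2 ≃ᵢ R2) (γ : ℝ → ℝ) (L : ℝ≥0),
    LipschitzWith L γ ∧ ∀ x ∈ Metric.ball p r, (x ∈ Ω ↔ γ (f x 0) < f x 1)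

/-- `G` is the weak (distributional) gradient of `u` on `Ω`:
`∫_Ω u_i ∂_j φ = -∫_Ω G_{ij} φ` for all test functions `φ ∈ C_c^∞(Ω)`. -/
def IsWeakGradient (Ω : Set R2) (u : R2 → R2) (G : R2 → Matrix (Fin 2) (Fin 2) ℝ) : Prop :=
  ∀ φ : R2 → ℝ, ContDiff ℝ (⊤ : ℕ∞) φ → HasCompactSupport φ → tsupport φ ⊆ Ω →
    ∀ i j : Fin 2,
      (∫ x in Ω, u x i * fderiv ℝ φ x (EuclideanSpace.single j 1)) =
        - ∫ x in Ω, G x i j * φ x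

/-- `u ∈ W^{1,1}(Ω;ℝ²)` with weak gradient `G`. -/
def MemW11 (Ω : Set R2) (u : R2 → R2) (G : R2 → Matrix (Fin 2) (Fin 2) ℝ) : Prop :=
  IntegrableOn u Ω ∧ (∀ i j : Fin 2, IntegrableOn (fun x => G x i j) Ω) ∧
    IsWeakGradient Ω u G

/-- `|u| = 1` a.e. in `Ω`. -/
def SphereValued (Ω : Set R2) (u : R2 → R2) : Prop :=
  ∀ᵐ x ∂(volume.restrict Ω), ‖u x‖ = 1

/-- Frobenius norm of a `2×2` matrix. -/
def frob (M : Matrix (Fin 2) (Fin 2) ℝ) : ℝ :=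
  Real.sqrt (∑ i, ∑ j, (M i j) ^ 2)

/-- Jacobian matrix of a map `v : ℝ² → ℝ²`. -/
def jacobianMatrix (v : R2 → R2) (x : R2) : Matrix (Fin 2) (Fin 2) ℝ :=
  Matrix.of fun i j => fderiv ℝ v x (EuclideanSpace.single j 1) i

/-- Classical graph area `A(v,A) = ∫_A √(1 + |∇v|² + (Jv)²)` of a `C¹` map. -/
def classicalArea (A : Set R2) (v : R2 → R2) : ℝ≥0∞ :=
  ∫⁻ x in A, ENNReal.ofReal
    (Real.sqrt (1 + (∑ i, ∑ j, (jacobianMatrix v x i j) ^ 2) + (jacobianMatrix v x).det ^ 2))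

/-- `L¹`-relaxed area functional `𝒜(u,A)`. -/
def relaxedArea (u : R2 → R2) (A : Set R2) : ℝ≥0∞ :=
  sInf { a : ℝ≥0∞ | ∃ v : ℕ → R2 → R2,
    (∀ k, ContDiffOn ℝ 1 (v k) A) ∧
    (∀ k, IntegrableOn (fun x => v k x - u x) A) ∧
    Tendsto (fun k => ∫ x in A, ‖v k x - u x‖) atTop (nhds 0) ∧
    a = Filter.liminf (fun k => classicalArea A (v k)) atTop }

/-- `λ_u = (1/2)(u₁ ∇^⊥u₂ − u₂ ∇^⊥u₁)`, computed from the weak gradient `G`. -/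
def lambdaVec (u : R2 → R2) (G : R2 → Matrix (Fin 2) (Fin 2) ℝ) (x : R2) : Fin 2 → ℝ :=
  ![ (1 / 2) * (-(u x 0) * G x 1 1 + u x 1 * G x 0 1),
     (1 / 2) * (u x 0 * G x 1 0 - u x 1 * G x 0 0) ]

/-- Distributional Jacobian pairing `⟨Det(∇u), φ⟩ = ∫_Ω λ_u · ∇φ`. -/
def detPairing (Ω : Set R2) (u : R2 → R2) (G : R2 → Matrix (Fin 2) (Fin 2) ℝ)
    (φ : R2 → ℝ) : ℝ :=
  ∫ x in Ω, ∑ j, lambdaVec u G x j * fderiv ℝ φ x (EuclideanSpace.single j 1)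

/-- `φ ∈ Lip₀(Ω)`: Lipschitz on `cl(Ω)` and vanishing on `∂Ω`. -/
def MemLip0 (Ω : Set R2) (φ : R2 → ℝ) : Prop :=
  (∃ L : ℝ≥0, LipschitzOnWith L φ (closure Ω)) ∧ ∀ p ∈ frontier Ω, φ p = 0

/-- Admissible test functions for the flat norm: Lipschitz constant `≤ L` on `cl(Ω)`,
vanishing on `Z`, and bounded by `1` on `cl(Ω)`. -/
def FlatAdmissible (Ω Z : Set R2) (L : ℝ≥0) (φ : R2 → ℝ) : Prop :=
  LipschitzOnWith L φ (closure Ω) ∧ (∀ p ∈ Z, φ p = 0) ∧ ∀ p ∈ closure Ω, |φ p| ≤ 1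

/-- Flat norm of a functional `F`, with vanishing condition on the set `Z`. -/
def flatNormOn (Ω Z : Set R2) (L : ℝ≥0) (F : (R2 → ℝ) → ℝ) : ℝ≥0∞ :=
  ⨆ φ ∈ {φ : R2 → ℝ | FlatAdmissible Ω Z L φ}, ENNReal.ofReal (F φ)

/-- Flat norm of a functional `F` on `Lip₀(Ω)`; `L = 2` gives `‖·‖_{flat,α}` (α = 1/2),
`L = 1` gives `‖·‖_flat`. -/
def flatNorm (Ω : Set R2) (L : ℝ≥0) (F : (R2 → ℝ) → ℝ) : ℝ≥0∞ :=
  flatNormOn Ω (frontier Ω) L F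

/-- `d̄_Ω(x,y) = min{|x−y|, dist(x,∂Ω) + dist(y,∂Ω)}`. -/
def dbar (Ω : Set R2) (x y : R2) : ℝ :=
  min (dist x y) (Metric.infDist x (frontier Ω) + Metric.infDist y (frontier Ω))

/-- Countably subadditive interior envelope `𝒜**(u,V)` (relative to `Ω`). -/
def envA (u : R2 → R2) (Ω V : Set R2) : ℝ≥0∞ :=
  sInf { a : ℝ≥0∞ | ∃ A : ℕ → Set R2,
    (∀ k, IsOpen (A k) ∧ A k ⊆ Ω) ∧ V ⊆ ⋃ k, A k ∧ a = ∑' k, relaxedArea u (A k) }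

/-- Property `(P_f)` for a finite family of pairs of points of `cl(Ω)`. -/
def SatisfiesPf (Ω : Set R2) {n : ℕ} (x y : Fin n → R2) : Prop :=
  (∀ k, (x k ∈ Ω ∧ y k ∈ frontier Ω ∧ dist (x k) (y k) = Metric.infDist (x k) (frontier Ω)) ∨
        (y k ∈ Ω ∧ x k ∈ frontier Ω ∧ dist (x k) (y k) = Metric.infDist (y k) (frontier Ω))) ∧
  ∀ i j, x i ∈ Ω → y j ∈ Ω → x i ≠ y j

/-- The points of the family `x, y` lying in `Ω` are distinct and three by three
not collinear. -/
def InteriorPointsGeneric (Ω : Set R2) {n : ℕ} (x y : Fin n → R2) : Prop :=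
  (∀ a b : Fin n ⊕ Fin n, Sum.elim x y a ∈ Ω → Sum.elim x y b ∈ Ω → a ≠ b →
    Sum.elim x y a ≠ Sum.elim x y b) ∧
  ∀ a b c : Fin n ⊕ Fin n, Sum.elim x y a ∈ Ω → Sum.elim x y b ∈ Ω → Sum.elim x y c ∈ Ω →
    a ≠ b → a ≠ c → b ≠ c →
    ¬ Collinear ℝ ({Sum.elim x y a, Sum.elim x y b, Sum.elim x y c} : Set R2)

/-- `ι(w₁,w₂) = (w₁,−w₂)`. -/
def conjPt (w : R2) : R2 := (WithLp.equiv 2 (Fin 2 → ℝ)).symm ![w 0, -(w 1)]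

/-- `u` is a (positive/negative) vortex around the points of the family lying in `Ω`:
the closed discs of radii `ρ` are contained in `Ω` and pairwise disjoint,
`u(z) = (z−x_i)/|z−x_i|` on `B_{ρ}(x_i)` and `u(z) = ι((z−y_j)/|z−y_j|)` on `B_{ρ}(y_j)`. -/
def VortexAt (Ω : Set R2) (u : R2 → R2) {n : ℕ} (x y : Fin n → R2)
    (ρ : Fin n ⊕ Fin n → ℝ) : Prop :=
  (∀ a, Sum.elim x y a ∈ Ω → Metric.closedBall (Sum.elim x y a) (ρ a) ⊆ Ω) ∧
  (∀ a b, a ≠ b → Sum.elim x y a ∈ Ω → Sum.elim x y b ∈ Ω →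
    Disjoint (Metric.closedBall (Sum.elim x y a) (ρ a))
      (Metric.closedBall (Sum.elim x y b) (ρ b))) ∧
  (∀ i, x i ∈ Ω → ∀ᵐ z ∂(volume.restrict (Metric.ball (x i) (ρ (Sum.inl i)))),
    u z = ‖z - x i‖⁻¹ • (z - x i)) ∧
  (∀ i, y i ∈ Ω → ∀ᵐ z ∂(volume.restrict (Metric.ball (y i) (ρ (Sum.inr i)))),
    u z = conjPt (‖z - y i‖⁻¹ • (z - y i)))

/-- The energy `E(I_P, I_D, τ)` of a partition `{I_Dᶜ, I_D}` of `I` and an injection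
`τ : I_D → I`. -/
def energy (Ω : Set R2) {n : ℕ} (x y : Fin n → R2) (ID : Finset (Fin n))
    (τ : Fin n → Fin n) : ℝ≥0∞ :=
  ((IDᶜ.filter fun k => x k ∈ Ω).card : ℝ≥0∞) +
  (((Finset.univ \ ID.image τ).filter fun j => y j ∈ Ω).card : ℝ≥0∞) +
  2 * ∑ k ∈ ID, μH[1] (segment ℝ (y (τ k)) (x k) ∩ Ω)

/-! ## Kernels -/

/-- Standard basis vector. -/
def eb (j : Fin 2) : R2 := EuclideanSpace.single j 1

/-- Partial derivative. -/
def pd {F : Type*} [NormedAddCommGroup F] [NormedSpace ℝ F] (j : Fin 2) (f : R2 → F) (z : R2) : F :=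
  fderiv ℝ f z (eb j)

/-- Smooth profile: `0` for `t ≤ 1/2`, `1` for `t ≥ 1`. -/
def nn (t : ℝ) : ℝ := Real.smoothTransition (2 * t - 1)

lemma nn_contDiff : ContDiff ℝ (⊤ : ℕ∞) nn := by
  unfold nn
  exact Real.smoothTransition.contDiff.comp (by fun_prop)

lemma nn_of_le {t : ℝ} (h : t ≤ 1 / 2) : nn t = 0 :=
  Real.smoothTransition.zero_of_nonpos (by linarith)

lemma nn_of_ge {t : ℝ} (h : 1 ≤ t) : nn t = 1 :=
  Real.smoothTransition.one_of_one_le (by linarith)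

lemma nn_nonneg (t : ℝ) : 0 ≤ nn t := Real.smoothTransition.nonneg _

lemma nn_le_one (t : ℝ) : nn t ≤ 1 := Real.smoothTransition.le_one _

lemma nn_mono : Monotone nn := fun a b h => Real.smoothTransition.monotone (by linarith)

lemma nn_diff (t : ℝ) : HasDerivAt nn (deriv nn t) t :=
  (nn_contDiff.differentiable (by simp) t).hasDerivAt

lemma nn'_nonneg (t : ℝ) : 0 ≤ deriv nn t := nn_mono.deriv_nonneg

lemma nn'_contDiff : ContDiff ℝ (⊤ : ℕ∞) (deriv nn) := by
  have := nn_contDiff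
  have h2 : ContDiff ℝ ((⊤ : ℕ∞) + 1) nn := by simpa using this
  exact (contDiff_succ_iff_deriv.1 h2).2.2

lemma nn'_of_lt {t : ℝ} (h : t < 1 / 2) : deriv nn t = 0 := by
  have : nn =ᶠ[𝓝 t] fun _ => 0 := by
    filter_upwards [Iio_mem_nhds h] with s hs using nn_of_le (le_of_lt hs)
  rw [this.deriv_eq]; simp

lemma nn'_of_gt {t : ℝ} (h : 1 < t) : deriv nn t = 0 := by
  have : nn =ᶠ[𝓝 t] fun _ => 1 := by
    filter_upwards [Ioi_mem_nhds h] with s hs using nn_of_ge (le_of_lt hs)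
  rw [this.deriv_eq]; simp

lemma nn'_bdd : ∃ C : ℝ, 0 < C ∧ ∀ t, deriv nn t ≤ C := by
  obtain ⟨C, hC⟩ := (isCompact_Icc (a := (0 : ℝ)) (b := 1)).exists_bound_of_continuousOn
    (nn'_contDiff.continuous.continuousOn)
  refine ⟨max C 1, by positivity, fun t => ?_⟩
  by_cases h0 : t < 1 / 2
  · rw [nn'_of_lt h0]; positivity
  by_cases h1 : 1 < t
  · rw [nn'_of_gt h1]; positivity
  exact (le_abs_self _).trans ((hC t ⟨by linarith, by linarith⟩).trans (le_max_left _ _))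

lemma normSq_hasFDerivAt (z : R2) : HasFDerivAt (fun z : R2 => ‖z‖ ^ 2) (2 • innerSL ℝ z) z := by
  exact (hasStrictFDerivAt_norm_sq z).hasFDerivAt

lemma inner_eb (z : R2) (j : Fin 2) : inner ℝ z (eb j) = z j := by
  unfold eb; simp [EuclideanSpace.inner_single_right]

lemma R2_normSq (z : R2) : ‖z‖ ^ 2 = z 0 ^ 2 + z 1 ^ 2 := by
  rw [EuclideanSpace.norm_sq_eq]; simp [Fin.sum_univ_two]

lemma abs_coord_le (z : R2) (j : Fin 2) : |z j| ≤ ‖z‖ := by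
  have := EuclideanSpace.norm_eq z
  simpa using PiLp.norm_apply_le z j

/-- Coordinates. -/
lemma eb_apply (i j : Fin 2) : (eb j) i = if i = j then (1 : ℝ) else 0 := by
  unfold eb; simp

lemma coord_hasFDerivAt (j : Fin 2) (z : R2) :
    HasFDerivAt (fun z : R2 => z j) (EuclideanSpace.proj j : R2 →L[ℝ] ℝ) z :=
  (EuclideanSpace.proj j : R2 →L[ℝ] ℝ).hasFDerivAt

lemma coord_contDiff (j : Fin 2) {n : WithTop ℕ∞} : ContDiff ℝ n (fun z : R2 => z j) :=
  (EuclideanSpace.proj j : R2 →L[ℝ] ℝ).contDiff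

/-- Cut-off `n_r(z) = nn(|z|²/r²)`. -/
def cut (r : ℝ) (z : R2) : ℝ := nn (‖z‖ ^ 2 / r ^ 2)

/-- Mollifier. -/
def eta (r : ℝ) (z : R2) : ℝ := deriv nn (‖z‖ ^ 2 / r ^ 2) / (Real.pi * r ^ 2)

/-- Singular kernel `z_j/|z|²`. -/
def kerS (j : Fin 2) (z : R2) : ℝ := z j / ‖z‖ ^ 2

def prof (r t : ℝ) : ℝ := nn (t / r ^ 2) / t

/-- Regularised kernel. -/
def kerr (r : ℝ) (j : Fin 2) (z : R2) : ℝ := z j * prof r (‖z‖ ^ 2)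

lemma kerr_eq (r : ℝ) (j : Fin 2) (z : R2) : kerr r j z = cut r z * kerS j z := by
  unfold kerr prof cut kerS; ring

lemma cut_nonneg (r : ℝ) (z : R2) : 0 ≤ cut r z := nn_nonneg _
lemma cut_le_one (r : ℝ) (z : R2) : cut r z ≤ 1 := nn_le_one _

lemma cut_of_ge {r : ℝ} (hr : 0 < r) {z : R2} (h : r ≤ ‖z‖) : cut r z = 1 := by
  apply nn_of_ge
  rw [le_div_iff₀ (by positivity), one_mul]
  gcongr

lemma cut_of_le {r : ℝ} (hr : 0 < r) {z : R2} (h : ‖z‖ ≤ r / 2) : cut r z = 0 := by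
  apply nn_of_le
  rw [div_le_iff₀ (by positivity)]
  have : ‖z‖ ^ 2 ≤ (r / 2) ^ 2 := by gcongr
  nlinarith [sq_nonneg r]

lemma cut_contDiff (r : ℝ) : ContDiff ℝ (⊤ : ℕ∞) (cut r) := by
  unfold cut
  exact nn_contDiff.comp ((contDiff_norm_sq ℝ).div_const _)

lemma eta_contDiff (r : ℝ) : ContDiff ℝ (⊤ : ℕ∞) (eta r) := by
  unfold eta
  exact (nn'_contDiff.comp ((contDiff_norm_sq ℝ).div_const _)).div_const _

lemma prof_contDiff {r : ℝ} (hr : 0 < r) : ContDiff ℝ (⊤ : ℕ∞) (prof r) := by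
  rw [contDiff_iff_contDiffAt]
  intro t
  by_cases h : t < r ^ 2 / 2
  · have : prof r =ᶠ[𝓝 t] fun _ => 0 := by
      filter_upwards [Iio_mem_nhds h] with s hs
      unfold prof
      rw [nn_of_le, zero_div]
      rw [div_le_iff₀ (by positivity)]
      have : s < r ^ 2 / 2 := hs
      linarith
    exact contDiffAt_const.congr_of_eventuallyEq this
  · have : t ≠ 0 := by
      have : 0 < r ^ 2 / 2 := by positivity
      intro h0; rw [h0] at h; exact h this
    unfold prof
    exact ((nn_contDiff.comp (contDiff_id.div_const _)).contDiffAt).div contDiffAt_id this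

lemma kerr_contDiff {r : ℝ} (hr : 0 < r) (j : Fin 2) : ContDiff ℝ (⊤ : ℕ∞) (kerr r j) := by
  unfold kerr
  exact (coord_contDiff j).mul ((prof_contDiff hr).comp (contDiff_norm_sq ℝ))

lemma prof_deriv {r : ℝ} (hr : 0 < r) (t : ℝ) :
    prof r t + t * deriv (prof r) t = deriv nn (t / r ^ 2) / r ^ 2 := by
  have h1 : HasDerivAt (fun t => t * prof r t) (1 * prof r t + t * deriv (prof r) t) t :=
    (hasDerivAt_id t).mul (((prof_contDiff hr).differentiable (by simp) t).hasDerivAt)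
  have h2 : HasDerivAt (fun t => nn (t / r ^ 2)) (deriv nn (t / r ^ 2) * (1 / r ^ 2)) t :=
    (nn_diff _).comp t ((hasDerivAt_id t).div_const _)
  have h3 : (fun t => t * prof r t) = fun t => nn (t / r ^ 2) := by
    funext t
    unfold prof
    by_cases h : t = 0
    · subst h; simp [nn_of_le]
    · field_simp
  rw [h3] at h1
  have := h1.unique h2
  rw [one_mul] at this
  rw [this]; ring

lemma pd_kerr {r : ℝ} (hr : 0 < r) (i j : Fin 2) (z : R2) :
    pd i (kerr r j) z = (if j = i then prof r (‖z‖ ^ 2) else 0)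
      + z j * (deriv (prof r) (‖z‖ ^ 2) * (2 * z i)) := by
  have h1 : HasFDerivAt (fun z : R2 => prof r (‖z‖ ^ 2))
      (deriv (prof r) (‖z‖ ^ 2) • (2 • innerSL ℝ z)) z :=
    (((prof_contDiff hr).differentiable (by simp) _).hasDerivAt).comp_hasFDerivAt z
      (normSq_hasFDerivAt z)
  have h2 := (coord_hasFDerivAt j z).mul h1
  unfold pd
  have : HasFDerivAt (kerr r j) _ z := h2
  rw [this.fderiv]
  simp [inner_eb, eb_apply]
  by_cases h : j = i <;> (simp [h]; try ring)

lemma kerr_symm {r : ℝ} (hr : 0 < r) (i j : Fin 2) (z : R2) :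
    pd i (kerr r j) z = pd j (kerr r i) z := by
  rw [pd_kerr hr, pd_kerr hr]
  by_cases h : j = i
  · simp [h]
  · have : ¬ i = j := fun h' => h h'.symm
    simp [h, this]; ring

lemma kerr_div {r : ℝ} (hr : 0 < r) (z : R2) :
    pd 0 (kerr r 0) z + pd 1 (kerr r 1) z = 2 * Real.pi * eta r z := by
  rw [pd_kerr hr, pd_kerr hr]
  have := prof_deriv hr (‖z‖ ^ 2)
  unfold eta
  have h2 : deriv nn (‖z‖ ^ 2 / r ^ 2) / (Real.pi * r ^ 2)
    = (prof r (‖z‖ ^ 2) + ‖z‖ ^ 2 * deriv (prof r) (‖z‖ ^ 2)) / Real.pi := by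
    rw [this]; field_simp
  rw [h2]
  have h3 := R2_normSq z
  field_simp
  simp
  rw [h3]; ring

lemma pd_cut (r : ℝ) (j : Fin 2) (z : R2) :
    pd j (cut r) z = deriv nn (‖z‖ ^ 2 / r ^ 2) * (2 * z j / r ^ 2) := by
  have h1 : HasFDerivAt (cut r)
      (deriv nn (‖z‖ ^ 2 / r ^ 2) • ((r ^ 2)⁻¹ • (2 • innerSL ℝ z))) z := by
    have h := (normSq_hasFDerivAt z).mul_const (r ^ 2)⁻¹
    have := (nn_diff (‖z‖ ^ 2 / r ^ 2)).comp_hasFDerivAt z (by simpa [div_eq_mul_inv] using h)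
    exact this
  unfold pd
  rw [h1.fderiv]
  simp [inner_eb]; left; ring

lemma eta_nonneg (r : ℝ) (z : R2) : 0 ≤ eta r z := by
  unfold eta
  have := nn'_nonneg (‖z‖ ^ 2 / r ^ 2)
  positivity

lemma eta_of_gt {r : ℝ} (hr : 0 < r) {z : R2} (h : r < ‖z‖) : eta r z = 0 := by
  unfold eta
  rw [nn'_of_gt, zero_div]
  rw [lt_div_iff₀ (by positivity), one_mul]
  gcongr

lemma eta_support {r : ℝ} (hr : 0 < r) : Function.support (eta r) ⊆ closedBall 0 r := by
  intro z hz
  rw [mem_closedBall_zero_iff]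
  by_contra h
  exact hz (eta_of_gt hr (not_le.1 h))

lemma eta_compact {r : ℝ} (hr : 0 < r) : HasCompactSupport (eta r) :=
  HasCompactSupport.of_support_subset_isCompact (isCompact_closedBall 0 r) (eta_support hr)

lemma eta_integrable {r : ℝ} (hr : 0 < r) : Integrable (eta r) :=
  (eta_contDiff r).continuous.integrable_of_hasCompactSupport (eta_compact hr)

lemma volume_real_ball_R2 : (volume : Measure R2).real (ball 0 1) = Real.pi := by
  rw [Measure.real, EuclideanSpace.volume_ball]
  simp [Real.sq_sqrt Real.pi_pos.le]
  rw [one_add_one_eq_two, Real.Gamma_two]; simp [Real.pi_pos.le]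

lemma finrank_R2 : Module.finrank ℝ R2 = 2 := by simp

/-- Radial integral. -/
lemma radial_integral {M : ℝ → ℝ} (hM : ContDiff ℝ 1 M) (h1 : ∀ t, 1 < t → deriv M t = 0)
    {r : ℝ} (hr : 0 < r) :
    ∫ z : R2, deriv M (‖z‖ ^ 2 / r ^ 2) / r ^ 2 = Real.pi * (M 1 - M 0) := by
  have h := integral_fun_norm_addHaar (volume : Measure R2)
    (fun y => deriv M (y ^ 2 / r ^ 2) / r ^ 2)
  rw [finrank_R2, volume_real_ball_R2] at h
  rw [h]
  have hz : ∫ y in Ioi (0 : ℝ), y ^ (2 - 1) • (deriv M (y ^ 2 / r ^ 2) / r ^ 2)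
      = ∫ y in (0 : ℝ)..r, y * (deriv M (y ^ 2 / r ^ 2) / r ^ 2) := by
    rw [intervalIntegral.integral_of_le hr.le]
    simp only [smul_eq_mul, Nat.add_one_sub_one, pow_one]
    apply setIntegral_eq_of_subset_of_forall_sdiff_eq_zero measurableSet_Ioi
    · exact Ioc_subset_Ioi_self
    · intro y hy
      have hy1 : r < y := by
        by_contra h
        exact hy.2 ⟨hy.1, not_lt.1 h⟩
      rw [h1]; simp
      rw [lt_div_iff₀ (by positivity), one_mul]
      gcongr
    
  rw [hz]
  have hd : ∀ y ∈ uIcc 0 r, HasDerivAt (fun y => M (y ^ 2 / r ^ 2) / 2)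
      (y * (deriv M (y ^ 2 / r ^ 2) / r ^ 2)) y := by
    intro y _
    have h1 : HasDerivAt (fun y : ℝ => y ^ 2 / r ^ 2) ((2 * y) / r ^ 2) y := by
      have := (hasDerivAt_pow 2 y).div_const (r ^ 2)
      simpa using this
    have h2 := ((hM.differentiable (by simp) (y ^ 2 / r ^ 2)).hasDerivAt).comp y h1
    have h3 := h2.div_const 2
    refine h3.congr_deriv ?_
    ring
  have hcont : Continuous (fun y => y * (deriv M (y ^ 2 / r ^ 2) / r ^ 2)) := by
    have := hM.continuous_deriv le_rfl
    fun_prop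
  rw [intervalIntegral.integral_eq_sub_of_hasDerivAt hd (hcont.intervalIntegrable _ _)]
  have : r ^ 2 / r ^ 2 = 1 := by field_simp
  simp [this]
  ring

lemma eta_integral {r : ℝ} (hr : 0 < r) : ∫ z : R2, eta r z = 1 := by
  have h := radial_integral (M := nn) (nn_contDiff.of_le (by simp)) (fun t ht => nn'_of_gt ht) hr
  rw [nn_of_ge le_rfl, nn_of_le (by norm_num)] at h
  have h2 : ∀ z : R2, eta r z = (1 / Real.pi) * (deriv nn (‖z‖ ^ 2 / r ^ 2) / r ^ 2) := by
    intro z; unfold eta; field_simp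
  simp_rw [h2]
  rw [integral_const_mul, h]
  field_simp; simp

/-- `∫ n |∇n| / |z| = π`. -/
lemma cut_jac_integral {r : ℝ} (hr : 0 < r) :
    ∫ z : R2, cut r z * (deriv nn (‖z‖ ^ 2 / r ^ 2) * (2 / r ^ 2)) = Real.pi := by
  have hd : ∀ t, deriv (fun t => nn t ^ 2) t = 2 * nn t * deriv nn t := by
    intro t
    have := ((nn_diff t).fun_pow 2).deriv
    simpa using this
  have h := radial_integral (M := fun t => nn t ^ 2) ((nn_contDiff.of_le (by simp)).pow 2)
    (fun t ht => by rw [hd, nn'_of_gt ht, mul_zero]) hr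
  simp only [hd] at h
  rw [nn_of_ge le_rfl, nn_of_le (by norm_num)] at h
  have h2 : ∀ z : R2, cut r z * (deriv nn (‖z‖ ^ 2 / r ^ 2) * (2 / r ^ 2))
      = 2 * nn (‖z‖ ^ 2 / r ^ 2) * deriv nn (‖z‖ ^ 2 / r ^ 2) / r ^ 2 := by
    intro z; unfold cut; field_simp
  simp_rw [h2]
  rw [h]; simp

lemma kerS_measurable (j : Fin 2) : Measurable (kerS j) := by
  unfold kerS
  exact ((coord_contDiff (n := 0) j).continuous.measurable).div (by fun_prop)

lemma kerS_abs_le (j : Fin 2) (z : R2) : |kerS j z| ≤ ‖z‖⁻¹ := by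
  unfold kerS
  by_cases h : ‖z‖ = 0
  · simp [h]
  · rw [abs_div, abs_of_nonneg (sq_nonneg ‖z‖), div_le_iff₀ (by positivity)]
    have := abs_coord_le z j
    have h2 : ‖z‖⁻¹ * ‖z‖ ^ 2 = ‖z‖ := by field_simp
    rw [h2]; exact this

lemma kerr_abs_le (r : ℝ) (j : Fin 2) (z : R2) : |kerr r j z| ≤ ‖z‖⁻¹ := by
  rw [kerr_eq, abs_mul, abs_of_nonneg (cut_nonneg r z)]
  calc cut r z * |kerS j z| ≤ 1 * ‖z‖⁻¹ := by
        gcongr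
        · exact cut_le_one r z
        · exact kerS_abs_le j z
    _ = _ := one_mul _

lemma invnorm_integrableOn (r : ℝ) : IntegrableOn (fun z : R2 => ‖z‖⁻¹) (ball 0 r) := by
  have h := (integrableOn_fun_norm_addHaar (volume : Measure R2) (f := fun y : ℝ => y⁻¹) (r := r))
  rw [h, finrank_R2]
  have : IntegrableOn (fun _ : ℝ => (1 : ℝ)) (Ioo 0 r) := by
    apply (continuous_const.integrableOn_Icc (a := (0 : ℝ)) (b := r)).mono_set Ioo_subset_Icc_self
  refine this.congr_fun ?_ measurableSet_Ioo
  intro y hy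
  have : y ≠ 0 := ne_of_gt hy.1
  simp [this]

lemma invnorm_integral {r : ℝ} (hr : 0 < r) : ∫ z in ball (0 : R2) r, ‖z‖⁻¹ = 2 * Real.pi * r := by
  have h := integral_fun_norm_addHaar (volume : Measure R2)
    (fun y => (Iio r).indicator (fun y : ℝ => y⁻¹) y)
  rw [finrank_R2, volume_real_ball_R2] at h
  have h1 : ∫ z in ball (0 : R2) r, ‖z‖⁻¹
      = ∫ x : R2, (Iio r).indicator (fun y : ℝ => y⁻¹) ‖x‖ := by
    rw [← integral_indicator measurableSet_ball]
    congr 1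
    funext z
    by_cases hz : ‖z‖ < r
    · simp [indicator, hz]
    · simp [indicator, hz]
  rw [h1, h]
  have h2 : ∫ y in Ioi (0 : ℝ), y ^ (2 - 1) • (Iio r).indicator (fun y : ℝ => y⁻¹) y
      = ∫ y in Ioi (0 : ℝ), (Iio r).indicator (fun _ : ℝ => (1 : ℝ)) y := by
    apply setIntegral_congr_fun measurableSet_Ioi
    intro y hy
    have : y ≠ 0 := ne_of_gt hy
    by_cases hy2 : y < r
    · simp [indicator, hy2, this]
    · simp [indicator, hy2]
  rw [h2, setIntegral_indicator measurableSet_Iio, Ioi_inter_Iio]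
  simp [hr.le]
  ring

lemma invnorm_integrableOn_of_bounded {s : Set R2} (hs : Bornology.IsBounded s) (p : R2) :
    IntegrableOn (fun z : R2 => ‖z - p‖⁻¹) s := by
  obtain ⟨r, hr⟩ := hs.subset_ball p
  refine IntegrableOn.mono_set ?_ hr
  have h := invnorm_integrableOn r
  rw [← integrable_indicator_iff measurableSet_ball] at h ⊢
  have := h.comp_sub_right p
  refine this.congr (ae_of_all _ fun z => ?_)
  simp [indicator, dist_eq_norm]

lemma kerS_integrableOn_of_bounded {s : Set R2} (hs : Bornology.IsBounded s) (p : R2) (j : Fin 2) :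
    IntegrableOn (fun z : R2 => kerS j (z - p)) s := by
  refine (invnorm_integrableOn_of_bounded hs p).mono' ?_ (ae_of_all _ fun z => kerS_abs_le j _)
  exact ((kerS_measurable j).comp (measurable_id.sub_const p)).aestronglyMeasurable

/-- Mollified evaluation tends to point evaluation. -/
lemma eta_tendsto {φ : R2 → ℝ} (hφ : Continuous φ) {r : ℕ → ℝ} (hr : ∀ n, 0 < r n)
    (hr0 : Tendsto r atTop (𝓝 0)) :
    Tendsto (fun n => ∫ z, φ z * eta (r n) z) atTop (𝓝 (φ 0)) := by
  rw [Metric.tendsto_atTop]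
  intro ε hε
  obtain ⟨δ, hδ, h⟩ := Metric.continuousAt_iff.1 (hφ.continuousAt (x := 0)) (ε / 2) (by positivity)
  obtain ⟨N, hN⟩ := (Metric.tendsto_atTop.1 hr0) δ hδ
  refine ⟨N, fun n hn => ?_⟩
  have h1 := hN n hn
  rw [Real.dist_0_eq_abs, abs_of_pos (hr n)] at h1
  have hi : Integrable (fun z => φ z * eta (r n) z) :=
    (hφ.mul (eta_contDiff _).continuous).integrable_of_hasCompactSupport
      ((eta_compact (hr n)).mul_left)
  have hi2 : Integrable (fun z => φ 0 * eta (r n) z) := (eta_integrable (hr n)).const_mul _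
  have h2 : φ 0 = ∫ z, φ 0 * eta (r n) z := by
    rw [integral_const_mul, eta_integral (hr n), mul_one]
  rw [Real.dist_eq]
  conv_lhs => rw [h2]
  rw [← integral_sub hi hi2]
  calc |∫ z, (φ z * eta (r n) z - φ 0 * eta (r n) z)|
      ≤ ∫ z, ‖φ z * eta (r n) z - φ 0 * eta (r n) z‖ := by
        rw [← Real.norm_eq_abs]; exact norm_integral_le_integral_norm _
    _ ≤ ∫ z, ε / 2 * eta (r n) z := by
        apply integral_mono (hi.sub hi2).norm ((eta_integrable (hr n)).const_mul _)
        intro z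
        show ‖φ z * eta (r n) z - φ 0 * eta (r n) z‖ ≤ _
        rw [← sub_mul, norm_mul, Real.norm_of_nonneg (eta_nonneg _ _)]
        by_cases hz : r n < ‖z‖
        · simp [eta_of_gt (hr n) hz]
        · apply mul_le_mul_of_nonneg_right _ (eta_nonneg _ _)
          have := h (x := z) (by rw [dist_zero_right]; linarith)
          rw [Real.dist_eq] at this
          exact this.le
    _ = ε / 2 := by rw [integral_const_mul, eta_integral (hr n), mul_one]
    _ < ε := by linarith

lemma pd_continuous {F : Type*} [NormedAddCommGroup F] [NormedSpace ℝ F] {φ : R2 → F}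
    (hφ : ContDiff ℝ 1 φ) (j : Fin 2) : Continuous (pd j φ) := by
  unfold pd
  exact (hφ.continuous_fderiv (by simp)).clm_apply continuous_const

lemma pd_compact {F : Type*} [NormedAddCommGroup F] [NormedSpace ℝ F] {φ : R2 → F}
    (hφ : HasCompactSupport φ) (j : Fin 2) : HasCompactSupport (pd j φ) := by
  unfold pd
  exact (hφ.fderiv ℝ).comp_left (g := fun L : R2 →L[ℝ] F => L (eb j)) (by simp)

lemma kerr_eq_of_ge {r : ℝ} (hr : 0 < r) (j : Fin 2) {z : R2} (h : r ≤ ‖z‖) :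
    kerr r j z = kerS j z := by
  rw [kerr_eq, cut_of_ge hr h, one_mul]

lemma kerS_zero (j : Fin 2) : kerS j 0 = 0 := by simp [kerS]

lemma kerr_tendsto {r : ℕ → ℝ} (hr : ∀ n, 0 < r n)
    (hr0 : Tendsto r atTop (𝓝 0)) (j : Fin 2) (z : R2) :
    Tendsto (fun n => kerr (r n) j z) atTop (𝓝 (kerS j z)) := by
  by_cases hz : z = 0
  · subst hz
    simp [kerr_eq, kerS_zero]
  · have : 0 < ‖z‖ := norm_pos_iff.2 hz
    apply tendsto_const_nhds.congr'
    filter_upwards [hr0.eventually (Iio_mem_nhds this)] with n hn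
    exact (kerr_eq_of_ge (hr n) j (le_of_lt hn)).symm

lemma kerr_ibp {φ : R2 → ℝ} (hφ : ContDiff ℝ 1 φ) (hc : HasCompactSupport φ) {r : ℝ} (hr : 0 < r) :
    ∫ z, (pd 0 φ z * kerr r 0 z + pd 1 φ z * kerr r 1 z)
      = - (2 * Real.pi * ∫ z, φ z * eta r z) := by
  have hint1 : ∀ j, Integrable (fun z => pd j φ z * kerr r j z) := fun j =>
    ((pd_continuous hφ j).mul (kerr_contDiff hr j).continuous).integrable_of_hasCompactSupport
      (pd_compact hc j).mul_right
  have hint2 : ∀ j, Integrable (fun z => φ z * pd j (kerr r j) z) := fun j =>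
    (hφ.continuous.mul (pd_continuous ((kerr_contDiff hr j).of_le
      (by simp)) j)).integrable_of_hasCompactSupport hc.mul_right
  have hint3 : ∀ j, Integrable (fun z => φ z * kerr r j z) := fun j =>
    (hφ.continuous.mul (kerr_contDiff hr j).continuous).integrable_of_hasCompactSupport hc.mul_right
  have hp : ∀ j, ∫ z, pd j φ z * kerr r j z = - ∫ z, φ z * pd j (kerr r j) z := by
    intro j
    have := integral_mul_fderiv_eq_neg_fderiv_mul_of_integrable (μ := (volume : Measure R2))
      (f := φ) (g := kerr r j) (v := eb j) (hint1 j) (hint2 j) (hint3 j)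
      (fun x _ => hφ.differentiable (by simp) x)
      (fun x _ => (kerr_contDiff hr j).differentiable (by simp) x)
    have h2 : ∫ z, φ z * pd j (kerr r j) z = - ∫ z, pd j φ z * kerr r j z := this
    rw [h2, neg_neg]
  rw [integral_add (hint1 0) (hint1 1), hp, hp, ← integral_const_mul, ← neg_add,
    ← integral_add (hint2 0) (hint2 1)]
  congr 2
  funext z
  rw [← mul_add, kerr_div hr]; ring

/-- Divergence of the singular kernel. -/
lemma kerS_div {φ : R2 → ℝ} (hφ : ContDiff ℝ 1 φ) (hc : HasCompactSupport φ) (p : R2) :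
    ∫ z, (pd 0 φ z * kerS 0 (z - p) + pd 1 φ z * kerS 1 (z - p)) = - (2 * Real.pi * φ p) := by
  -- reduce to `p = 0`
  suffices H : ∀ φ : R2 → ℝ, ContDiff ℝ 1 φ → HasCompactSupport φ →
      ∫ z, (pd 0 φ z * kerS 0 z + pd 1 φ z * kerS 1 z) = - (2 * Real.pi * φ 0) by
    have hpd : ∀ j z, pd j (fun z => φ (z + p)) z = pd j φ (z + p) := by
      intro j z; unfold pd; rw [fderiv_comp_add_right]
    have h1 := H (fun z => φ (z + p)) (hφ.comp (by fun_prop))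
      (hc.comp_homeomorph (Homeomorph.addRight p))
    simp only [hpd, zero_add] at h1
    rw [← h1]
    rw [← integral_add_right_eq_self _ p]
    simp
  intro φ hφ hc
  set r : ℕ → ℝ := fun n => 1 / ((n : ℝ) + 1) with hrdef
  have hr : ∀ n, 0 < r n := fun n => by positivity
  have hr0 : Tendsto r atTop (𝓝 0) := tendsto_one_div_add_atTop_nhds_zero_nat
  have h1 : Tendsto (fun n => ∫ z, (pd 0 φ z * kerr (r n) 0 z + pd 1 φ z * kerr (r n) 1 z)) atTop
      (𝓝 (∫ z, (pd 0 φ z * kerS 0 z + pd 1 φ z * kerS 1 z))) := by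
    apply tendsto_integral_of_dominated_convergence
      (fun z => ‖pd 0 φ z‖ * ‖z‖⁻¹ + ‖pd 1 φ z‖ * ‖z‖⁻¹)
    · intro n
      exact ((((pd_continuous hφ 0).mul (kerr_contDiff (hr n) 0).continuous)).add
        ((pd_continuous hφ 1).mul (kerr_contDiff (hr n) 1).continuous)).aestronglyMeasurable
    · have : ∀ j, Integrable (fun z => ‖pd j φ z‖ * ‖z‖⁻¹) := by
        intro j
        have hk := (pd_compact hc j).isCompact
        have hI : IntegrableOn (fun z : R2 => ‖z‖⁻¹) (tsupport (pd j φ)) := by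
          have := invnorm_integrableOn_of_bounded hk.isBounded 0
          simpa using this
        have h2 := hI.continuousOn_mul (pd_continuous hφ j).norm.continuousOn hk
        refine (integrableOn_iff_integrable_of_support_subset ?_).1 h2
        intro z hz
        apply subset_tsupport
        intro h0
        apply hz
        simp [h0]
      exact (this 0).add (this 1)
    · intro n
      refine ae_of_all _ fun z => ?_
      refine (norm_add_le _ _).trans ?_
      rw [norm_mul, norm_mul]
      gcongr
      · exact kerr_abs_le _ _ _
      · exact kerr_abs_le _ _ _
    · refine ae_of_all _ fun z => ?_
      exact ((kerr_tendsto hr hr0 0 z).const_mul _).add ((kerr_tendsto hr hr0 1 z).const_mul _)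
  have h2 : Tendsto (fun n => - (2 * Real.pi * ∫ z, φ z * eta (r n) z)) atTop
      (𝓝 (- (2 * Real.pi * φ 0))) := ((eta_tendsto hφ.continuous hr hr0).const_mul _).neg
  refine tendsto_nhds_unique h1 (h2.congr fun n => ?_)
  exact (kerr_ibp hφ hc (hr n)).symm

set_option linter.unusedSectionVars false
section Conv
variable {E : Type*} [NormedAddCommGroup E] [NormedSpace ℝ E]

/-- Convolution with a scalar kernel. -/
def cv (k : R2 → E) (T : R2 → ℝ) (x : R2) : E := ∫ y, T (x - y) • k y

/-- The bilinear map used to identify `cv` with Mathlib's convolution. -/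
def cvL (E : Type*) [NormedAddCommGroup E] [NormedSpace ℝ E] : E →L[ℝ] ℝ →L[ℝ] E :=
  (ContinuousLinearMap.lsmul ℝ ℝ).flip

lemma cv_eq (k : R2 → E) (T : R2 → ℝ) : cv k T = convolution k T (cvL E) volume := by
  funext x
  simp [cv, convolution, cvL]

lemma cv_contDiff {k : R2 → E} (hk : Integrable k) {T : R2 → ℝ} (hT : ContDiff ℝ (⊤ : ℕ∞) T)
    (hc : HasCompactSupport T) : ContDiff ℝ (⊤ : ℕ∞) (cv k T) := by
  rw [cv_eq]
  exact hc.contDiff_convolution_right _ hk.locallyIntegrable hT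

lemma pd_cv {k : R2 → E} (hk : Integrable k) {T : R2 → ℝ} (hT : ContDiff ℝ 1 T)
    (hc : HasCompactSupport T) (j : Fin 2) (x : R2) : pd j (cv k T) x = cv k (pd j T) x := by
  have h := hc.hasFDerivAt_convolution_right (cvL E) (hk.locallyIntegrable (μ := volume)) hT x
  unfold pd
  rw [cv_eq, cv_eq, h.fderiv, convolution_precompR_apply _ hk.locallyIntegrable (hc.fderiv ℝ)
    (hT.continuous_fderiv (by simp))]

lemma cv_aesm {k : R2 → E} (hk : AEStronglyMeasurable k) {T : R2 → ℝ}
    (hT : AEStronglyMeasurable T) : AEStronglyMeasurable (cv k T) := by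
  have h := hk.convolution_integrand (cvL E) hT (μ := (volume : Measure R2))
  rw [cv_eq]
  exact h.integral_prod_right'

lemma cv_lintegral_le {k : R2 → E} (hk : AEStronglyMeasurable k) {T : R2 → ℝ}
    (hT : AEStronglyMeasurable T) :
    ∫⁻ x, ‖cv k T x‖ₑ ≤ (∫⁻ y, ‖T y‖ₑ) * ∫⁻ y, ‖k y‖ₑ := by
  have h := hk.convolution_integrand (cvL E) hT (μ := (volume : Measure R2))
  have h' : AEMeasurable (Function.uncurry fun x y : R2 => ‖T (x - y) • k y‖ₑ)
      ((volume : Measure R2).prod volume) := by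
    have := h.enorm
    refine this.congr (ae_of_all _ fun p => ?_)
    simp [cvL, Function.uncurry]
  calc ∫⁻ x, ‖cv k T x‖ₑ ≤ ∫⁻ x, ∫⁻ y, ‖T (x - y) • k y‖ₑ :=
        lintegral_mono fun x => enorm_integral_le_lintegral_enorm _
    _ = ∫⁻ y, ∫⁻ x, ‖T (x - y) • k y‖ₑ := lintegral_lintegral_swap h'
    _ = ∫⁻ y, (∫⁻ x, ‖T x‖ₑ) * ‖k y‖ₑ := by
        congr 1
        funext y
        simp_rw [enorm_smul]
        rw [lintegral_mul_const' _ _ enorm_ne_top, lintegral_sub_right_eq_self (fun x => ‖T x‖ₑ) y]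
    _ = _ := by
        rw [lintegral_const_mul'' _ hk.enorm]

lemma eta_lintegral {r : ℝ} (hr : 0 < r) : ∫⁻ z, ‖eta r z‖ₑ = 1 := by
  have h : ∀ z, ‖eta r z‖ₑ = ENNReal.ofReal (eta r z) := fun z =>
    Real.enorm_of_nonneg (eta_nonneg r z)
  simp_rw [h]
  rw [← ofReal_integral_eq_lintegral_ofReal (eta_integrable hr) (ae_of_all _ (eta_nonneg r)),
    eta_integral hr]
  simp

lemma cv_int_exists {k : R2 → E} (hk : Integrable k) {T : R2 → ℝ} (hT : Continuous T)
    (hc : HasCompactSupport T) (x : R2) : Integrable (fun y => T (x - y) • k y) := by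
  obtain ⟨C, hC⟩ := hc.exists_bound_of_continuous hT
  exact hk.bdd_smul C ((hT.comp (continuous_const.sub continuous_id)).aestronglyMeasurable)
    (ae_of_all _ fun y => hC _)

lemma eta_integral_sub {r : ℝ} (hr : 0 < r) (x : R2) : ∫ y, eta r (x - y) = 1 := by
  rw [integral_sub_left_eq_self (fun y => eta r y) volume x, eta_integral hr]

lemma eta_integrable_sub {r : ℝ} (hr : 0 < r) (x : R2) : Integrable fun y => eta r (x - y) :=
  (eta_integrable hr).comp_sub_left x

/-- `L¹` convergence of mollifications. -/
lemma moll_L1 [CompleteSpace E] {k : R2 → E} (hk : Integrable k) {ε : ℝ≥0∞} (hε : ε ≠ 0) :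
    ∃ r0 > 0, ∀ r, 0 < r → r ≤ r0 → ∫⁻ x, ‖cv k (eta r) x - k x‖ₑ ≤ ε := by
  have hε3 : ε / 3 ≠ 0 := by simp [hε]
  obtain ⟨g, hgc, hgk, hgcont, hgi⟩ := hk.exists_hasCompactSupport_lintegral_sub_le hε3
  obtain ⟨R, hR⟩ := (hgc.isCompact.isBounded).subset_closedBall (0 : R2)
  -- volume of a big ball
  set V := (volume : Measure R2) (closedBall 0 (R + 1)) with hV
  have hVtop : V ≠ ⊤ := measure_closedBall_lt_top.ne
  obtain ⟨δ, hδ, hδV⟩ : ∃ δ : ℝ, 0 < δ ∧ ENNReal.ofReal δ * V ≤ ε / 3 := by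
    by_cases hεt : ε / 3 = ⊤
    · exact ⟨1, one_pos, by simp [hεt]⟩
    refine ⟨(ε / 3).toReal / (V.toReal + 1), by
      have := ENNReal.toReal_pos hε3 hεt
      positivity, ?_⟩
    rw [← ENNReal.ofReal_toReal hVtop, ← ENNReal.ofReal_mul (by positivity)]
    conv_rhs => rw [← ENNReal.ofReal_toReal hεt]
    apply ENNReal.ofReal_le_ofReal
    rw [div_mul_eq_mul_div, div_le_iff₀ (by positivity)]
    simp only [ENNReal.toReal_ofReal ENNReal.toReal_nonneg]
    nlinarith [ENNReal.toReal_nonneg (a := ε / 3), ENNReal.toReal_nonneg (a := V)]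
  have huc := hgc.uniformContinuous_of_continuous hgcont
  obtain ⟨ρ, hρ, hρg⟩ := Metric.uniformContinuous_iff.1 huc δ hδ
  refine ⟨min (ρ / 2) 1, by positivity, fun r hr hr0 => ?_⟩
  have hrρ : r < ρ := by have := min_le_left (ρ / 2) 1; linarith
  have hr1 : r ≤ 1 := hr0.trans (min_le_right _ _)
  have hec := (eta_contDiff r).continuous
  have hes := eta_compact hr
  have hpt : ∀ x, ‖cv g (eta r) x - g x‖ₑ ≤ (closedBall (0 : R2) (R + 1)).indicator
      (fun _ => ENNReal.ofReal δ) x := by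
    intro x
    have h1 : cv g (eta r) x - g x = ∫ y, eta r (x - y) • (g y - g x) := by
      have h2 : g x = ∫ y, eta r (x - y) • g x := by
        rw [integral_smul_const, eta_integral_sub hr, one_smul]
      conv_lhs => rw [h2]
      unfold cv
      rw [← integral_sub (cv_int_exists hgi hec hes x) ((eta_integrable_sub hr x).smul_const _)]
      simp_rw [smul_sub]
    rw [h1]
    by_cases hx : x ∈ closedBall (0 : R2) (R + 1)
    · rw [indicator_of_mem hx, ← ofReal_norm]
      apply ENNReal.ofReal_le_ofReal
      calc ‖∫ y, eta r (x - y) • (g y - g x)‖ ≤ ∫ y, eta r (x - y) * δ := by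
            apply norm_integral_le_of_norm_le ((eta_integrable_sub hr x).mul_const _)
            refine ae_of_all _ fun y => ?_
            rw [norm_smul, Real.norm_of_nonneg (eta_nonneg _ _)]
            by_cases hy : r < ‖x - y‖
            · simp [eta_of_gt hr hy]
            · apply mul_le_mul_of_nonneg_left _ (eta_nonneg _ _)
              rw [← dist_eq_norm]
              refine (hρg ?_).le
              rw [dist_comm, dist_eq_norm]; linarith
        _ = δ := by rw [integral_mul_const, eta_integral_sub hr, one_mul]
    · rw [indicator_of_notMem hx]
      have h0 : ∀ y, eta r (x - y) • (g y - g x) = 0 := by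
        intro y
        by_cases hy : r < ‖x - y‖
        · simp [eta_of_gt hr hy]
        · rw [mem_closedBall_zero_iff, not_le] at hx
          have hgx : ∀ w : R2, R < ‖w‖ → g w = 0 := by
            intro w hw
            by_contra h
            have := hR (subset_tsupport _ h)
            rw [mem_closedBall_zero_iff] at this
            linarith
          have : ‖x‖ ≤ ‖x - y‖ + ‖y‖ := by
            have := norm_add_le (x - y) y; simpa using this
          rw [hgx x (by linarith), hgx y (by linarith)]; simp
      simp [h0]
  have hkm := hk.aestronglyMeasurable
  have hgm := hgi.aestronglyMeasurable
  have e1 : ∫⁻ x, ‖cv k (eta r) x - cv g (eta r) x‖ₑ ≤ ε / 3 := by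
    have : ∀ x, cv k (eta r) x - cv g (eta r) x = cv (fun y => k y - g y) (eta r) x := by
      intro x
      unfold cv
      rw [← integral_sub (cv_int_exists hk hec hes x) (cv_int_exists hgi hec hes x)]
      simp_rw [smul_sub]
    simp_rw [this]
    refine (cv_lintegral_le (hkm.sub hgm) hec.aestronglyMeasurable).trans ?_
    rw [eta_lintegral hr, one_mul]; exact hgk
  have e2 : ∫⁻ x, ‖cv g (eta r) x - g x‖ₑ ≤ ε / 3 := by
    refine (lintegral_mono hpt).trans ?_
    rw [lintegral_indicator measurableSet_closedBall]
    rw [setLIntegral_const]; exact hδV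
  have e3 : ∫⁻ x, ‖g x - k x‖ₑ ≤ ε / 3 := by
    refine le_trans (le_of_eq ?_) hgk
    congr 1; funext x; rw [← enorm_neg, neg_sub]
  calc ∫⁻ x, ‖cv k (eta r) x - k x‖ₑ
      ≤ ∫⁻ x, (‖cv k (eta r) x - cv g (eta r) x‖ₑ + (‖cv g (eta r) x - g x‖ₑ + ‖g x - k x‖ₑ)) := by
        apply lintegral_mono
        intro x
        have : cv k (eta r) x - k x = (cv k (eta r) x - cv g (eta r) x) +
          ((cv g (eta r) x - g x) + (g x - k x)) := by abel
        simp only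
        rw [this]
        refine (enorm_add_le _ _).trans ?_
        gcongr
        exact enorm_add_le _ _
    _ ≤ ε / 3 + (ε / 3 + ε / 3) := by
        rw [lintegral_add_left', lintegral_add_left']
        · gcongr
        · exact ((cv_aesm hgm hec.aestronglyMeasurable).sub hgm).enorm
        · exact ((cv_aesm hkm hec.aestronglyMeasurable).sub
            (cv_aesm hgm hec.aestronglyMeasurable)).enorm
    _ = ε := by
        rw [← add_assoc]; exact ENNReal.add_thirds ε

lemma moll_tendsto [CompleteSpace E] {k : R2 → E} (hk : Integrable k) {r : ℕ → ℝ}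
    (hr : ∀ n, 0 < r n) (hr0 : Tendsto r atTop (𝓝 0)) :
    Tendsto (fun n => ∫⁻ x, ‖cv k (eta (r n)) x - k x‖ₑ) atTop (𝓝 0) := by
  rw [ENNReal.tendsto_nhds_zero]
  intro ε hε
  obtain ⟨r0, h0, h⟩ := moll_L1 hk hε.ne'
  filter_upwards [hr0.eventually (Iic_mem_nhds h0)] with n hn
  exact h _ (hr n) hn

/-- a.e. convergent subsequence. -/
lemma subseq_ae {μ : Measure R2} {f : ℕ → R2 → E} {g : R2 → E}
    (hf : ∀ n, AEStronglyMeasurable (f n) μ) (hg : AEStronglyMeasurable g μ)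
    (h : Tendsto (fun n => ∫⁻ x, ‖f n x - g x‖ₑ ∂μ) atTop (𝓝 0)) :
    ∃ ns : ℕ → ℕ, StrictMono ns ∧ ∀ᵐ x ∂μ, Tendsto (fun i => f (ns i) x) atTop (𝓝 (g x)) := by
  refine (tendstoInMeasure_of_tendsto_eLpNorm one_ne_zero hf hg ?_).exists_seq_tendsto_ae
  simpa [eLpNorm_one_eq_lintegral_enorm] using h

end Conv

/-- `f` is a bounded strong `W^{1,1}` limit on `B` with gradient `F`. -/
def Appr (B : Set R2) (f : R2 → ℂ) (F : Fin 2 → R2 → ℂ) : Prop :=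
  ∃ fn : ℕ → R2 → ℂ, (∀ n, ContDiffOn ℝ 1 (fn n) B) ∧ (∀ n, ∀ z ∈ B, ‖fn n z‖ ≤ 1) ∧
    (∀ᵐ z ∂(volume.restrict B), Tendsto (fun n => fn n z) atTop (𝓝 (f z))) ∧
    ∀ j, Tendsto (fun n => ∫⁻ z in B, ‖pd j (fn n) z - F j z‖ₑ) atTop (𝓝 0)

lemma pd_continuousOn {E : Type*} [NormedAddCommGroup E] [NormedSpace ℝ E] {B : Set R2}
    (hB : IsOpen B) {f : R2 → E} (hf : ContDiffOn ℝ 1 f B) (j : Fin 2) :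
    ContinuousOn (pd j f) B :=
  (hf.continuousOn_fderiv_of_isOpen hB le_rfl).clm_apply continuousOn_const

lemma Appr.aesm {B : Set R2} (hB : IsOpen B) {f : R2 → ℂ} {F : Fin 2 → R2 → ℂ} (h : Appr B f F) :
    AEStronglyMeasurable f (volume.restrict B) := by
  obtain ⟨fn, h1, h2, h3, h4⟩ := h
  exact aestronglyMeasurable_of_tendsto_ae atTop
    (fun n => (h1 n).continuousOn.aestronglyMeasurable hB.measurableSet) h3

lemma Appr.bdd {B : Set R2} (hB : IsOpen B) {f : R2 → ℂ} {F : Fin 2 → R2 → ℂ} (h : Appr B f F) :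
    ∀ᵐ z ∂(volume.restrict B), ‖f z‖ ≤ 1 := by
  obtain ⟨fn, h1, h2, h3, h4⟩ := h
  filter_upwards [h3, ae_restrict_mem hB.measurableSet] with z hz hzB
  exact le_of_tendsto hz.norm (Eventually.of_forall fun n => h2 n z hzB)

/-- Bounded a.e. convergence against an `L¹` weight. -/
lemma dct_weight {μ : Measure R2} {fn : ℕ → R2 → ℂ} {f : R2 → ℂ} {F : R2 → ℂ}
    (hfm : ∀ n, AEStronglyMeasurable (fn n) μ)
    (hb : ∀ n, ∀ᵐ z ∂μ, ‖fn n z‖ ≤ 1)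
    (hl : ∀ᵐ z ∂μ, Tendsto (fun n => fn n z) atTop (𝓝 (f z))) (hF : Integrable F μ) :
    Tendsto (fun n => ∫⁻ z, ‖fn n z - f z‖ₑ * ‖F z‖ₑ ∂μ) atTop (𝓝 0) := by
  have hm : AEStronglyMeasurable f μ := aestronglyMeasurable_of_tendsto_ae atTop hfm hl
  have hfb : ∀ᵐ z ∂μ, ‖f z‖ ≤ 1 := by
    have := ae_all_iff.2 hb
    filter_upwards [hl, this] with z hz hzB
    exact le_of_tendsto hz.norm (Eventually.of_forall fun n => hzB n)
  have := tendsto_lintegral_of_dominated_convergence' (μ := μ)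
    (F := fun n z => ‖fn n z - f z‖ₑ * ‖F z‖ₑ) (f := fun _ => 0) (fun z => 2 * ‖F z‖ₑ)
    (fun n => ((hfm n).sub hm).enorm.mul hF.aestronglyMeasurable.enorm) ?_ ?_ ?_
  · simpa using this
  · intro n
    filter_upwards [hb n, hfb] with z h1 h2
    gcongr
    rw [← ofReal_norm]
    refine (ENNReal.ofReal_le_ofReal (q := 2) ?_).trans (by simp)
    refine (norm_sub_le _ _).trans (by linarith)
  · rw [lintegral_const_mul'' _ hF.aestronglyMeasurable.enorm]
    exact ENNReal.mul_ne_top (by simp) hF.hasFiniteIntegral.ne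
  · filter_upwards [hl] with z hz
    have h1 : Tendsto (fun n => ‖fn n z - f z‖ₑ) atTop (𝓝 0) := by
      have := (hz.sub_const (f z)).enorm
      simpa using this
    have := ENNReal.Tendsto.mul_const (b := ‖F z‖ₑ) h1 (Or.inr enorm_ne_top)
    simpa using this

lemma squeeze4 {a b c d e : ℕ → ℝ≥0∞} (hb : Tendsto b atTop (𝓝 0)) (hc : Tendsto c atTop (𝓝 0))
    (hd : Tendsto d atTop (𝓝 0)) (he : Tendsto e atTop (𝓝 0))
    (h : ∀ n, a n ≤ b n + c n + d n + e n) : Tendsto a atTop (𝓝 0) := by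
  have : Tendsto (fun n => b n + c n + d n + e n) atTop (𝓝 0) := by
    simpa using ((hb.add hc).add hd).add he
  exact tendsto_of_tendsto_of_tendsto_of_le_of_le tendsto_const_nhds this (fun _ => zero_le) h

lemma pd_mul {f g : R2 → ℂ} {z : R2} (hf : DifferentiableAt ℝ f z) (hg : DifferentiableAt ℝ g z)
    (j : Fin 2) : pd j (fun z => f z * g z) z = pd j f z * g z + f z * pd j g z := by
  unfold pd
  rw [fderiv_fun_mul hf hg]
  simp [mul_comm]; ring

lemma Appr.mul {B : Set R2} (hB : IsOpen B) {f g : R2 → ℂ} {F H : Fin 2 → R2 → ℂ}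
    (hf : Appr B f F) (hg : Appr B g H) (hF : ∀ j, IntegrableOn (F j) B)
    (hH : ∀ j, IntegrableOn (H j) B) :
    Appr B (fun z => f z * g z) (fun j z => F j z * g z + f z * H j z) := by
  have hfm := hf.aesm hB
  have hgm := hg.aesm hB
  obtain ⟨fn, f1, f2, f3, f4⟩ := hf
  obtain ⟨gn, g1, g2, g3, g4⟩ := hg
  refine ⟨fun n z => fn n z * gn n z, fun n => (f1 n).mul (g1 n), ?_, ?_, ?_⟩
  · intro n z hz
    rw [norm_mul]
    exact mul_le_one₀ (f2 n z hz) (norm_nonneg _) (g2 n z hz)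
  · filter_upwards [f3, g3] with z h1 h2 using h1.mul h2
  · intro j
    have mfn : ∀ n, AEStronglyMeasurable (fn n) (volume.restrict B) := fun n =>
      (f1 n).continuousOn.aestronglyMeasurable hB.measurableSet
    have mgn : ∀ n, AEStronglyMeasurable (gn n) (volume.restrict B) := fun n =>
      (g1 n).continuousOn.aestronglyMeasurable hB.measurableSet
    have bfn : ∀ n, ∀ᵐ z ∂(volume.restrict B), ‖fn n z‖ ≤ 1 := fun n => by
      filter_upwards [ae_restrict_mem hB.measurableSet] with z hz using f2 n z hz
    have bgn : ∀ n, ∀ᵐ z ∂(volume.restrict B), ‖gn n z‖ ≤ 1 := fun n => by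
      filter_upwards [ae_restrict_mem hB.measurableSet] with z hz using g2 n z hz
    have t1 := dct_weight mgn bgn g3 (hF j)
    have t2 := dct_weight mfn bfn f3 (hH j)
    refine squeeze4 (f4 j) t1 t2 (g4 j) fun n => ?_
    have mpf : AEStronglyMeasurable (pd j (fn n)) (volume.restrict B) :=
      (pd_continuousOn hB (f1 n) j).aestronglyMeasurable hB.measurableSet
    rw [← lintegral_add_left', ← lintegral_add_left', ← lintegral_add_left']
    · apply setLIntegral_mono_ae' hB.measurableSet
      refine ae_of_all _ fun z hz => ?_
      have df := ((f1 n).differentiableOn (by simp) z hz).differentiableAt (hB.mem_nhds hz)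
      have dg := ((g1 n).differentiableOn (by simp) z hz).differentiableAt (hB.mem_nhds hz)
      rw [pd_mul df dg]
      have e : pd j (fn n) z * gn n z + fn n z * pd j (gn n) z - (F j z * g z + f z * H j z)
        = (pd j (fn n) z - F j z) * gn n z + (gn n z - g z) * F j z + (fn n z - f z) * H j z
          + fn n z * (pd j (gn n) z - H j z) := by ring
      rw [e]
      refine (enorm_add_le _ _).trans (add_le_add ((enorm_add_le _ _).trans
        (add_le_add ((enorm_add_le _ _).trans (add_le_add ?_ ?_)) ?_)) ?_)
      · rw [enorm_mul]
        refine mul_le_of_le_one_right' ?_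
        rw [← ofReal_norm]; exact ENNReal.ofReal_le_one.2 (g2 n z hz)
      · rw [enorm_mul]
      · rw [enorm_mul]
      · rw [enorm_mul]
        refine mul_le_of_le_one_left' ?_
        rw [← ofReal_norm]; exact ENNReal.ofReal_le_one.2 (f2 n z hz)
    · exact (((mpf.sub (hF j).aestronglyMeasurable).enorm).add
        (((mgn n).sub hgm).enorm.mul (hF j).aestronglyMeasurable.enorm)).add
        (((mfn n).sub hfm).enorm.mul (hH j).aestronglyMeasurable.enorm)
    · exact (((mpf.sub (hF j).aestronglyMeasurable).enorm).add
        (((mgn n).sub hgm).enorm.mul (hF j).aestronglyMeasurable.enorm))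
    · exact ((mpf.sub (hF j).aestronglyMeasurable).enorm)

lemma Appr.congr {B : Set R2} {f f' : R2 → ℂ} {F F' : Fin 2 → R2 → ℂ}
    (h : Appr B f F) (hf : ∀ᵐ z ∂(volume.restrict B), f z = f' z)
    (hF : ∀ j, ∀ᵐ z ∂(volume.restrict B), F j z = F' j z) : Appr B f' F' := by
  obtain ⟨fn, h1, h2, h3, h4⟩ := h
  refine ⟨fn, h1, h2, ?_, fun j => ?_⟩
  · filter_upwards [h3, hf] with z a b
    rwa [← b]
  · refine (h4 j).congr fun n => ?_
    apply lintegral_congr_ae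
    filter_upwards [hF j] with z hz
    rw [hz]

lemma Appr.of_contDiff {B : Set R2} {f : R2 → ℂ} (h : ContDiffOn ℝ 1 f B)
    (hb : ∀ z ∈ B, ‖f z‖ ≤ 1) : Appr B f (fun j => pd j f) :=
  ⟨fun _ => f, fun _ => h, fun _ => hb, ae_of_all _ fun _ => tendsto_const_nhds, fun j => by simp⟩

/-- Weak formulation. -/
lemma Appr.weak {B : Set R2} (hB : IsOpen B) {f : R2 → ℂ} {F : Fin 2 → R2 → ℂ} (h : Appr B f F)
    (hF : ∀ j, IntegrableOn (F j) B) {φ : R2 → ℝ} (hφ : ContDiff ℝ (⊤ : ℕ∞) φ)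
    (hc : HasCompactSupport φ) (hs : tsupport φ ⊆ B) (j : Fin 2) :
    ∫ z in B, pd j φ z • f z = - ∫ z in B, φ z • F j z := by
  obtain ⟨fn, h1, h2, h3, h4⟩ := h
  have hφ1 : ContDiff ℝ 1 φ := hφ.of_le (by simp)
  obtain ⟨C, hC⟩ := hc.exists_bound_of_continuous hφ.continuous
  have hpc := pd_continuous hφ1 j
  have hpcs := pd_compact hc j
  obtain ⟨C', hC'⟩ := hpcs.exists_bound_of_continuous hpc
  have hts : tsupport (pd j φ) ⊆ tsupport φ := by
    refine closure_minimal ?_ (isClosed_tsupport _)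
    intro z hz
    by_contra hzn
    apply hz
    unfold pd
    rw [fderiv_of_notMem_tsupport ℝ hzn]; simp
  have mfn : ∀ n, AEStronglyMeasurable (fn n) (volume.restrict B) := fun n =>
    (h1 n).continuousOn.aestronglyMeasurable hB.measurableSet
  -- global integrability
  have gi : ∀ (a : R2 → ℝ) (b : R2 → ℂ), Continuous a → HasCompactSupport a → tsupport a ⊆ B →
      ContinuousOn b B → Integrable (fun z => a z • b z) := by
    intro a b ha hac haB hb
    have : IntegrableOn (fun z => a z • b z) (tsupport a) := by
      apply ContinuousOn.integrableOn_compact hac.isCompact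
      exact ha.continuousOn.smul (hb.mono haB)
    refine (integrableOn_iff_integrable_of_support_subset ?_).1 this
    intro z hz
    apply subset_tsupport
    intro h0
    apply hz
    simp [h0]
  have zo : ∀ (a : R2 → ℝ) (b : R2 → ℂ), tsupport a ⊆ B →
      ∫ z in B, a z • b z = ∫ z, a z • b z := by
    intro a b ha
    apply setIntegral_eq_integral_of_forall_compl_eq_zero
    intro z hz
    have : a z = 0 := by
      by_contra h0
      exact hz (ha (subset_tsupport _ h0))
    simp [this]
  have key : ∀ n, ∫ z in B, pd j φ z • fn n z = - ∫ z in B, φ z • pd j (fn n) z := by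
    intro n
    rw [zo _ _ (hts.trans hs), zo _ _ hs]
    have := integral_smul_fderiv_eq_neg_fderiv_smul_of_integrable (μ := (volume : Measure R2))
      (f := φ) (g := fn n) (v := eb j)
      (gi (pd j φ) (fn n) hpc hpcs (hts.trans hs) (h1 n).continuousOn)
      (gi φ (pd j (fn n)) hφ.continuous hc hs (pd_continuousOn hB (h1 n) j))
      (gi φ (fn n) hφ.continuous hc hs (h1 n).continuousOn)
      (fun x _ => hφ.differentiable (by simp) x)
      (fun x hx => ((h1 n).differentiableOn (by simp) x (hs hx)).differentiableAt
        (hB.mem_nhds (hs hx)))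
    have h2 : ∫ z, φ z • pd j (fn n) z = - ∫ z, pd j φ z • fn n z := this
    rw [h2, neg_neg]
  have l1 : Tendsto (fun n => ∫ z in B, pd j φ z • fn n z) atTop
      (𝓝 (∫ z in B, pd j φ z • f z)) := by
    apply tendsto_integral_of_dominated_convergence (fun z => ‖pd j φ z‖)
    · intro n
      exact hpc.aestronglyMeasurable.smul (mfn n)
    · exact (hpc.integrable_of_hasCompactSupport hpcs).norm.integrableOn
    · intro n
      filter_upwards [ae_restrict_mem hB.measurableSet] with z hz
      rw [norm_smul]
      exact mul_le_of_le_one_right (norm_nonneg _) (h2 n z hz)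
    · filter_upwards [h3] with z hz using hz.const_smul _
  have l2 : Tendsto (fun n => ∫ z in B, φ z • pd j (fn n) z) atTop
      (𝓝 (∫ z in B, φ z • F j z)) := by
    apply tendsto_integral_of_L1
    · exact hφ.continuous.aestronglyMeasurable.smul (hF j).aestronglyMeasurable
    · refine Eventually.of_forall fun n => ?_
      exact (gi φ (pd j (fn n)) hφ.continuous hc hs (pd_continuousOn hB (h1 n) j)).integrableOn
    · have : Tendsto (fun n => ENNReal.ofReal C * ∫⁻ z in B, ‖pd j (fn n) z - F j z‖ₑ) atTop
          (𝓝 0) := by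
        have := ENNReal.Tendsto.const_mul (a := ENNReal.ofReal C) (h4 j) (Or.inr (by simp))
        simpa using this
      refine tendsto_of_tendsto_of_tendsto_of_le_of_le tendsto_const_nhds this (fun _ => zero_le)
        fun n => ?_
      simp only
      rw [← lintegral_const_mul' _ _ (by simp)]
      apply lintegral_mono
      intro z
      simp only
      rw [← smul_sub, enorm_smul]
      gcongr
      rw [← ofReal_norm]
      exact ENNReal.ofReal_le_ofReal (hC z)
  refine tendsto_nhds_unique l1 ?_
  simp_rw [key]
  exact l2.neg

lemma Appr.grad_zero {B : Set R2} (hB : IsOpen B) {F : Fin 2 → R2 → ℂ}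
    (h : Appr B (fun _ => 1) F) (hF : ∀ j, IntegrableOn (F j) B) (j : Fin 2) :
    ∀ᵐ z ∂(volume.restrict B), F j z = 0 := by
  rw [ae_restrict_iff' hB.measurableSet]
  refine hB.ae_eq_zero_of_integral_contDiff_smul_eq_zero (hF j).locallyIntegrableOn ?_
  intro φ hφ hc hs
  have h1 := h.weak hB hF hφ hc hs j
  have h2 := (Appr.of_contDiff (B := B) (f := fun _ => (1 : ℂ)) contDiffOn_const (by simp)).weak hB
    (fun j => by
      have e : pd j (fun _ : R2 => (1 : ℂ)) = fun _ => 0 := by funext z; simp [pd]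
      rw [e]; exact integrableOn_zero) hφ hc hs j
  have h3 : ∫ z in B, φ z • F j z = 0 := by
    rw [h2] at h1
    simpa [pd] using h1
  rw [← h3]
  symm
  apply setIntegral_eq_integral_of_forall_compl_eq_zero
  intro z hz
  have : φ z = 0 := by
    by_contra h0
    exact hz (hs (subset_tsupport _ h0))
  simp [this]

lemma pd_comp_sub {T : R2 → ℝ} (hT : ContDiff ℝ 1 T) (x : R2) (j : Fin 2) (y : R2) :
    pd j (fun y => T (x - y)) y = - pd j T (x - y) := by
  unfold pd
  have h1 : HasFDerivAt (fun y : R2 => x - y) (-ContinuousLinearMap.id ℝ R2) y := by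
    have := (hasFDerivAt_id (𝕜 := ℝ) y).const_sub x
    exact this
  have h := ((hT.differentiable (by simp) (x - y)).hasFDerivAt).comp y h1
  have h2 : fderiv ℝ (fun y => T (x - y)) y = _ := h.fderiv
  rw [h2]; simp

lemma tsupport_comp_sub {T : R2 → ℝ} {r : ℝ} (hT : Function.support T ⊆ closedBall 0 r) (x : R2) :
    tsupport (fun y => T (x - y)) ⊆ closedBall x r := by
  refine closure_minimal ?_ isClosed_closedBall
  intro y hy
  have := hT (show x - y ∈ Function.support T from hy)
  rw [mem_closedBall_zero_iff] at this
  rwa [mem_closedBall, dist_comm, dist_eq_norm]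

lemma hcs_comp_sub {T : R2 → ℝ} {r : ℝ} (hT : Function.support T ⊆ closedBall 0 r) (x : R2) :
    HasCompactSupport (fun y => T (x - y)) :=
  (isCompact_closedBall x r).of_isClosed_subset (isClosed_tsupport _) (tsupport_comp_sub hT x)

lemma fderiv_zero_of_pd {E : Type*} [NormedAddCommGroup E] [NormedSpace ℝ E] {f : R2 → E} {z : R2}
    (h : ∀ j, pd j f z = 0) : fderiv ℝ f z = 0 := by
  ext v
  have hv : v = v 0 • eb 0 + v 1 • eb 1 := by
    ext i; fin_cases i <;> simp [eb]
  rw [hv, map_add, map_smul, map_smul]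
  have h0 := h 0
  have h1 := h 1
  unfold pd at h0 h1
  rw [h0, h1]; simp

/-- A map with zero gradient is a.e. constant on a ball. -/
lemma Appr.const {p : R2} {R : ℝ} (hR : 0 < R) {f : R2 → ℂ}
    (h : Appr (ball p R) f (fun _ _ => 0)) :
    ∃ c : ℂ, ∀ᵐ z ∂(volume.restrict (ball p R)), f z = c := by
  have hB : IsOpen (ball p R) := isOpen_ball
  have hm := h.aesm hB
  have hb := h.bdd hB
  haveI : IsFiniteMeasure ((volume : Measure R2).restrict (ball p R)) :=
    ⟨by rw [Measure.restrict_apply_univ]; exact measure_ball_lt_top⟩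
  have hfi : IntegrableOn f (ball p R) := Integrable.of_bound hm 1 hb
  set g := (ball p R).indicator f with hg
  have hgi : Integrable g := (integrable_indicator_iff measurableSet_ball).2 hfi
  set r : ℕ → ℝ := fun n => 1 / ((n : ℝ) + 1) with hrdef
  have hr : ∀ n, 0 < r n := fun n => by positivity
  have hr0 : Tendsto r atTop (𝓝 0) := tendsto_one_div_add_atTop_nhds_zero_nat
  obtain ⟨ns, hns, hae⟩ := subseq_ae (μ := volume) (fun n => cv_aesm hgi.aestronglyMeasurable
    (eta_contDiff (r n)).continuous.aestronglyMeasurable) hgi.aestronglyMeasurable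
    (moll_tendsto hgi hr hr0)
  have hr0' : Tendsto (fun n => r (ns n)) atTop (𝓝 0) := hr0.comp hns.tendsto_atTop
  have hder : ∀ n, ∀ x ∈ ball p (R - r n), fderiv ℝ (cv g (eta (r n))) x = 0 := by
    intro n x hx
    apply fderiv_zero_of_pd
    intro j
    have he1 : ContDiff ℝ 1 (eta (r n)) := (eta_contDiff _).of_le (by simp)
    rw [pd_cv hgi he1 (eta_compact (hr n))]
    have hsub : closedBall x (r n) ⊆ ball p R := by
      apply closedBall_subset_ball'
      rw [mem_ball] at hx; linarith
    have hw := h.weak hB (fun j => by simp) (φ := fun y => eta (r n) (x - y))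
      ((eta_contDiff _).comp (by fun_prop)) (hcs_comp_sub (eta_support (hr n)) x)
      ((tsupport_comp_sub (eta_support (hr n)) x).trans hsub) j
    simp only [smul_zero, integral_zero, neg_zero] at hw
    simp_rw [pd_comp_sub he1, neg_smul] at hw
    rw [integral_neg, neg_eq_zero, ← integral_indicator measurableSet_ball] at hw
    rw [← hw]
    unfold cv
    congr 1
    funext y
    by_cases hy : y ∈ ball p R <;> simp [hg, indicator, hy]
  have hlim : ∀ x ∈ ball p R, ∀ x' ∈ ball p R,
      Tendsto (fun i => cv g (eta (r (ns i))) x) atTop (𝓝 (g x)) →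
      Tendsto (fun i => cv g (eta (r (ns i))) x') atTop (𝓝 (g x')) → f x = f x' := by
    intro x hx x' hx' h1 h2
    have e1 : g x = f x := indicator_of_mem hx _
    have e2 : g x' = f x' := indicator_of_mem hx' _
    rw [← e1, ← e2]
    refine tendsto_nhds_unique h1 (h2.congr' ?_)
    rw [mem_ball] at hx hx'
    have hpos : 0 < min (R - dist x p) (R - dist x' p) := by
      apply lt_min <;> linarith
    filter_upwards [hr0'.eventually (Iio_mem_nhds hpos)] with i hi
    have hi1 : r (ns i) < R - dist x p := lt_of_lt_of_le hi (min_le_left _ _)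
    have hi2 : r (ns i) < R - dist x' p := lt_of_lt_of_le hi (min_le_right _ _)
    refine isOpen_ball.is_const_of_fderiv_eq_zero (𝕜 := ℝ)
      (convex_ball p (R - r (ns i))).isPreconnected ?_ (fun z hz => hder (ns i) z hz) ?_ ?_
    · exact ((cv_contDiff hgi (eta_contDiff _) (eta_compact (hr _))).differentiable
        (by simp)).differentiableOn
    · rw [mem_ball]; linarith
    · rw [mem_ball]; linarith
  by_cases hex : ∃ x ∈ ball p R, Tendsto (fun i => cv g (eta (r (ns i))) x) atTop (𝓝 (g x))
  · obtain ⟨x, hx, hxt⟩ := hex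
    refine ⟨f x, ?_⟩
    filter_upwards [ae_restrict_of_ae hae, ae_restrict_mem measurableSet_ball] with z hz hzB
    exact hlim z hzB x hx hz hxt
  · refine ⟨0, ?_⟩
    filter_upwards [ae_restrict_of_ae hae, ae_restrict_mem measurableSet_ball] with z hz hzB
    exact absurd ⟨z, hzB, hz⟩ hex

lemma cv_indicator {E : Type*} [NormedAddCommGroup E] [NormedSpace ℝ E] {Ω : Set R2}
    (hΩ : MeasurableSet Ω) (f : R2 → E) (T : R2 → ℝ) (x : R2) :
    cv (Ω.indicator f) T x = ∫ y in Ω, T (x - y) • f y := by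
  rw [← integral_indicator hΩ]
  unfold cv
  congr 1
  funext y
  by_cases hy : y ∈ Ω <;> simp [indicator, hy]

lemma Appr.of_weak {Ω B : Set R2} (hΩ : IsOpen Ω) (hB : IsOpen B) {δ : ℝ} (hδ : 0 < δ)
    (hsub : ∀ z ∈ B, closedBall z δ ⊆ Ω) {f : R2 → ℂ} {F : Fin 2 → R2 → ℂ}
    (hf : IntegrableOn f Ω) (hb : ∀ᵐ z ∂(volume.restrict Ω), ‖f z‖ ≤ 1)
    (hF : ∀ j, IntegrableOn (F j) Ω)
    (hw : ∀ φ : R2 → ℝ, ContDiff ℝ (⊤ : ℕ∞) φ → HasCompactSupport φ → tsupport φ ⊆ Ω →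
      ∀ j, ∫ z in Ω, pd j φ z • f z = - ∫ z in Ω, φ z • F j z) : Appr B f F := by
  have hBΩ : B ⊆ Ω := fun z hz => hsub z hz (mem_closedBall_self hδ.le)
  set g := Ω.indicator f with hg
  have hgi : Integrable g := (integrable_indicator_iff hΩ.measurableSet).2 hf
  have hFi : ∀ j, Integrable (Ω.indicator (F j)) := fun j =>
    (integrable_indicator_iff hΩ.measurableSet).2 (hF j)
  have hgb : ∀ᵐ z, ‖g z‖ ≤ 1 := by
    rw [ae_restrict_iff' hΩ.measurableSet] at hb
    filter_upwards [hb] with z hz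
    by_cases h : z ∈ Ω
    · rw [hg, indicator_of_mem h]; exact hz h
    · rw [hg, indicator_of_notMem h]; simp
  set r : ℕ → ℝ := fun n => δ * (1 / ((n : ℝ) + 1)) with hrdef
  have hr : ∀ n, 0 < r n := fun n => by positivity
  have hrδ : ∀ n, r n ≤ δ := fun n => by
    refine mul_le_of_le_one_right hδ.le ?_
    rw [div_le_one (by positivity)]
    have : (0 : ℝ) ≤ n := by positivity
    linarith
  have hr0 : Tendsto r atTop (𝓝 0) := by
    have := tendsto_one_div_add_atTop_nhds_zero_nat (𝕜 := ℝ) |>.const_mul δ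
    rw [mul_zero] at this; exact this
  obtain ⟨ns, hns, hae⟩ := subseq_ae (μ := volume) (fun n => cv_aesm hgi.aestronglyMeasurable
    (eta_contDiff (r n)).continuous.aestronglyMeasurable) hgi.aestronglyMeasurable
    (moll_tendsto hgi hr hr0)
  refine ⟨fun n => cv g (eta (r (ns n))), ?_, ?_, ?_, ?_⟩
  · intro n
    exact ((cv_contDiff hgi (eta_contDiff _) (eta_compact (hr _))).of_le (by simp)).contDiffOn
  · intro n z _
    unfold cv
    calc ‖∫ y, eta (r (ns n)) (z - y) • g y‖ ≤ ∫ y, eta (r (ns n)) (z - y) := by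
          apply norm_integral_le_of_norm_le (eta_integrable_sub (hr _) z)
          filter_upwards [hgb] with y hy
          rw [norm_smul, Real.norm_of_nonneg (eta_nonneg _ _)]
          exact mul_le_of_le_one_right (eta_nonneg _ _) hy
      _ = 1 := eta_integral_sub (hr _) z
  · filter_upwards [ae_restrict_of_ae hae, ae_restrict_mem hB.measurableSet] with z hz hzB
    rwa [hg, indicator_of_mem (hBΩ hzB)] at hz
  · intro j
    have ht := (moll_tendsto (hFi j) hr hr0).comp hns.tendsto_atTop
    refine tendsto_of_tendsto_of_tendsto_of_le_of_le tendsto_const_nhds ht (fun _ => zero_le)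
      fun n => ?_
    refine le_trans ?_ (setLIntegral_le_lintegral B _)
    apply setLIntegral_mono_ae' hB.measurableSet
    refine ae_of_all _ fun z hz => ?_
    have he1 : ContDiff ℝ 1 (eta (r (ns n))) := (eta_contDiff _).of_le (by simp)
    have hball : closedBall z (r (ns n)) ⊆ Ω :=
      (closedBall_subset_closedBall (hrδ _)).trans (hsub z hz)
    have h1 := hw (fun y => eta (r (ns n)) (z - y)) ((eta_contDiff _).comp (by fun_prop))
      (hcs_comp_sub (eta_support (hr _)) z)
      ((tsupport_comp_sub (eta_support (hr _)) z).trans hball) j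
    simp_rw [pd_comp_sub he1, neg_smul] at h1
    rw [integral_neg, neg_inj] at h1
    have h2 : pd j (cv g (eta (r (ns n)))) z = cv (Ω.indicator (F j)) (eta (r (ns n))) z := by
      rw [pd_cv hgi he1 (eta_compact (hr _))]
      rw [hg, cv_indicator hΩ.measurableSet, cv_indicator hΩ.measurableSet, h1]
    rw [h2, indicator_of_mem (hBΩ hz)]

/-- Unit complex number of phase `t`. -/
def ex (t : ℝ) : ℂ := Complex.exp (t * Complex.I)

lemma ex_norm (t : ℝ) : ‖ex t‖ = 1 := Complex.norm_exp_ofReal_mul_I t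

lemma ex_add (a b : ℝ) : ex (a + b) = ex a * ex b := by
  unfold ex; rw [← Complex.exp_add]; push_cast; ring_nf

lemma ex_zero : ex 0 = 1 := by simp [ex]

lemma ex_contDiff {n : WithTop ℕ∞} : ContDiff ℝ n ex := by
  unfold ex
  exact (Complex.ofRealCLM.contDiff.mul contDiff_const).cexp

lemma pd_ex {l : R2 → ℝ} {z : R2} (h : DifferentiableAt ℝ l z) (j : Fin 2) :
    pd j (fun z => ex (l z)) z = ((pd j l z : ℝ) : ℂ) * Complex.I * ex (l z) := by
  have h1 : HasFDerivAt (fun z => ((l z : ℝ) : ℂ)) (Complex.ofRealCLM.comp (fderiv ℝ l z)) z :=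
    Complex.ofRealCLM.hasFDerivAt.comp z h.hasFDerivAt
  have h2 := (h1.mul_const Complex.I).cexp
  unfold pd
  have h3 : fderiv ℝ (fun z => ex (l z)) z = _ := h2.fderiv
  rw [h3]
  simp [ex]; ring

lemma ex_lip (a b : ℝ) : ‖ex a - ex b‖ ≤ |a - b| := by
  have h : ex a - ex b = ex b * (ex (a - b) - 1) := by
    rw [mul_sub, ← ex_add]; simp
  rw [h, norm_mul, ex_norm, one_mul]
  unfold ex
  have := Real.norm_exp_I_mul_ofReal_sub_one_le (x := a - b)
  rw [mul_comm] at this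
  simpa using this

lemma Appr.exp {B : Set R2} (hB : IsOpen B) {l : R2 → ℝ} {D : Fin 2 → R2 → ℝ} {ln : ℕ → R2 → ℝ}
    (h1 : ∀ n, ContDiffOn ℝ 1 (ln n) B)
    (h2 : ∀ᵐ z ∂(volume.restrict B), Tendsto (fun n => ln n z) atTop (𝓝 (l z)))
    (h3 : ∀ j, Tendsto (fun n => ∫⁻ z in B, ‖pd j (ln n) z - D j z‖ₑ) atTop (𝓝 0))
    (hD : ∀ j, IntegrableOn (D j) B) :
    Appr B (fun z => ex (l z)) (fun j z => (D j z : ℂ) * Complex.I * ex (l z)) := by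
  have mfn : ∀ n, AEStronglyMeasurable (fun z => ex (ln n z)) (volume.restrict B) := fun n =>
    (ex_contDiff (n := 0).continuous.comp_continuousOn
      (h1 n).continuousOn).aestronglyMeasurable hB.measurableSet
  have hl : ∀ᵐ z ∂(volume.restrict B), Tendsto (fun n => ex (ln n z)) atTop (𝓝 (ex (l z))) := by
    filter_upwards [h2] with z hz
    exact ((ex_contDiff (n := 0)).continuous.tendsto _).comp hz
  refine ⟨fun n z => ex (ln n z), fun n => ex_contDiff.comp_contDiffOn (h1 n),
    fun n z _ => (ex_norm _).le, hl, fun j => ?_⟩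
  have hDc : IntegrableOn (fun z => (D j z : ℂ)) B := (hD j).ofReal
  have t1 := dct_weight mfn (fun n => ae_of_all _ fun z => (ex_norm _).le) hl hDc
  refine squeeze4 (h3 j) t1 tendsto_const_nhds tendsto_const_nhds (c := fun n => _)
    (d := fun _ => 0) (e := fun _ => 0) fun n => ?_
  simp only [add_zero]
  rw [← lintegral_add_left']
  · apply setLIntegral_mono_ae' hB.measurableSet
    refine ae_of_all _ fun z hz => ?_
    have df := ((h1 n).differentiableOn (by simp) z hz).differentiableAt (hB.mem_nhds hz)
    rw [pd_ex df]
    have e : ((pd j (ln n) z : ℝ) : ℂ) * Complex.I * ex (ln n z) - (D j z : ℂ) * Complex.I * ex (l z)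
      = ((pd j (ln n) z - D j z : ℝ) : ℂ) * (Complex.I * ex (ln n z))
        + (ex (ln n z) - ex (l z)) * (D j z : ℂ) * Complex.I := by push_cast; ring
    rw [e]
    refine (enorm_add_le _ _).trans (add_le_add ?_ ?_)
    · rw [← ofReal_norm, norm_mul, norm_mul, ex_norm, Complex.norm_I, Complex.norm_real,
        mul_one, mul_one, ofReal_norm]
    · rw [← ofReal_norm, norm_mul, norm_mul, Complex.norm_I, mul_one, ENNReal.ofReal_mul
        (norm_nonneg _), ofReal_norm, ofReal_norm]
  · exact ((pd_continuousOn hB (h1 n) j).aestronglyMeasurable hB.measurableSet |>.sub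
      (hD j).aestronglyMeasurable).enorm

/-- Rotated kernel `∇^⊥ log|z|`. -/
def Th (j : Fin 2) (z : R2) : ℝ := ![-kerS 1 z, kerS 0 z] j

/-- Vortex map of degree `s = ±1` at `p`. -/
def Q (s : ℝ) (p z : R2) : ℂ :=
  (((z 0 - p 0 : ℝ) : ℂ) + ((s * (z 1 - p 1) : ℝ) : ℂ) * Complex.I) * ((‖z - p‖⁻¹ : ℝ) : ℂ)

lemma Th_abs_le (j : Fin 2) (z : R2) : |Th j z| ≤ ‖z‖⁻¹ := by
  fin_cases j
  · simpa [Th] using kerS_abs_le 1 z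
  · simpa [Th] using kerS_abs_le 0 z

lemma Th_measurable (j : Fin 2) : Measurable (Th j) := by
  fin_cases j
  · exact (kerS_measurable 1).neg
  · exact kerS_measurable 0

lemma Th_integrableOn {B : Set R2} (hB : Bornology.IsBounded B) (p : R2) (j : Fin 2) :
    IntegrableOn (fun z => Th j (z - p)) B := by
  refine (invnorm_integrableOn_of_bounded hB p).mono' ?_ (ae_of_all _ fun z => Th_abs_le j _)
  exact ((Th_measurable j).comp (measurable_id.sub_const p)).aestronglyMeasurable

lemma sq_one_of {s : ℝ} (hs : s = 1 ∨ s = -1) : s * s = 1 := by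
  rcases hs with h | h <;> rw [h] <;> norm_num

lemma Q_norm {s : ℝ} (hs : s = 1 ∨ s = -1) {p z : R2} (h : z ≠ p) : ‖Q s p z‖ = 1 := by
  have hp : 0 < ‖z - p‖ := norm_pos_iff.2 (sub_ne_zero.2 h)
  unfold Q
  rw [norm_mul, Complex.norm_real, Real.norm_of_nonneg (by positivity)]
  have : ‖(((z 0 - p 0 : ℝ) : ℂ) + ((s * (z 1 - p 1) : ℝ) : ℂ) * Complex.I)‖ = ‖z - p‖ := by
    rw [Complex.norm_add_mul_I, EuclideanSpace.norm_eq]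
    congr 1
    simp [Fin.sum_univ_two]
    have := sq_one_of hs
    linear_combination (z 1 - p 1) ^ 2 * this
  rw [this]; field_simp

lemma Q_norm_le {s : ℝ} (hs : s = 1 ∨ s = -1) (p z : R2) : ‖Q s p z‖ ≤ 1 := by
  by_cases h : z = p
  · subst h; simp [Q]
  · exact (Q_norm hs h).le

lemma Q_contDiffAt (s : ℝ) {p z : R2} (h : z ≠ p) : ContDiffAt ℝ (⊤ : ℕ∞) (Q s p) z := by
  unfold Q
  have hn : ContDiffAt ℝ (⊤ : ℕ∞) (fun z : R2 => ‖z - p‖) z :=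
    (contDiffAt_id.sub contDiffAt_const).norm ℝ (sub_ne_zero.2 h)
  have hni := hn.inv (norm_ne_zero_iff.2 (sub_ne_zero.2 h))
  have c := fun j => ((coord_contDiff (n := (⊤ : ℕ∞)) j).contDiffAt (x := z)).sub
    (contDiffAt_const (c := p j))
  have oR : ∀ {f : R2 → ℝ}, ContDiffAt ℝ (⊤ : ℕ∞) f z →
      ContDiffAt ℝ (⊤ : ℕ∞) (fun z => (f z : ℂ)) z :=
    fun hf => Complex.ofRealCLM.contDiff.contDiffAt.comp z hf
  exact ((oR (c 0)).add ((oR ((contDiffAt_const (c := s)).mul (c 1))).mul contDiffAt_const)).mul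
    (oR hni)

lemma pd_Q {s : ℝ} (hs : s = 1 ∨ s = -1) {p z : R2} (h : z ≠ p) (j : Fin 2) :
    pd j (Q s p) z = ((s * Th j (z - p) : ℝ) : ℂ) * Complex.I * Q s p z := by
  have hz : z - p ≠ 0 := sub_ne_zero.2 h
  have hp : 0 < ‖z - p‖ := norm_pos_iff.2 hz
  have hsq : HasFDerivAt (fun z : R2 => ‖z - p‖ ^ 2) (2 • innerSL ℝ (z - p)) z := by
    have := (normSq_hasFDerivAt (z - p)).comp z ((hasFDerivAt_id z).sub_const p)
    exact this
  have hn : HasFDerivAt (fun z : R2 => ‖z - p‖⁻¹)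
      ((-(1 / (2 * ‖z - p‖ ^ 3))) • (2 • innerSL ℝ (z - p))) z := by
    have h1 := (hsq.sqrt (by positivity))
    have h2 := ((hasDerivAt_inv (x := Real.sqrt (‖z - p‖ ^ 2)) (by
      rw [Real.sqrt_sq hp.le]; exact hp.ne'))).comp_hasFDerivAt z h1
    have e : (fun z : R2 => ‖z - p‖⁻¹) = (fun y => y⁻¹) ∘ fun z : R2 => Real.sqrt (‖z - p‖ ^ 2) := by
      funext y; simp [Real.sqrt_sq]
    rw [e]
    refine h2.congr_fderiv ?_
    rw [Real.sqrt_sq hp.le, smul_smul]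
    congr 1
    field_simp
  have c0 := (Complex.ofRealCLM.hasFDerivAt).comp z ((coord_hasFDerivAt 0 z).sub_const (p 0))
  have c1 := (Complex.ofRealCLM.hasFDerivAt).comp z
    (((coord_hasFDerivAt 1 z).sub_const (p 1)).const_mul s)
  have c2 := (Complex.ofRealCLM.hasFDerivAt).comp z hn
  have hQ : HasFDerivAt (Q s p) _ z := (c0.add (c1.mul_const Complex.I)).mul c2
  unfold pd
  rw [hQ.fderiv]
  have hN := R2_normSq (z - p)
  have hss := sq_one_of hs
  have hi0 := inner_eb (z - p) 0
  have hi1 := inner_eb (z - p) 1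
  simp at hN hi0 hi1
  set a := z 0 - p 0
  set b := z 1 - p 1
  set N := ‖z - p‖ with hNdef
  have hsC : (s : ℂ) * s = 1 := by exact_mod_cast hss
  have hNC : (N : ℂ) ^ 2 = (a : ℂ) ^ 2 + (b : ℂ) ^ 2 := by exact_mod_cast hN
  have hN0 : (N : ℂ) ≠ 0 := by exact_mod_cast hp.ne'
  have ea : (a : ℂ) = (z 0 : ℂ) - (p 0 : ℂ) := by push_cast [a]; rfl
  have eb' : (b : ℂ) = (z 1 : ℂ) - (p 1 : ℂ) := by push_cast [b]; rfl
  fin_cases j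
  · simp [eb_apply, Th, kerS, Q, ← hNdef]
    field_simp
    rw [inner_eb, inner_eb, ← ea, ← eb']
    linear_combination hNC + (b : ℂ) ^ 2 * Complex.I ^ 2 * hsC + (b : ℂ) ^ 2 * Complex.I_sq
  · simp [eb_apply, Th, kerS, Q, ← hNdef]
    field_simp
    rw [inner_eb, inner_eb, ← ea, ← eb']
    linear_combination s * Complex.I * hNC - (a : ℂ) * b * Complex.I ^ 2 * hsC
      - (a : ℂ) * b * Complex.I_sq

lemma pd_cut_abs {r : ℝ} (hr : 0 < r) (j : Fin 2) (z : R2) :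
    |pd j (cut r) z| ≤ 2 * Real.pi * r * eta r z := by
  have h0 := eta_nonneg r z
  by_cases h : r < ‖z‖
  · have := eta_of_gt hr h
    have h2 : deriv nn (‖z‖ ^ 2 / r ^ 2) = 0 := by
      unfold eta at this
      have : deriv nn (‖z‖ ^ 2 / r ^ 2) = 0 ∨ Real.pi * r ^ 2 = 0 := div_eq_zero_iff.1 this
      rcases this with h | h
      · exact h
      · exfalso; have := Real.pi_pos; have : 0 < Real.pi * r ^ 2 := by positivity
        linarith
    rw [pd_cut, h2]
    simp
    have := Real.pi_pos; positivity
  · have hz := abs_coord_le z j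
    have e : pd j (cut r) z = 2 * Real.pi * z j * eta r z := by
      rw [pd_cut]; unfold eta
      have := Real.pi_pos
      field_simp
    rw [e, abs_mul, abs_of_nonneg h0, abs_mul, abs_of_nonneg (by have := Real.pi_pos; positivity)]
    have := Real.pi_pos
    have : |z j| ≤ r := hz.trans (not_lt.1 h)
    gcongr

lemma pd_cut_lintegral {r : ℝ} (hr : 0 < r) (j : Fin 2) (p : R2) :
    ∫⁻ z, ‖pd j (cut r) (z - p)‖ₑ ≤ ENNReal.ofReal (2 * Real.pi * r) := by
  rw [lintegral_sub_right_eq_self (fun z => ‖pd j (cut r) z‖ₑ) p]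
  calc ∫⁻ z, ‖pd j (cut r) z‖ₑ ≤ ∫⁻ z, ENNReal.ofReal (2 * Real.pi * r) * ‖eta r z‖ₑ := by
        refine lintegral_mono fun z => ?_
        rw [← ofReal_norm, ← ofReal_norm, ← ENNReal.ofReal_mul (by have := Real.pi_pos; positivity)]
        refine ENNReal.ofReal_le_ofReal ?_
        rw [Real.norm_eq_abs, Real.norm_of_nonneg (eta_nonneg r z)]
        exact pd_cut_abs hr j z
    _ = _ := by
        rw [lintegral_const_mul' _ _ ENNReal.ofReal_ne_top, eta_lintegral hr, mul_one]

/-- Regularised vortex. -/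
def cQ (r s : ℝ) (p z : R2) : ℂ := (cut r (z - p) : ℂ) * Q s p z

lemma cQ_eventually {r : ℝ} (hr : 0 < r) (s : ℝ) (p : R2) :
    cQ r s p =ᶠ[𝓝 p] fun _ => 0 := by
  filter_upwards [ball_mem_nhds p (half_pos hr)] with z hz
  have : cut r (z - p) = 0 := cut_of_le hr (by rw [← dist_eq_norm]; exact (mem_ball.1 hz).le)
  simp [cQ, this]

lemma cut_sub_contDiff (r : ℝ) (p : R2) :
    ContDiff ℝ (⊤ : ℕ∞) (fun z : R2 => (cut r (z - p) : ℂ)) :=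
  Complex.ofRealCLM.contDiff.comp ((cut_contDiff r).comp (contDiff_id.sub contDiff_const))

lemma cQ_contDiff {r : ℝ} (hr : 0 < r) (s : ℝ) (p : R2) : ContDiff ℝ (⊤ : ℕ∞) (cQ r s p) := by
  rw [contDiff_iff_contDiffAt]
  intro z
  by_cases h : z = p
  · subst h
    exact contDiffAt_const.congr_of_eventuallyEq (cQ_eventually hr s z)
  · exact (cut_sub_contDiff r p).contDiffAt.mul (Q_contDiffAt s h)

lemma pd_congr {E : Type*} [NormedAddCommGroup E] [NormedSpace ℝ E] {f g : R2 → E} {z : R2}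
    (h : f =ᶠ[𝓝 z] g) (j : Fin 2) : pd j f z = pd j g z := by
  unfold pd; rw [h.fderiv_eq]

lemma pd_ofReal {f : R2 → ℝ} {z : R2} (hf : DifferentiableAt ℝ f z) (j : Fin 2) :
    pd j (fun z => (f z : ℂ)) z = ((pd j f z : ℝ) : ℂ) := by
  have := (Complex.ofRealCLM.hasFDerivAt).comp z hf.hasFDerivAt
  have e : HasFDerivAt (fun z => (f z : ℂ)) _ z := this
  unfold pd; rw [e.fderiv]; simp

lemma pd_sub_const {E : Type*} [NormedAddCommGroup E] [NormedSpace ℝ E] (f : R2 → E) (z p : R2)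
    (j : Fin 2) : pd j (fun z => f (z - p)) z = pd j f (z - p) := by
  unfold pd; simp only [sub_eq_add_neg]; rw [fderiv_comp_add_right]

lemma Q_self (s : ℝ) (p : R2) : Q s p p = 0 := by simp [Q]

lemma pd_cQ {r s : ℝ} (hr : 0 < r) (hs : s = 1 ∨ s = -1) (p z : R2) (j : Fin 2) :
    pd j (cQ r s p) z = ((pd j (cut r) (z - p) : ℝ) : ℂ) * Q s p z
      + (cut r (z - p) : ℂ) * (((s * Th j (z - p) : ℝ) : ℂ) * Complex.I * Q s p z) := by
  by_cases h : z = p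
  · subst h
    rw [pd_congr (cQ_eventually hr s z), Q_self]
    simp [pd]
  · have h1 : DifferentiableAt ℝ (fun z : R2 => cut r (z - p)) z :=
      ((cut_contDiff r).differentiable (by simp) _).comp z
        (differentiableAt_id.sub_const p)
    have h2 : DifferentiableAt ℝ (fun z : R2 => (cut r (z - p) : ℂ)) z :=
      (cut_sub_contDiff r p).differentiable (by simp) z
    rw [show cQ r s p = fun z => (cut r (z - p) : ℂ) * Q s p z from rfl,
      pd_mul h2 ((Q_contDiffAt s h).differentiableAt (by simp)), pd_Q hs h, pd_ofReal h1,
      pd_sub_const]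

lemma cQ_norm_le {r s : ℝ} (hs : s = 1 ∨ s = -1) (p z : R2) : ‖cQ r s p z‖ ≤ 1 := by
  unfold cQ
  rw [norm_mul, Complex.norm_real, Real.norm_of_nonneg (cut_nonneg r _)]
  exact mul_le_one₀ (cut_le_one r _) (norm_nonneg _) (Q_norm_le hs p z)

lemma Q_measurable (s : ℝ) (p : R2) : Measurable (Q s p) := by
  unfold Q
  have : ∀ j, Measurable (fun z : R2 => z j) := fun j => by fun_prop
  refine Measurable.mul ?_ ?_
  · exact (Complex.measurable_ofReal.comp ((this 0).sub_const _)).add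
      ((Complex.measurable_ofReal.comp (((this 1).sub_const _).const_mul s)).mul_const _)
  · exact Complex.measurable_ofReal.comp (measurable_id.sub_const p).norm.inv

/-- phase-gradient of `Q` times `Q`. -/
lemma QF_integrableOn {B : Set R2} (hB : Bornology.IsBounded B) {s : ℝ} (hs : s = 1 ∨ s = -1)
    (p : R2) (j : Fin 2) :
    IntegrableOn (fun z => ((s * Th j (z - p) : ℝ) : ℂ) * Complex.I * Q s p z) B := by
  have h := ((Th_integrableOn hB p j).const_mul s).ofReal (𝕜 := ℂ)
  refine h.mono ((h.aestronglyMeasurable.mul_const _).mul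
    (Q_measurable s p).aestronglyMeasurable) (ae_of_all _ fun z => ?_)
  rw [norm_mul, norm_mul, Complex.norm_I, mul_one]
  exact mul_le_of_le_one_right (norm_nonneg _) (Q_norm_le hs p z)

lemma Appr.Q {B : Set R2} (hBo : IsOpen B) (hB : Bornology.IsBounded B) {s : ℝ}
    (hs : s = 1 ∨ s = -1) (p : R2) :
    Appr B (Q s p) (fun j z => ((s * Th j (z - p) : ℝ) : ℂ) * Complex.I * Q s p z) := by
  set r : ℕ → ℝ := fun n => 1 / ((n : ℝ) + 1)
  have hr : ∀ n, 0 < r n := fun n => by positivity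
  have hrl : Tendsto r atTop (𝓝 0) := tendsto_one_div_add_atTop_nhds_zero_nat
  have hne : ∀ᵐ z ∂(volume.restrict B), z ≠ p :=
    ae_restrict_of_ae (by simp [ae_iff])
  have hc : ∀ᵐ z ∂(volume.restrict B),
      Tendsto (fun n => (cut (r n) (z - p) : ℂ)) atTop (𝓝 1) := by
    filter_upwards [hne] with z hz
    have hp : 0 < ‖z - p‖ := norm_pos_iff.2 (sub_ne_zero.2 hz)
    refine tendsto_const_nhds.congr' ?_
    filter_upwards [hrl.eventually (ge_mem_nhds hp)] with n hn
    rw [cut_of_ge (hr n) hn]; simp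
  refine ⟨fun n => cQ (r n) s p, fun n => ((cQ_contDiff (hr n) s p).of_le (by simp)).contDiffOn,
    fun n z _ => cQ_norm_le hs p z, ?_, fun j => ?_⟩
  · filter_upwards [hc] with z hz
    simpa [cQ] using hz.mul_const (_root_.Q s p z)
  · have t1 := dct_weight (μ := volume.restrict B) (fun n => ((cut_sub_contDiff (r n)
      p).continuous.aestronglyMeasurable)) (fun n => ae_of_all _ fun z => by
        rw [Complex.norm_real, Real.norm_of_nonneg (cut_nonneg _ _)]; exact cut_le_one _ _) hc
        (QF_integrableOn hB hs p j)
    have t2 : Tendsto (fun n => ENNReal.ofReal (2 * Real.pi * r n)) atTop (𝓝 0) := by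
      rw [← ENNReal.ofReal_zero]
      refine (ENNReal.continuous_ofReal.tendsto _).comp ?_
      simpa using hrl.const_mul (2 * Real.pi)
    refine squeeze4 t2 t1 tendsto_const_nhds tendsto_const_nhds (c := fun n => _)
      (d := fun _ => 0) (e := fun _ => 0) fun n => ?_
    simp only [add_zero]
    refine le_trans ?_ (add_le_add_left (pd_cut_lintegral (hr n) j p) _)
    refine le_trans ?_ (add_le_add_left (setLIntegral_le_lintegral B _) _)
    have mm : Measurable fun z => ‖pd j (cut (r n)) (z - p)‖ₑ :=
      (((pd_continuous ((cut_contDiff (r n)).of_le (by simp)) j).comp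
        (continuous_id.sub continuous_const)).measurable).enorm
    rw [← lintegral_add_left mm]
    refine lintegral_mono fun z => ?_
    rw [pd_cQ (hr n) hs]
    have e : ∀ a b c d : ℂ, a * b + c * d - d = a * b + (c - 1) * d := fun a b c d => by ring
    rw [e]
    refine (enorm_add_le _ _).trans (add_le_add ?_ ?_)
    · rw [← ofReal_norm, norm_mul, Complex.norm_real, ← ofReal_norm]
      exact ENNReal.ofReal_le_ofReal (mul_le_of_le_one_right (norm_nonneg _) (Q_norm_le hs p z))
    · rw [← ofReal_norm, norm_mul, ENNReal.ofReal_mul (norm_nonneg _), ofReal_norm, ofReal_norm]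

/-- Weak closedness of the 1-form `k` in `Ω`. -/
def Closed1 (Ω : Set R2) (k : Fin 2 → R2 → ℝ) : Prop :=
  ∀ φ : R2 → ℝ, ContDiff ℝ (⊤ : ℕ∞) φ → HasCompactSupport φ → tsupport φ ⊆ Ω →
    ∫ y, pd 1 φ y * k 0 y = ∫ y, pd 0 φ y * k 1 y

def TT (a b : ℝ) (j : Fin 2) (z : R2) : ℝ := (kerr a j z - kerr b j z) / (2 * Real.pi)

def VV (e : ℝ) (j : Fin 2) (z : R2) : ℝ := (kerS j z - kerr e j z) / (2 * Real.pi)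

def LL (k : Fin 2 → R2 → ℝ) (e : ℝ) (x : R2) : ℝ :=
  -(cv (k 0) (VV e 0) x + cv (k 1) (VV e 1) x)

def DD (k : Fin 2 → R2 → ℝ) (a b : ℝ) (x : R2) : ℝ :=
  -(cv (k 0) (TT a b 0) x + cv (k 1) (TT a b 1) x)

lemma VV_abs_le {e : ℝ} (he : 0 < e) (j : Fin 2) (z : R2) :
    |VV e j z| ≤ (ball (0 : R2) e).indicator (fun z => ‖z‖⁻¹ / (2 * Real.pi)) z := by
  have hpi := Real.pi_pos
  unfold VV
  by_cases h : z ∈ ball (0 : R2) e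
  · rw [indicator_of_mem h, abs_div, abs_of_pos (by positivity : 0 < 2 * Real.pi)]
    have e1 : kerS j z - kerr e j z = (1 - cut e z) * kerS j z := by rw [kerr_eq]; ring
    have h1 := cut_nonneg e z
    have h2 := cut_le_one e z
    gcongr
    rw [e1, abs_mul, abs_of_nonneg (by linarith)]
    refine (mul_le_of_le_one_left (abs_nonneg _) (by linarith)).trans (kerS_abs_le j z)
  · rw [indicator_of_notMem h]
    rw [mem_ball_zero_iff, not_lt] at h
    rw [kerr_eq_of_ge he j h]; simp

lemma kerr_continuous {r : ℝ} (hr : 0 < r) (j : Fin 2) : Continuous (kerr r j) :=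
  (kerr_contDiff hr j).continuous

lemma VV_measurable {e : ℝ} (he : 0 < e) (j : Fin 2) : Measurable (VV e j) :=
  ((kerS_measurable j).sub (kerr_continuous he j).measurable).div_const _

lemma VV_integrable {e : ℝ} (he : 0 < e) (j : Fin 2) : Integrable (VV e j) := by
  refine Integrable.mono' (g := (ball (0 : R2) e).indicator (fun z => ‖z‖⁻¹ / (2 * Real.pi))) ?_
    (VV_measurable he j).aestronglyMeasurable (ae_of_all _ fun z => VV_abs_le he j z)
  rw [integrable_indicator_iff measurableSet_ball]
  exact (invnorm_integrableOn e).div_const _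

lemma VV_lintegral {e : ℝ} (he : 0 < e) (j : Fin 2) :
    ∫⁻ z, ‖VV e j z‖ₑ ≤ ENNReal.ofReal e := by
  rw [← ofReal_integral_norm_eq_lintegral_enorm (VV_integrable he j)]
  refine ENNReal.ofReal_le_ofReal ?_
  calc ∫ z, ‖VV e j z‖ ≤ ∫ z, (ball (0 : R2) e).indicator (fun z => ‖z‖⁻¹ / (2 * Real.pi)) z := by
        refine integral_mono (VV_integrable he j).norm ?_ (fun z => VV_abs_le he j z)
        rw [integrable_indicator_iff measurableSet_ball]
        exact (invnorm_integrableOn e).div_const _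
    _ = e := by
        rw [integral_indicator measurableSet_ball, integral_div, invnorm_integral he]
        have := Real.pi_pos
        field_simp

lemma LL_aesm {k : Fin 2 → R2 → ℝ} (hk : ∀ j, Integrable (k j)) {e : ℝ} (he : 0 < e) :
    AEStronglyMeasurable (LL k e) :=
  ((cv_aesm (hk 0).aestronglyMeasurable (VV_integrable he 0).aestronglyMeasurable).add
    (cv_aesm (hk 1).aestronglyMeasurable (VV_integrable he 1).aestronglyMeasurable)).neg

lemma LL_lintegral {k : Fin 2 → R2 → ℝ} (hk : ∀ j, Integrable (k j)) {e : ℝ} (he : 0 < e) :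
    ∫⁻ z, ‖LL k e z‖ₑ ≤ ENNReal.ofReal e * ((∫⁻ y, ‖k 0 y‖ₑ) + ∫⁻ y, ‖k 1 y‖ₑ) := by
  calc ∫⁻ z, ‖LL k e z‖ₑ ≤ ∫⁻ z, (‖cv (k 0) (VV e 0) z‖ₑ + ‖cv (k 1) (VV e 1) z‖ₑ) := by
        refine lintegral_mono fun z => ?_
        unfold LL; rw [enorm_neg]; exact enorm_add_le _ _
    _ ≤ _ := by
        rw [lintegral_add_left' (cv_aesm (hk 0).aestronglyMeasurable
          (VV_integrable he 0).aestronglyMeasurable).enorm, mul_add]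
        refine add_le_add ?_ ?_
        · refine (cv_lintegral_le (hk 0).aestronglyMeasurable
            (VV_integrable he 0).aestronglyMeasurable).trans ?_
          gcongr; exact VV_lintegral he 0
        · refine (cv_lintegral_le (hk 1).aestronglyMeasurable
            (VV_integrable he 1).aestronglyMeasurable).trans ?_
          gcongr; exact VV_lintegral he 1

lemma TT_support {a b : ℝ} (ha : 0 < a) (hb : 0 < b) (j : Fin 2) :
    Function.support (TT a b j) ⊆ closedBall 0 (max a b) := by
  intro z hz
  rw [mem_closedBall_zero_iff]
  by_contra h
  push Not at h
  apply hz
  unfold TT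
  rw [kerr_eq_of_ge ha j ((le_max_left _ _).trans h.le),
    kerr_eq_of_ge hb j ((le_max_right _ _).trans h.le)]
  simp

lemma TT_compact {a b : ℝ} (ha : 0 < a) (hb : 0 < b) (j : Fin 2) : HasCompactSupport (TT a b j) :=
  HasCompactSupport.of_support_subset_isCompact (isCompact_closedBall 0 _) (TT_support ha hb j)

lemma TT_contDiff {a b : ℝ} (ha : 0 < a) (hb : 0 < b) (j : Fin 2) :
    ContDiff ℝ (⊤ : ℕ∞) (TT a b j) :=
  ((kerr_contDiff ha j).sub (kerr_contDiff hb j)).div_const _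

lemma pd_TT {a b : ℝ} (ha : 0 < a) (hb : 0 < b) (i j : Fin 2) (z : R2) :
    pd i (TT a b j) z = (pd i (kerr a j) z - pd i (kerr b j) z) / (2 * Real.pi) := by
  have h1 := ((kerr_contDiff ha j).differentiable (by simp) z).hasFDerivAt
  have h2 := ((kerr_contDiff hb j).differentiable (by simp) z).hasFDerivAt
  have h : HasFDerivAt (TT a b j) _ z := (h1.sub h2).mul_const (2 * Real.pi)⁻¹
  unfold pd
  rw [h.fderiv]
  simp [div_eq_inv_mul]

lemma LL_sub {k : Fin 2 → R2 → ℝ} (hk : ∀ j, Integrable (k j)) {a b : ℝ} (ha : 0 < a)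
    (hb : 0 < b) : ∀ᵐ x, DD k a b x = LL k b x - LL k a x := by
  have ex : ∀ {e : ℝ}, 0 < e → ∀ j, ∀ᵐ x, Integrable (fun y => VV e j (x - y) • k j y) := by
    intro e he j
    have := (hk j).ae_convolution_exists (cvL ℝ) (VV_integrable he j)
    filter_upwards [this] with x hx
    simpa [ConvolutionExistsAt, cvL] using hx
  filter_upwards [ex ha 0, ex ha 1, ex hb 0, ex hb 1] with x a0 a1 b0 b1
  have key : ∀ j, Integrable (fun y => VV a j (x - y) • k j y) →
      Integrable (fun y => VV b j (x - y) • k j y) →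
      cv (k j) (TT a b j) x = cv (k j) (VV b j) x - cv (k j) (VV a j) x := by
    intro j h1 h2
    unfold cv
    rw [← integral_sub h2 h1]
    congr 1
    funext y
    simp only [TT, VV, smul_eq_mul]
    ring
  unfold DD LL
  rw [key 0 a0 b0, key 1 a1 b1]; ring

lemma DD_contDiff {k : Fin 2 → R2 → ℝ} (hk : ∀ j, Integrable (k j)) {a b : ℝ} (ha : 0 < a)
    (hb : 0 < b) : ContDiff ℝ (⊤ : ℕ∞) (DD k a b) :=
  ((cv_contDiff (hk 0) (TT_contDiff ha hb 0) (TT_compact ha hb 0)).add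
    (cv_contDiff (hk 1) (TT_contDiff ha hb 1) (TT_compact ha hb 1))).neg

/-- The closedness relation tested with `T(x-·)`. -/
lemma closed_cv {Ω : Set R2} {k : Fin 2 → R2 → ℝ} (hcl : Closed1 Ω k) {T : R2 → ℝ} {r : ℝ}
    (hT : ContDiff ℝ (⊤ : ℕ∞) T) (hs : Function.support T ⊆ closedBall 0 r) {x : R2}
    (hx : closedBall x r ⊆ Ω) : cv (k 0) (pd 1 T) x = cv (k 1) (pd 0 T) x := by
  have hT1 : ContDiff ℝ 1 T := hT.of_le (by simp)
  have h := hcl (fun y => T (x - y)) (hT.comp (contDiff_const.sub contDiff_id))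
    (hcs_comp_sub hs x) ((tsupport_comp_sub hs x).trans hx)
  simp only [pd_comp_sub hT1, neg_mul, integral_neg, neg_inj] at h
  simpa [cv] using h

lemma cv_add_T {k : R2 → ℝ} (hk : Integrable k) {S T : R2 → ℝ} (hS : Continuous S)
    (hSc : HasCompactSupport S) (hT : Continuous T) (hTc : HasCompactSupport T) (x : R2) :
    cv k (fun z => S z + T z) x = cv k S x + cv k T x := by
  unfold cv
  rw [← integral_add (cv_int_exists hk hS hSc x) (cv_int_exists hk hT hTc x)]
  simp only [add_smul]

lemma cv_sub_T {k : R2 → ℝ} (hk : Integrable k) {S T : R2 → ℝ} (hS : Continuous S)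
    (hSc : HasCompactSupport S) (hT : Continuous T) (hTc : HasCompactSupport T) (x : R2) :
    cv k (fun z => S z - T z) x = cv k S x - cv k T x := by
  unfold cv
  rw [← integral_sub (cv_int_exists hk hS hSc x) (cv_int_exists hk hT hTc x)]
  simp only [sub_smul]

lemma pd_DD {Ω : Set R2} {k : Fin 2 → R2 → ℝ} (hk : ∀ j, Integrable (k j)) (hcl : Closed1 Ω k)
    {a b : ℝ} (ha : 0 < a) (hb : 0 < b) {x : R2} (hx : closedBall x (max a b) ⊆ Ω) (i : Fin 2) :
    pd i (DD k a b) x = cv (k i) (eta b) x - cv (k i) (eta a) x := by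
  have hpi := Real.pi_pos
  have T1 : ∀ j, ContDiff ℝ 1 (TT a b j) := fun j => (TT_contDiff ha hb j).of_le (by simp)
  have d : ∀ j, DifferentiableAt ℝ (cv (k j) (TT a b j)) x := fun j =>
    (cv_contDiff (hk j) (TT_contDiff ha hb j) (TT_compact ha hb j)).differentiable (by simp) x
  have e1 : pd i (DD k a b) x = -(cv (k 0) (pd i (TT a b 0)) x + cv (k 1) (pd i (TT a b 1)) x) := by
    rw [← pd_cv (hk 0) (T1 0) (TT_compact ha hb 0), ← pd_cv (hk 1) (T1 1) (TT_compact ha hb 1)]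
    have h : HasFDerivAt (DD k a b) _ x := ((d 0).hasFDerivAt.add (d 1).hasFDerivAt).neg
    unfold pd
    rw [h.fderiv]; simp
  have c0 := closed_cv hcl (TT_contDiff ha hb 0) (TT_support ha hb 0) hx
  have c1 := closed_cv hcl (TT_contDiff ha hb 1) (TT_support ha hb 1) hx
  have sym : pd 1 (TT a b 0) = pd 0 (TT a b 1) := by
    funext z; rw [pd_TT ha hb, pd_TT ha hb, kerr_symm ha 1 0, kerr_symm hb 1 0]
  have hdiv : (fun z => pd 0 (TT a b 0) z + pd 1 (TT a b 1) z) = fun z => eta a z - eta b z := by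
    funext z
    have ka := kerr_div ha z
    have kb := kerr_div hb z
    rw [pd_TT ha hb, pd_TT ha hb]
    field_simp
    linarith
  have cc : ∀ j i, Continuous (pd i (TT a b j)) := fun j i => pd_continuous (T1 j) i
  have cs : ∀ j i, HasCompactSupport (pd i (TT a b j)) := fun j i => pd_compact (TT_compact ha hb j) i
  have hd : ∀ i, cv (k i) (pd 0 (TT a b 0)) x + cv (k i) (pd 1 (TT a b 1)) x
      = cv (k i) (eta a) x - cv (k i) (eta b) x := by
    intro i
    rw [← cv_add_T (hk i) (cc 0 0) (cs 0 0) (cc 1 1) (cs 1 1), hdiv,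
      cv_sub_T (hk i) (eta_contDiff a).continuous (eta_compact ha) (eta_contDiff b).continuous
        (eta_compact hb)]
  rw [e1]
  fin_cases i
  · have := hd 0
    simp only [Fin.zero_eta]
    rw [← c1]; linarith
  · have := hd 1
    simp only [Fin.mk_one]
    rw [c0]; linarith

lemma K_closed {Ω : Set R2} {k : Fin 2 → R2 → ℝ} (hk : ∀ j, Integrable (k j)) (hcl : Closed1 Ω k)
    {e : ℝ} (he : 0 < e) {x : R2} (hx : closedBall x e ⊆ Ω) :
    pd 0 (cv (k 1) (eta e)) x = pd 1 (cv (k 0) (eta e)) x := by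
  have h1 : ContDiff ℝ 1 (eta e) := (eta_contDiff e).of_le (by simp)
  rw [pd_cv (hk 1) h1 (eta_compact he), pd_cv (hk 0) h1 (eta_compact he)]
  exact (closed_cv hcl (eta_contDiff e) (eta_support he) hx).symm

lemma R2_decomp (v : R2) : v = v 0 • eb 0 + v 1 • eb 1 := by
  ext i; fin_cases i <;> simp [eb]

lemma fderiv_apply_pd {f : R2 → ℝ} (z v : R2) :
    fderiv ℝ f z v = v 0 * pd 0 f z + v 1 * pd 1 f z := by
  conv_lhs => rw [R2_decomp v]
  simp [pd]

lemma contDiffOn_one_of_hasFDerivAt {E : Type*} [NormedAddCommGroup E] [NormedSpace ℝ E]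
    {f : R2 → E} {f' : R2 → R2 →L[ℝ] E} {B : Set R2} (hB : IsOpen B)
    (h : ∀ z ∈ B, HasFDerivAt f (f' z) z) (hc : ContinuousOn f' B) : ContDiffOn ℝ 1 f B := by
  have := (contDiffOn_succ_iff_fderiv_of_isOpen (𝕜 := ℝ) (n := 0) (f := f) hB).2
    ⟨fun z hz => (h z hz).differentiableAt.differentiableWithinAt, by simp, ?_⟩
  · simpa using this
  · rw [contDiffOn_zero]
    exact hc.congr fun z hz => (h z hz).fderiv

lemma poincare2 {K : Fin 2 → R2 → ℝ} (hK : ∀ j, ContDiff ℝ 1 (K j)) {p : R2} {R : ℝ}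
    (hsym : ∀ z ∈ ball p R, pd 0 (K 1) z = pd 1 (K 0) z) :
    ∃ χ : R2 → ℝ, ContDiffOn ℝ 1 χ (ball p R) ∧ ∀ z ∈ ball p R, ∀ j, pd j χ z = K j z := by
  set π : Fin 2 → R2 →L[ℝ] ℝ := fun j => EuclideanSpace.proj j
  set ω : R2 → R2 →L[ℝ] ℝ := fun z => K 0 z • π 0 + K 1 z • π 1
  have d : ∀ j z, DifferentiableAt ℝ (K j) z := fun j z => (hK j).differentiable (by simp) z
  have hω : ∀ z, HasFDerivAt ω ((fderiv ℝ (K 0) z).smulRight (π 0)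
      + (fderiv ℝ (K 1) z).smulRight (π 1)) z := fun z =>
    ((d 0 z).hasFDerivAt.smul_const (π 0)).add ((d 1 z).hasFDerivAt.smul_const (π 1))
  obtain ⟨χ, hχ⟩ := (convex_ball p R).exists_forall_hasFDerivAt_of_fderiv_symmetric isOpen_ball
    (ω := ω) (fun z _ => (hω z).differentiableAt.differentiableWithinAt) (by
      intro a ha v w
      rw [(hω a).fderiv]
      simp only [add_apply, ContinuousLinearMap.smulRight_apply,
        smul_apply, fderiv_apply_pd, smul_eq_mul, hsym a ha, π,
        show ∀ (j : Fin 2) (x : R2), (EuclideanSpace.proj j : R2 →L[ℝ] ℝ) x = x j from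
          fun _ _ => rfl]
      ring)
  refine ⟨χ, contDiffOn_one_of_hasFDerivAt isOpen_ball hχ ?_, fun z hz j => ?_⟩
  · exact (continuous_iff_continuousAt.2 fun z => (hω z).continuousAt).continuousOn
  · unfold pd
    rw [(hχ z hz).fderiv]
    fin_cases j <;> simp [ω, π, eb]

lemma Appr.exLL {Ω : Set R2} {k : Fin 2 → R2 → ℝ} (hk : ∀ j, Integrable (k j))
    (hcl : Closed1 Ω k) {B : Set R2} (hB : IsOpen B) {e : ℝ} (he : 0 < e)
    (hBe : ∀ z ∈ B, closedBall z e ⊆ Ω) :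
    Appr B (fun z => ex (LL k e z)) (fun j z => ((cv (k j) (eta e) z - k j z : ℝ) : ℂ) * Complex.I
      * ex (LL k e z)) := by
  set r : ℕ → ℝ := fun n => e / ((n : ℝ) + 1)
  have hr : ∀ n, 0 < r n := fun n => by positivity
  have hre : ∀ n, r n ≤ e := fun n => div_le_self he.le (by linarith [n.cast_nonneg (α := ℝ)])
  have hrl : Tendsto r atTop (𝓝 0) := by
    have := tendsto_one_div_add_atTop_nhds_zero_nat (𝕜 := ℝ) |>.const_mul e
    simpa [r, div_eq_mul_inv] using this
  have hL : Tendsto (fun n => ∫⁻ z, ‖DD k (r n) e z - LL k e z‖ₑ) atTop (𝓝 0) := by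
    have e1 : ∀ n, ∫⁻ z, ‖DD k (r n) e z - LL k e z‖ₑ
        ≤ ENNReal.ofReal (r n) * ((∫⁻ y, ‖k 0 y‖ₑ) + ∫⁻ y, ‖k 1 y‖ₑ) := by
      intro n
      refine le_trans (le_of_eq ?_) (LL_lintegral hk (hr n))
      apply lintegral_congr_ae
      filter_upwards [LL_sub hk (hr n) he] with z hz
      rw [hz, show LL k e z - LL k (r n) z - LL k e z = - LL k (r n) z by ring, enorm_neg]
    have hfin : ((∫⁻ y, ‖k 0 y‖ₑ) + ∫⁻ y, ‖k 1 y‖ₑ) ≠ ∞ :=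
      ENNReal.add_ne_top.2 ⟨(hk 0).2.ne, (hk 1).2.ne⟩
    refine tendsto_of_tendsto_of_tendsto_of_le_of_le tendsto_const_nhds ?_ (fun _ => zero_le) e1
    have : Tendsto (fun n => ENNReal.ofReal (r n)) atTop (𝓝 0) := by
      rw [← ENNReal.ofReal_zero]
      exact (ENNReal.continuous_ofReal.tendsto _).comp hrl
    simpa using ENNReal.Tendsto.mul_const this (Or.inr hfin)
  obtain ⟨ns, hns, hae⟩ := subseq_ae (fun n =>
    (DD_contDiff hk (hr n) he).continuous.aestronglyMeasurable) (LL_aesm hk he) hL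
  refine Appr.exp hB (ln := fun n => DD k (r (ns n)) e)
    (D := fun j z => cv (k j) (eta e) z - k j z)
    (fun n => ((DD_contDiff hk (hr _) he).of_le (by simp)).contDiffOn)
    (ae_restrict_of_ae hae) (fun j => ?_) (fun j => ?_)
  · have m := (moll_tendsto (hk j) hr hrl).comp hns.tendsto_atTop
    refine tendsto_of_tendsto_of_tendsto_of_le_of_le tendsto_const_nhds m (fun _ => zero_le) ?_
    intro n
    refine le_trans ?_ (setLIntegral_le_lintegral B _)
    refine setLIntegral_mono_ae' hB.measurableSet (ae_of_all _ fun z hz => ?_)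
    rw [pd_DD hk hcl (hr _) he (by rw [max_eq_right (hre _)]; exact hBe z hz)]
    rw [show cv (k j) (eta e) z - cv (k j) (eta (r (ns n))) z - (cv (k j) (eta e) z - k j z)
      = -(cv (k j) (eta (r (ns n))) z - k j z) by ring, enorm_neg]
  · refine Integrable.sub ?_ (hk j).integrableOn
    refine Integrable.integrableOn ⟨(cv_contDiff (hk j) (eta_contDiff e)
      (eta_compact he)).continuous.aestronglyMeasurable, ?_⟩
    refine lt_of_le_of_lt (cv_lintegral_le (hk j).aestronglyMeasurable
      (eta_integrable he).aestronglyMeasurable) ?_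
    rw [eta_lintegral he, one_mul]
    exact (hk j).2

lemma cv_eta_integrable {k : R2 → ℝ} (hk : Integrable k) {e : ℝ} (he : 0 < e) :
    Integrable (cv k (eta e)) := by
  refine ⟨(cv_contDiff hk (eta_contDiff e)
      (eta_compact he)).continuous.aestronglyMeasurable, ?_⟩
  refine lt_of_le_of_lt (cv_lintegral_le hk.aestronglyMeasurable
    (eta_integrable he).aestronglyMeasurable) ?_
  rw [eta_lintegral he, one_mul]
  exact hk.2

lemma phase_integrable {B : Set R2} {D : R2 → ℝ} {f : R2 → ℂ} (hD : IntegrableOn D B)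
    (hf : AEStronglyMeasurable f (volume.restrict B))
    (hb : ∀ᵐ z ∂(volume.restrict B), ‖f z‖ ≤ 1) :
    IntegrableOn (fun z => (D z : ℂ) * Complex.I * f z) B := by
  have h := hD.ofReal (𝕜 := ℂ)
  refine h.mono ((h.aestronglyMeasurable.mul_const _).mul hf) ?_
  filter_upwards [hb] with z hz
  rw [norm_mul, norm_mul, Complex.norm_I, mul_one]
  exact mul_le_of_le_one_right (norm_nonneg _) hz

lemma Appr.phase_mul {B : Set R2} (hB : IsOpen B) {f g : R2 → ℂ} {D E : Fin 2 → R2 → ℝ}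
    (hf : Appr B f (fun j z => (D j z : ℂ) * Complex.I * f z))
    (hg : Appr B g (fun j z => (E j z : ℂ) * Complex.I * g z))
    (hD : ∀ j, IntegrableOn (D j) B) (hE : ∀ j, IntegrableOn (E j) B) :
    Appr B (fun z => f z * g z)
      (fun j z => ((D j z + E j z : ℝ) : ℂ) * Complex.I * (f z * g z)) := by
  refine (Appr.mul hB hf hg (fun j => phase_integrable (hD j) (hf.aesm hB) (hf.bdd hB))
    (fun j => phase_integrable (hE j) (hg.aesm hB) (hg.bdd hB))).congr (ae_of_all _ fun z => rfl)
    (fun j => ae_of_all _ fun z => ?_)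
  push_cast; ring

/-- Local smooth structure of `w e^{iL}`. -/
lemma claimS {Ω : Set R2} {k : Fin 2 → R2 → ℝ} (hk : ∀ j, Integrable (k j))
    (hcl : Closed1 Ω k) {w : R2 → ℂ} {p : R2} {R : ℝ} (hR : 0 < R) {e : ℝ} (he : 0 < e)
    (hBe : ∀ z ∈ ball p R, closedBall z e ⊆ Ω)
    (hw : Appr (ball p R) w (fun j z => (k j z : ℂ) * Complex.I * w z)) :
    ∃ (c : ℂ) (χ : R2 → ℝ), ContDiffOn ℝ 1 χ (ball p R) ∧
      (∀ z ∈ ball p R, ∀ j, pd j χ z = cv (k j) (eta e) z) ∧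
      ∀ᵐ z ∂(volume.restrict (ball p R)), w z * ex (LL k e z) = c * ex (χ z) := by
  have hB : IsOpen (ball p R) := isOpen_ball
  have Ki : ∀ j, IntegrableOn (cv (k j) (eta e)) (ball p R) := fun j =>
    (cv_eta_integrable (hk j) he).integrableOn
  obtain ⟨χ, hχ, hχd⟩ := poincare2 (K := fun j => cv (k j) (eta e)) (p := p) (R := R)
    (fun j => (cv_contDiff (hk j) (eta_contDiff e) (eta_compact he)).of_le (by simp))
    (fun z hz => K_closed hk hcl he (hBe z hz))
  have a1 := Appr.phase_mul hB hw (Appr.exLL hk hcl hB he hBe) (fun j => (hk j).integrableOn)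
    (fun j => (Ki j).sub (hk j).integrableOn)
  have a2 : Appr (ball p R) (fun z => ex (-χ z))
      (fun j z => ((-cv (k j) (eta e) z : ℝ) : ℂ) * Complex.I * ex (-χ z)) := by
    refine Appr.exp hB (ln := fun _ z => -χ z) (D := fun j z => -cv (k j) (eta e) z)
      (fun _ => hχ.neg) (ae_of_all _ fun z => tendsto_const_nhds) (fun j => ?_)
      (fun j => (Ki j).neg)
    refine tendsto_const_nhds.congr' (Eventually.of_forall fun n => ?_)
    symm
    rw [setLIntegral_congr_fun (g := fun _ => 0) hB.measurableSet]
    · simp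
    · intro z hz
      have e1 : pd j (fun z => -χ z) z = - pd j χ z := by
        unfold pd; rw [fderiv_fun_neg]; simp
      simp only [e1, hχd z hz j, sub_self, enorm_zero]
  have a3 := Appr.phase_mul hB a1 a2 (fun j => (hk j).integrableOn.add
    ((Ki j).sub (hk j).integrableOn)) (fun j => (Ki j).neg)
  obtain ⟨c, hc⟩ := Appr.const hR (a3.congr (ae_of_all _ fun z => rfl)
    (F' := fun _ _ => 0) (fun j => ae_of_all _ fun z => by simp))
  refine ⟨c, χ, hχ, hχd, ?_⟩
  filter_upwards [hc] with z hz
  rw [← hz, mul_assoc _ (ex (-χ z)), ← ex_add]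
  simp [ex_zero]

lemma ae_of_local {Ω : Set R2} {p : R2 → Prop} (hΩ : IsOpen Ω)
    (h : ∀ z0 ∈ Ω, ∃ R > 0, ∀ᵐ z ∂(volume.restrict (ball z0 R)), p z) :
    ∀ᵐ z ∂(volume.restrict Ω), p z := by
  rw [ae_restrict_iff' hΩ.measurableSet, ae_iff]
  refine measure_null_of_locally_null _ fun z hz => ?_
  have hz1 : z ∈ Ω := by by_contra hc; exact hz fun h => absurd h hc
  obtain ⟨R, hR, hp⟩ := h z hz1
  refine ⟨{a | ¬(a ∈ Ω → p a)} ∩ ball z R, inter_mem_nhdsWithin _ (ball_mem_nhds z hR), ?_⟩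
  rw [ae_restrict_iff' measurableSet_ball, ae_iff] at hp
  refine measure_mono_null ?_ hp
  rintro a ⟨h1, h2⟩ h3
  exact h1 fun _ => h3 h2

lemma glue {Ω : Set R2} (hΩ : IsOpen Ω) {W : R2 → ℂ} {t : Fin 2 → R2 → ℝ}
    (H : ∀ z0 ∈ Ω, ∃ R > 0, ∃ (f : R2 → ℂ) (τ : Fin 2 → R2 → ℝ), ball z0 R ⊆ Ω ∧
      ContDiffOn ℝ 1 f (ball z0 R) ∧ (∀ z ∈ ball z0 R, ‖f z‖ = 1) ∧
      (∀ z ∈ ball z0 R, ∀ j, pd j f z = (τ j z : ℂ) * Complex.I * f z) ∧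
      (∀ᵐ z ∂(volume.restrict (ball z0 R)), f z = W z) ∧
      ∀ j, ∀ᵐ z ∂(volume.restrict (ball z0 R)), τ j z = t j z) :
    ∃ (F : R2 → ℂ) (τ : Fin 2 → R2 → ℝ), ContDiffOn ℝ 1 F Ω ∧ (∀ z ∈ Ω, ‖F z‖ = 1) ∧
      (∀ z ∈ Ω, ∀ j, pd j F z = (τ j z : ℂ) * Complex.I * F z) ∧
      (∀ j, ContinuousOn (τ j) Ω) ∧
      (∀ᵐ z ∂(volume.restrict Ω), F z = W z) ∧
      ∀ j, ∀ᵐ z ∂(volume.restrict Ω), τ j z = t j z := by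
  choose! R hR f τ hsub hf1 hfn hfd hfW hτ using H
  set F : R2 → ℂ := fun z => f z z with hF
  have hFf : ∀ z0 ∈ Ω, EqOn F (f z0) (ball z0 (R z0)) := by
    intro z0 hz0 z hz
    have hzΩ := hsub z0 hz0 hz
    have hU : IsOpen (ball z0 (R z0) ∩ ball z (R z)) := isOpen_ball.inter isOpen_ball
    have hae : f z =ᵐ[volume.restrict (ball z0 (R z0) ∩ ball z (R z))] f z0 := by
      have h1 := ae_mono (Measure.restrict_mono (inter_subset_right (s := ball z0 (R z0))
        (t := ball z (R z))) le_rfl) (hfW z hzΩ)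
      have h2 := ae_mono (Measure.restrict_mono (inter_subset_left (s := ball z0 (R z0))
        (t := ball z (R z))) le_rfl) (hfW z0 hz0)
      filter_upwards [h1, h2] with a ha hb
      rw [ha, hb]
    exact Measure.eqOn_open_of_ae_eq hae hU ((hf1 z hzΩ).continuousOn.mono inter_subset_right)
      ((hf1 z0 hz0).continuousOn.mono inter_subset_left) ⟨hz, mem_ball_self (hR z hzΩ)⟩
  have hFe : ∀ z0 ∈ Ω, ∀ z ∈ ball z0 (R z0), F =ᶠ[𝓝 z] f z0 := fun z0 hz0 z hz =>
    (hFf z0 hz0).eventuallyEq_of_mem (isOpen_ball.mem_nhds hz)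
  have hFn : ∀ z ∈ Ω, ‖F z‖ = 1 := fun z hz => hfn z hz z (mem_ball_self (hR z hz))
  have hFc : ContDiffOn ℝ 1 F Ω := by
    intro z hz
    have hb := mem_ball_self (x := z) (hR z hz)
    exact (((hf1 z hz).contDiffAt (isOpen_ball.mem_nhds hb)).congr_of_eventuallyEq
      (hFe z hz z hb)).contDiffWithinAt
  set T : Fin 2 → R2 → ℝ := fun j z => (pd j F z / (Complex.I * F z)).re with hT
  have hTτ : ∀ z0 ∈ Ω, ∀ z ∈ ball z0 (R z0), ∀ j, pd j F z = (τ z0 j z : ℂ) * Complex.I * F z := by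
    intro z0 hz0 z hz j
    rw [pd_congr (hFe z0 hz0 z hz), hfd z0 hz0 z hz, hFf z0 hz0 hz]
  have hT2 : ∀ z0 ∈ Ω, ∀ z ∈ ball z0 (R z0), ∀ j, T j z = τ z0 j z := by
    intro z0 hz0 z hz j
    have h0 : F z ≠ 0 := by
      intro h
      have := hFn z (hsub z0 hz0 hz)
      rw [h] at this; simp at this
    simp only [hT]
    rw [hTτ z0 hz0 z hz j, mul_assoc, mul_div_assoc, div_self (mul_ne_zero Complex.I_ne_zero h0)]
    simp
  refine ⟨F, T, hFc, hFn, ?_, ?_, ?_, ?_⟩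
  · intro z hz j
    have hb := mem_ball_self (x := z) (hR z hz)
    rw [hT2 z hz z hb, hTτ z hz z hb]
  · intro j
    refine Complex.continuous_re.comp_continuousOn ((pd_continuousOn hΩ hFc j).div
      (continuousOn_const.mul hFc.continuousOn) ?_)
    intro z hz h
    have h0 : F z = 0 := by simpa using h
    have := hFn z hz
    rw [h0] at this; simp at this
  · refine ae_of_local hΩ fun z0 hz0 => ⟨R z0, hR z0 hz0, ?_⟩
    filter_upwards [hfW z0 hz0, ae_restrict_mem measurableSet_ball] with z hz hzb
    rw [hFf z0 hz0 hzb, hz]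
  · intro j
    refine ae_of_local hΩ fun z0 hz0 => ⟨R z0, hR z0 hz0, ?_⟩
    filter_upwards [hτ z0 hz0 j, ae_restrict_mem measurableSet_ball] with z hz hzb
    rw [hT2 z0 hz0 z hzb, hz]

lemma partition_exists {Ω : Set R2} (hΩ : IsOpen Ω) (hb : Bornology.IsBounded Ω) :
    ∃ (ζ : ℕ → R2 → ℝ) (K : ℕ → Set R2), (∀ n, ContDiff ℝ (⊤ : ℕ∞) (ζ n)) ∧ (∀ n z, 0 ≤ ζ n z) ∧
      (∀ n z, ζ n z ≤ 1) ∧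
      (∀ n, IsCompact (K n)) ∧ (∀ n, K n ⊆ Ω) ∧ (∀ n z, ζ n z ≠ 0 → z ∈ K n) ∧
      ∀ z0 ∈ Ω, ∃ R > 0, ∃ N, ball z0 R ⊆ Ω ∧ (∀ z ∈ ball z0 R, ∀ n, N ≤ n → ζ n z = 0) ∧
        ∀ z ∈ ball z0 R, ∑ n ∈ Finset.range N, ζ n z = 1 := by
  obtain ⟨f, hfs, hf, hfr⟩ := hΩ.exists_contDiff_support_eq (n := ⊤)
  have hf0 : ∀ z, 0 ≤ f z := fun z => (hfr (mem_range_self z)).1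
  have hfΩ : ∀ z, 0 < f z → z ∈ Ω := fun z hz => by rw [← hfs]; exact hz.ne'
  set χ : ℕ → R2 → ℝ := fun n z => nn (2 ^ n * f z) with hχ
  have χm : ∀ n z, χ n z ≤ χ (n + 1) z := fun n z => nn_mono (by
    rw [pow_succ]; nlinarith [hf0 z, show (0:ℝ) ≤ 2 ^ n * f z from mul_nonneg (by positivity) (hf0 z)])
  have χc : ∀ n, ContDiff ℝ (⊤ : ℕ∞) (χ n) := fun n => nn_contDiff.comp (contDiff_const.mul hf)
  set ζ : ℕ → R2 → ℝ := fun n => Nat.casesOn n (χ 0) (fun m z => χ (m + 1) z - χ m z) with hζ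
  have z0' : ∀ z, ζ 0 z = χ 0 z := fun z => rfl
  have zs : ∀ m z, ζ (m + 1) z = χ (m + 1) z - χ m z := fun m z => rfl
  have sum : ∀ N z, ∑ n ∈ Finset.range (N + 1), ζ n z = χ N z := by
    intro N z
    induction N with
    | zero => simp [z0']
    | succ m ih => rw [Finset.sum_range_succ, ih, zs]; ring
  have hle : ∀ n z, ζ n z ≤ χ n z := by
    intro n z
    cases n with
    | zero => exact le_rfl
    | succ m => rw [zs]; linarith [nn_nonneg (2 ^ m * f z)]
  have hnn : ∀ n z, 0 ≤ ζ n z := by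
    intro n z
    cases n with
    | zero => exact nn_nonneg _
    | succ m => rw [zs]; linarith [χm m z]
  refine ⟨ζ, fun n => {z | 1 / 2 ≤ 2 ^ n * f z}, ?_, hnn, ?_, ?_, ?_, ?_, ?_⟩
  · intro n
    cases n with
    | zero => exact χc 0
    | succ m => exact (χc (m + 1)).sub (χc m)
  · exact fun n z => (hle n z).trans (nn_le_one _)
  · intro n
    refine isCompact_of_isClosed_isBounded ?_ (hb.subset ?_)
    · exact isClosed_le continuous_const (continuous_const.mul hf.continuous)
    · intro z hz
      apply hfΩ
      by_contra h
      have : f z = 0 := le_antisymm (not_lt.1 h) (hf0 z)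
      simp only [mem_ofPred_eq, this, mul_zero] at hz
      norm_num at hz
  · intro n z hz
    apply hfΩ
    by_contra h
    have : f z = 0 := le_antisymm (not_lt.1 h) (hf0 z)
    simp only [mem_ofPred_eq, this, mul_zero] at hz
    norm_num at hz
  · intro n z hz
    by_contra h
    simp only [mem_ofPred_eq, not_le] at h
    apply hz
    refine le_antisymm ((hle n z).trans ?_) (hnn n z)
    exact (nn_of_le h.le).le
  · intro z0 hz0
    have hp : 0 < f z0 := lt_of_le_of_ne (hf0 z0) (Ne.symm (by rw [← hfs] at hz0; exact hz0))
    have hU : {z | f z0 / 2 < f z} ∈ 𝓝 z0 :=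
      (isOpen_lt continuous_const hf.continuous).mem_nhds (by simp only [mem_ofPred_eq]; linarith)
    obtain ⟨R, hR, hRU⟩ := Metric.mem_nhds_iff.1 hU
    obtain ⟨N, hN⟩ := pow_unbounded_of_one_lt (2 / f z0) (one_lt_two (α := ℝ))
    have h1 : ∀ z ∈ ball z0 R, ∀ n, N ≤ n → χ n z = 1 := by
      intro z hz n hn
      apply nn_of_ge
      have h2 : f z0 / 2 < f z := hRU hz
      have h3 : (2:ℝ) ^ N ≤ 2 ^ n := pow_le_pow_right₀ one_le_two hn
      have h4 : 2 / f z0 ≤ 2 ^ n := hN.le.trans h3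
      calc (1:ℝ) = 2 / f z0 * (f z0 / 2) := by field_simp
        _ ≤ 2 ^ n * f z := by gcongr
    refine ⟨R, hR, N + 1, fun z hz => hfΩ z (lt_trans (by linarith) (hRU hz)), ?_, ?_⟩
    · intro z hz n hn
      obtain ⟨m, rfl⟩ : ∃ m, n = m + 1 := ⟨n - 1, by omega⟩
      rw [zs, h1 z hz _ (by omega), h1 z hz _ (by omega), sub_self]
    · intro z hz
      rw [sum, h1 z hz N le_rfl]

lemma pd_smul_sum {N : ℕ} {a b : ℕ → R2 → ℝ} {z : R2} (ha : ∀ n, DifferentiableAt ℝ (a n) z)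
    (hb : ∀ n, DifferentiableAt ℝ (b n) z) (j : Fin 2) :
    pd j (fun z => ∑ n ∈ Finset.range N, a n z * b n z) z
      = ∑ n ∈ Finset.range N, (pd j (a n) z * b n z + a n z * pd j (b n) z) := by
  have h := HasFDerivAt.fun_sum (u := Finset.range N)
    (fun n _ => (ha n).hasFDerivAt.mul (hb n).hasFDerivAt)
  unfold pd
  have h' : HasFDerivAt (fun z => ∑ n ∈ Finset.range N, a n z * b n z) _ z := h
  rw [h'.fderiv]
  simp only [sum_apply, add_apply, smul_apply, smul_eq_mul]
  refine Finset.sum_congr rfl fun n _ => by ring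

lemma local_struct {Ω : Set R2} {k : Fin 2 → R2 → ℝ} (hk : ∀ j, Integrable (k j))
    (hcl : Closed1 Ω k) {w : R2 → ℂ} (hw1 : ∀ᵐ z ∂(volume.restrict Ω), ‖w z‖ = 1)
    (hw : ∀ p R δ, 0 < R → 0 < δ → (∀ z ∈ ball p R, closedBall z δ ⊆ Ω) →
      Appr (ball p R) w (fun j z => (k j z : ℂ) * Complex.I * w z))
    {ζ : ℕ → R2 → ℝ} {e : ℕ → ℝ} (hζ : ∀ n, ContDiff ℝ (⊤ : ℕ∞) (ζ n)) (he : ∀ n, 0 < e n)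
    (hζe : ∀ n z, ζ n z ≠ 0 → closedBall z (e n) ⊆ Ω) {z0 : R2} {R : ℝ} (hR : 0 < R) {N : ℕ}
    (hsub : ball z0 R ⊆ Ω) (hN : ∀ z ∈ ball z0 R, ∀ n, N ≤ n → ζ n z = 0)
    (h1 : ∀ z ∈ ball z0 R, ∑ n ∈ Finset.range N, ζ n z = 1) :
    ∃ R > 0, ∃ (f : R2 → ℂ) (τ : Fin 2 → R2 → ℝ), ball z0 R ⊆ Ω ∧
      ContDiffOn ℝ 1 f (ball z0 R) ∧ (∀ z ∈ ball z0 R, ‖f z‖ = 1) ∧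
      (∀ z ∈ ball z0 R, ∀ j, pd j f z = (τ j z : ℂ) * Complex.I * f z) ∧
      (∀ᵐ z ∂(volume.restrict (ball z0 R)), f z = w z * ex (∑' n, ζ n z * LL k (e n) z)) ∧
      ∀ j, ∀ᵐ z ∂(volume.restrict (ball z0 R)), τ j z =
        ∑' n, (ζ n z * cv (k j) (eta (e n)) z + pd j (ζ n) z * LL k (e n) z) := by
  -- shrink
  set r := R / 2 with hr
  have hr0 : 0 < r := by positivity
  have hrR : ball z0 r ⊆ ball z0 R := ball_subset_ball (by linarith)
  set e0 := R / 4 with he0d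
  have he0 : 0 < e0 := by positivity
  have hBe : ∀ z ∈ ball z0 r, closedBall z e0 ⊆ Ω := by
    intro z hz y hy
    apply hsub
    rw [mem_ball] at hz ⊢
    rw [mem_closedBall] at hy
    have := dist_triangle y z z0
    linarith
  obtain ⟨c, χ, hχ, hχd, hc⟩ := claimS hk hcl hr0 he0 hBe (hw z0 r e0 hr0 he0 hBe)
  set D : ℕ → R2 → ℝ := fun n => DD k e0 (e n) with hD
  set S : R2 → ℝ := fun z => ∑ n ∈ Finset.range N, ζ n z * D n z with hSd
  have hDc : ∀ n, ContDiff ℝ (⊤ : ℕ∞) (D n) := fun n => DD_contDiff hk he0 (he n)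
  have hSc : ContDiff ℝ (⊤ : ℕ∞) S := ContDiff.sum fun n _ => (hζ n).mul (hDc n)
  have pS : ∀ z j, pd j S z = ∑ n ∈ Finset.range N, (pd j (ζ n) z * D n z + ζ n z * pd j (D n) z) :=
    fun z j => pd_smul_sum (fun n => (hζ n).differentiable (by simp) z)
      (fun n => (hDc n).differentiable (by simp) z) j
  have hopen : IsOpen (ball z0 r) := isOpen_ball
  have hLL : ∀ᵐ z ∂(volume.restrict (ball z0 r)), ∀ n, D n z = LL k (e n) z - LL k e0 z :=
    ae_restrict_of_ae (ae_all_iff.2 fun n => LL_sub hk he0 (he n))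
  have hw1' : ∀ᵐ z ∂(volume.restrict (ball z0 r)), ‖w z‖ = 1 :=
    ae_mono (Measure.restrict_mono (hrR.trans hsub) le_rfl) hw1
  have hcn : ‖c‖ = 1 := by
    have : (ae (volume.restrict (ball z0 r))).NeBot := by
      rw [ae_neBot, Ne, Measure.restrict_eq_zero]
      exact (measure_ball_pos volume z0 hr0).ne'
    obtain ⟨z, h1, h2⟩ := (hc.and hw1').exists
    have := congrArg norm h1
    rw [norm_mul, norm_mul, ex_norm, ex_norm, h2] at this
    linarith
  refine ⟨r, hr0, fun z => c * ex (χ z + S z),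
    fun j z => cv (k j) (eta e0) z + pd j S z, hrR.trans hsub, ?_, ?_, ?_, ?_, ?_⟩
  · exact contDiffOn_const.mul (ex_contDiff.comp_contDiffOn
      (hχ.add (hSc.of_le (by simp)).contDiffOn))
  · intro z _
    rw [norm_mul, ex_norm, hcn, one_mul]
  · intro z hz j
    have d1 : DifferentiableAt ℝ χ z :=
      (hχ.differentiableOn (by simp) z hz).differentiableAt (hopen.mem_nhds hz)
    have d2 : DifferentiableAt ℝ S z := hSc.differentiable (by simp) z
    have d3 : DifferentiableAt ℝ (fun z => χ z + S z) z := d1.add d2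
    have d4 : DifferentiableAt ℝ (fun z => ex (χ z + S z)) z :=
      ((ex_contDiff (n := 1)).differentiable (by simp) _).comp z d3
    rw [pd_mul (differentiableAt_const c) d4, pd_ex d3]
    have e1 : pd j (fun z => χ z + S z) z = cv (k j) (eta e0) z + pd j S z := by
      rw [← hχd z hz j]; unfold pd; rw [fderiv_fun_add d1 d2]; rfl
    rw [e1]
    simp [pd]
    ring
  · filter_upwards [hc, hLL, ae_restrict_mem measurableSet_ball] with z hz hL hzb
    have hzR := hrR hzb
    rw [ex_add, ← mul_assoc, ← hz, mul_assoc, ← ex_add]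
    congr 2
    rw [tsum_eq_sum (s := Finset.range N) (fun n hn => by
      rw [hN z hzR n (by simpa using hn), zero_mul])]
    simp only [hSd, hL, mul_sub]
    rw [Finset.sum_sub_distrib, ← Finset.sum_mul, h1 z hzR]
    ring
  · intro j
    filter_upwards [hLL, ae_restrict_mem measurableSet_ball] with z hL hzb
    have hzR := hrR hzb
    have pz : ∀ n, N ≤ n → pd j (ζ n) z = 0 := by
      intro n hn
      have : ζ n =ᶠ[𝓝 z] fun _ => 0 := by
        filter_upwards [isOpen_ball.mem_nhds hzR] with y hy using hN y hy n hn
      rw [pd_congr this]; simp [pd]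
    have ps : ∑ n ∈ Finset.range N, pd j (ζ n) z = 0 := by
      have h : (fun z => ∑ n ∈ Finset.range N, ζ n z * 1) =ᶠ[𝓝 z] fun _ => 1 := by
        filter_upwards [isOpen_ball.mem_nhds hzR] with y hy using by simpa using h1 y hy
      have h2 := pd_congr h j
      rw [pd_smul_sum (b := fun _ _ => 1) (fun n => (hζ n).differentiable (by simp) z)
        (fun n => differentiableAt_const _)] at h2
      simpa [pd] using h2
    rw [tsum_eq_sum (s := Finset.range N) (fun n hn => by
      rw [hN z hzR n (by simpa using hn), pz n (by simpa using hn)]; simp)]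
    rw [pS]
    have term : ∀ n, pd j (ζ n) z * D n z + ζ n z * pd j (D n) z
        = (ζ n z * cv (k j) (eta (e n)) z + pd j (ζ n) z * LL k (e n) z)
          - pd j (ζ n) z * LL k e0 z - ζ n z * cv (k j) (eta e0) z := by
      intro n
      rw [hL n]
      by_cases h0 : ζ n z = 0
      · rw [h0]; ring
      · rw [pd_DD hk hcl he0 (he n) ?_]
        · ring
        · rcases max_choice e0 (e n) with h | h
          · rw [h]; exact hBe z hzb
          · rw [h]; exact hζe n z h0
    simp only [term]
    rw [Finset.sum_sub_distrib, Finset.sum_sub_distrib, ← Finset.sum_mul, ← Finset.sum_mul, ps,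
      h1 z hzR]
    ring

lemma LL_small {k : Fin 2 → R2 → ℝ} (hk : ∀ j, Integrable (k j)) {C : ℝ≥0∞} (hC : C ≠ ∞)
    {δ : ℝ≥0∞} (hδ : δ ≠ 0) :
    ∃ r0 > 0, ∀ r, 0 < r → r ≤ r0 → C * ∫⁻ z, ‖LL k r z‖ₑ ≤ δ := by
  have hfin : ((∫⁻ y, ‖k 0 y‖ₑ) + ∫⁻ y, ‖k 1 y‖ₑ) ≠ ∞ :=
      ENNReal.add_ne_top.2 ⟨(hk 0).2.ne, (hk 1).2.ne⟩
  set M := ((∫⁻ y, ‖k 0 y‖ₑ) + ∫⁻ y, ‖k 1 y‖ₑ)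
  have t : Tendsto (fun r : ℝ => C * (ENNReal.ofReal r * M)) (𝓝 0) (𝓝 0) := by
    have : Tendsto (fun r : ℝ => ENNReal.ofReal r) (𝓝 0) (𝓝 0) := by
      have := ENNReal.continuous_ofReal.tendsto 0
      simpa using this
    simpa using ENNReal.Tendsto.const_mul (ENNReal.Tendsto.mul_const this (Or.inr hfin))
      (Or.inr hC)
  have ev := t.eventually (Iic_mem_nhds (pos_iff_ne_zero.2 hδ))
  obtain ⟨s, hs, h⟩ := Metric.eventually_nhds_iff.1 ev
  refine ⟨s / 2, by positivity, fun r hr hrs => ?_⟩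
  refine le_trans (mul_le_mul_right (LL_lintegral hk hr) _) (h ?_)
  rw [Real.dist_eq, sub_zero, abs_of_pos hr]; linarith

lemma smoothing {Ω : Set R2} (hΩ : IsOpen Ω) (hb : Bornology.IsBounded Ω)
    {k : Fin 2 → R2 → ℝ} (hk : ∀ j, Integrable (k j))
    (hcl : Closed1 Ω k) {w : R2 → ℂ} (hw1 : ∀ᵐ z ∂(volume.restrict Ω), ‖w z‖ = 1)
    (hw : ∀ p R δ, 0 < R → 0 < δ → (∀ z ∈ ball p R, closedBall z δ ⊆ Ω) →
      Appr (ball p R) w (fun j z => (k j z : ℂ) * Complex.I * w z)) {ε : ℝ≥0∞} (hε : ε ≠ 0) :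
    ∃ (F : R2 → ℂ) (τ : Fin 2 → R2 → ℝ), ContDiffOn ℝ 1 F Ω ∧ (∀ z ∈ Ω, ‖F z‖ = 1) ∧
      (∀ z ∈ Ω, ∀ j, pd j F z = (τ j z : ℂ) * Complex.I * F z) ∧
      (∀ j, ContinuousOn (τ j) Ω) ∧ ∫⁻ z in Ω, ‖F z - w z‖ₑ ≤ ε ∧
      ∀ j, ∫⁻ z in Ω, ‖τ j z - k j z‖ₑ ≤ ε := by
  obtain ⟨ζ, K, hζ, hζ0, hζ1, hKc, hKΩ, hζK, hloc⟩ := partition_exists hΩ hb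
  obtain ⟨δ, hδ, hδs⟩ := ENNReal.exists_pos_sum_of_countable'
    (ENNReal.div_ne_zero.2 ⟨hε, (by simp : (2 : ℝ≥0∞) ≠ ∞)⟩) ℕ
  have hcs : ∀ n, HasCompactSupport (ζ n) := fun n =>
    HasCompactSupport.intro (hKc n) fun z hz => by
      by_contra h; exact hz (hζK n z h)
  have hC : ∀ n, ∃ C : ℝ, 1 ≤ C ∧ ∀ j z, ‖pd j (ζ n) z‖ ≤ C := by
    intro n
    have : ∀ j, ∃ C, ∀ z, ‖pd j (ζ n) z‖ ≤ C := fun j =>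
      (pd_compact (hcs n) j).exists_bound_of_continuous
        (pd_continuous ((hζ n).of_le (by simp)) j)
    choose C hC using this
    refine ⟨max 1 (max (C 0) (C 1)), le_max_left _ _, fun j z => (hC j z).trans ?_⟩
    fin_cases j <;> simp
  choose C hC1 hC using hC
  have he : ∀ n, ∃ e : ℝ, 0 < e ∧ (∀ z ∈ K n, closedBall z e ⊆ Ω) ∧
      (∀ j, ∫⁻ z, ‖cv (k j) (eta e) z - k j z‖ₑ ≤ δ n) ∧
      ENNReal.ofReal (C n) * ∫⁻ z, ‖LL k e z‖ₑ ≤ δ n := by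
    intro n
    obtain ⟨a, ha, hat⟩ := (hKc n).exists_cthickening_subset_open hΩ (hKΩ n)
    obtain ⟨b0, hb0, hb0'⟩ := moll_L1 (hk 0) (hδ n).ne'
    obtain ⟨b1, hb1, hb1'⟩ := moll_L1 (hk 1) (hδ n).ne'
    obtain ⟨d, hd, hd'⟩ := LL_small hk (C := ENNReal.ofReal (C n)) ENNReal.ofReal_ne_top (hδ n).ne'
    set e := min (min a b0) (min b1 d)
    have he : 0 < e := by positivity
    refine ⟨e, he, ?_, ?_, ?_⟩
    · intro z hz
      refine (closedBall_subset_closedBall ((min_le_left _ _).trans (min_le_left _ _))).trans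
        ((closedBall_subset_cthickening hz a).trans hat)
    · intro j
      fin_cases j
      · exact hb0' e he ((min_le_left _ _).trans (min_le_right _ _))
      · exact hb1' e he ((min_le_right _ _).trans (min_le_left _ _))
    · exact hd' e he ((min_le_right _ _).trans (min_le_right _ _))
  choose e he0 heK heM heL using he
  obtain ⟨F, τ, hF, hFn, hFd, hτc, hFW, hτ⟩ := glue hΩ
    (W := fun z => w z * ex (∑' n, ζ n z * LL k (e n) z))
    (t := fun j z => ∑' n, (ζ n z * cv (k j) (eta (e n)) z + pd j (ζ n) z * LL k (e n) z))
    (fun z0 hz0 => by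
      obtain ⟨R, hR, N, h1, h2, h3⟩ := hloc z0 hz0
      exact local_struct hk hcl hw1 hw hζ he0 (fun n z hz => heK n z (hζK n z hz)) hR h1 h2 h3)
  have hsum2 : ∑' n, (δ n + δ n) ≤ ε := by
    rw [ENNReal.tsum_add]
    refine (add_le_add hδs.le hδs.le).trans (ENNReal.add_halves ε).le
  have hLm : ∀ n, AEMeasurable (fun z => ‖LL k (e n) z‖ₑ) := fun n =>
    (LL_aesm hk (he0 n)).enorm
  have hC' : ∀ n, (1 : ℝ≥0∞) ≤ ENNReal.ofReal (C n) := fun n => by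
    rw [← ENNReal.ofReal_one]; exact ENNReal.ofReal_le_ofReal (hC1 n)
  refine ⟨F, τ, hF, hFn, hFd, hτc, ?_, ?_⟩
  · calc ∫⁻ z in Ω, ‖F z - w z‖ₑ ≤ ∫⁻ z in Ω, ∑' n, ‖LL k (e n) z‖ₑ := by
          apply lintegral_mono_ae
          filter_upwards [hFW, hw1, ae_restrict_mem hΩ.measurableSet] with z hz hz1 hzΩ
          obtain ⟨R, hR, N, h1, h2, h3⟩ := hloc z hzΩ
          have hzb := mem_ball_self (x := z) hR
          rw [hz, ← ofReal_norm]
          have e1 : w z * ex (∑' n, ζ n z * LL k (e n) z) - w z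
            = w z * (ex (∑' n, ζ n z * LL k (e n) z) - ex 0) := by rw [ex_zero]; ring
          rw [e1, norm_mul, hz1, one_mul]
          have l := ex_lip (∑' n, ζ n z * LL k (e n) z) 0
          rw [sub_zero, ← Real.norm_eq_abs] at l
          refine (ENNReal.ofReal_le_ofReal l).trans ?_
          rw [ofReal_norm, tsum_eq_sum (s := Finset.range N) (fun n hn => by
            rw [h2 z hzb n (by simpa using hn), zero_mul])]
          refine (enorm_sum_le _ _).trans (le_trans (Finset.sum_le_sum fun n _ => ?_)
            (ENNReal.sum_le_tsum (Finset.range N)))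
          rw [← ofReal_norm, ← ofReal_norm, norm_mul, Real.norm_of_nonneg (hζ0 n z)]
          exact ENNReal.ofReal_le_ofReal (mul_le_of_le_one_left (norm_nonneg _) (hζ1 n z))
      _ = ∑' n, ∫⁻ z in Ω, ‖LL k (e n) z‖ₑ := lintegral_tsum fun n => (hLm n).restrict
      _ ≤ ∑' n, (δ n + δ n) := by
          refine ENNReal.tsum_le_tsum fun n => ?_
          refine (setLIntegral_le_lintegral _ _).trans (le_trans ?_ ((heL n).trans le_self_add))
          exact le_mul_of_one_le_left zero_le (hC' n)
      _ ≤ ε := hsum2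
  · intro j
    have hKm : ∀ n, AEMeasurable (fun z => ‖cv (k j) (eta (e n)) z - k j z‖ₑ) := fun n =>
      ((cv_eta_integrable (hk j) (he0 n)).sub (hk j)).aestronglyMeasurable.enorm
    calc ∫⁻ z in Ω, ‖τ j z - k j z‖ₑ
        ≤ ∫⁻ z in Ω, ∑' n, (‖cv (k j) (eta (e n)) z - k j z‖ₑ
            + ENNReal.ofReal (C n) * ‖LL k (e n) z‖ₑ) := by
          apply lintegral_mono_ae
          filter_upwards [hτ j, ae_restrict_mem hΩ.measurableSet] with z hz hzΩ
          obtain ⟨R, hR, N, h1, h2, h3⟩ := hloc z hzΩ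
          have hzb := mem_ball_self (x := z) hR
          have pz : ∀ n, N ≤ n → pd j (ζ n) z = 0 := by
            intro n hn
            have : ζ n =ᶠ[𝓝 z] fun _ => 0 := by
              filter_upwards [isOpen_ball.mem_nhds hzb] with y hy using h2 y hy n hn
            rw [pd_congr this]; simp [pd]
          rw [hz, tsum_eq_sum (s := Finset.range N) (fun n hn => by
            rw [h2 z hzb n (by simpa using hn), pz n (by simpa using hn)]; simp)]
          have e1 : ∑ n ∈ Finset.range N, (ζ n z * cv (k j) (eta (e n)) z
              + pd j (ζ n) z * LL k (e n) z) - k j z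
              = ∑ n ∈ Finset.range N, (ζ n z * (cv (k j) (eta (e n)) z - k j z)
              + pd j (ζ n) z * LL k (e n) z) := by
            have : k j z = ∑ n ∈ Finset.range N, ζ n z * k j z := by
              rw [← Finset.sum_mul, h3 z hzb, one_mul]
            conv_lhs => rw [this]
            rw [← Finset.sum_sub_distrib]
            exact Finset.sum_congr rfl fun n _ => by ring
          rw [e1]
          refine (enorm_sum_le _ _).trans (le_trans (Finset.sum_le_sum fun n _ => ?_)
            (ENNReal.sum_le_tsum (Finset.range N)))
          refine (enorm_add_le _ _).trans (add_le_add ?_ ?_)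
          · rw [← ofReal_norm, ← ofReal_norm, norm_mul, Real.norm_of_nonneg (hζ0 n z)]
            exact ENNReal.ofReal_le_ofReal (mul_le_of_le_one_left (norm_nonneg _) (hζ1 n z))
          · rw [← ofReal_norm, ← ofReal_norm, norm_mul,
              ← ENNReal.ofReal_mul (le_trans zero_le_one (hC1 n))]
            exact ENNReal.ofReal_le_ofReal (mul_le_mul_of_nonneg_right (hC n j z) (norm_nonneg _))
      _ = ∑' n, ∫⁻ z in Ω, (‖cv (k j) (eta (e n)) z - k j z‖ₑ
            + ENNReal.ofReal (C n) * ‖LL k (e n) z‖ₑ) :=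
          lintegral_tsum fun n => ((hKm n).add ((hLm n).const_mul _)).restrict
      _ ≤ ∑' n, (δ n + δ n) := by
          refine ENNReal.tsum_le_tsum fun n => ?_
          refine (setLIntegral_le_lintegral _ _).trans ?_
          rw [lintegral_add_left' (hKm n), lintegral_const_mul' _ _ ENNReal.ofReal_ne_top]
          exact add_le_add (heM n j) (heL n)
      _ ≤ ε := hsum2

/-- complex version of `u` (or its conjugate, for `s = -1`) -/
def cu (s : ℝ) (u : R2 → R2) (z : R2) : ℂ := ((u z 0 : ℝ) : ℂ) + ((s * u z 1 : ℝ) : ℂ) * Complex.I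

def cG (s : ℝ) (G : R2 → Matrix (Fin 2) (Fin 2) ℝ) (j : Fin 2) (z : R2) : ℂ :=
  ((G z 0 j : ℝ) : ℂ) + ((s * G z 1 j : ℝ) : ℂ) * Complex.I

/-- the current of `u` -/
def gg (u : R2 → R2) (G : R2 → Matrix (Fin 2) (Fin 2) ℝ) (j : Fin 2) (z : R2) : ℝ :=
  u z 0 * G z 1 j - u z 1 * G z 0 j

lemma u_coord_int {Ω : Set R2} {u : R2 → R2} (h : IntegrableOn u Ω) (i : Fin 2) :
    IntegrableOn (fun z => u z i) Ω :=
  (EuclideanSpace.proj (𝕜 := ℝ) i).integrable_comp h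

lemma cu_norm {s : ℝ} (hs : s = 1 ∨ s = -1) (u : R2 → R2) (z : R2) : ‖cu s u z‖ = ‖u z‖ := by
  unfold cu
  rw [Complex.norm_add_mul_I, EuclideanSpace.norm_eq]
  congr 1
  rw [Fin.sum_univ_two, Real.norm_eq_abs, Real.norm_eq_abs, sq_abs, sq_abs, mul_pow, sq s,
    sq_one_of hs, one_mul]

lemma cu_integrable {Ω : Set R2} {u : R2 → R2} (h : IntegrableOn u Ω) (s : ℝ) :
    IntegrableOn (cu s u) Ω :=
  ((u_coord_int h 0).ofReal (𝕜 := ℂ)).add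
    ((((u_coord_int h 1).const_mul s).ofReal (𝕜 := ℂ)).mul_const Complex.I)

lemma cG_integrable {Ω : Set R2} {G : R2 → Matrix (Fin 2) (Fin 2) ℝ}
    (h : ∀ i j : Fin 2, IntegrableOn (fun x => G x i j) Ω) (s : ℝ) (j : Fin 2) :
    IntegrableOn (cG s G j) Ω :=
  ((h 0 j).ofReal (𝕜 := ℂ)).add
    ((((h 1 j).const_mul s).ofReal (𝕜 := ℂ)).mul_const Complex.I)

lemma bdd_mul_integrable {Ω : Set R2} {φ f : R2 → ℝ} (hφ : Continuous φ) (hc : HasCompactSupport φ)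
    (hf : IntegrableOn f Ω) : IntegrableOn (fun z => φ z * f z) Ω := by
  obtain ⟨C, hC⟩ := hφ.bounded_above_of_compact_support hc
  exact hf.bdd_mul (c := C) hφ.aestronglyMeasurable (ae_of_all _ hC)

lemma cu_weak {Ω : Set R2} {u : R2 → R2} {G : R2 → Matrix (Fin 2) (Fin 2) ℝ} (hu : MemW11 Ω u G)
    (s : ℝ) : ∀ φ : R2 → ℝ, ContDiff ℝ (⊤ : ℕ∞) φ → HasCompactSupport φ → tsupport φ ⊆ Ω →
      ∀ j, ∫ z in Ω, pd j φ z • cu s u z = - ∫ z in Ω, φ z • cG s G j z := by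
  intro φ h1 h2 h3 j
  have hφ1 : ContDiff ℝ 1 φ := h1.of_le (by exact_mod_cast le_top)
  have e : ∀ (a b t : ℝ), t • (((a : ℝ) : ℂ) + ((s * b : ℝ) : ℂ) * Complex.I) =
      ((t * a : ℝ) : ℂ) + ((s * (t * b) : ℝ) : ℂ) * Complex.I := by
    intro a b t
    rw [Complex.real_smul]; push_cast; ring
  have key : ∀ (t a b : R2 → ℝ), IntegrableOn (fun z => t z * a z) Ω →
      IntegrableOn (fun z => t z * b z) Ω →
      ∫ z in Ω, t z • (((a z : ℝ) : ℂ) + ((s * b z : ℝ) : ℂ) * Complex.I) =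
      ((∫ z in Ω, t z * a z : ℝ) : ℂ) + ((s * ∫ z in Ω, t z * b z : ℝ) : ℂ) * Complex.I := by
    intro t a b ha hb
    simp_rw [e]
    refine (integral_add (ha.ofReal (𝕜 := ℂ))
      (((hb.const_mul s).ofReal (𝕜 := ℂ)).mul_const Complex.I)).trans ?_
    rw [integral_mul_const]
    have := integral_ofReal (𝕜 := ℂ) (μ := volume.restrict Ω) (f := fun z => t z * a z)
    have h2 := integral_ofReal (𝕜 := ℂ) (μ := volume.restrict Ω) (f := fun z => s * (t z * b z))
    rw [integral_const_mul] at h2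
    exact congrArg₂ (fun x y => x + y * Complex.I) this h2
  have c1 := pd_continuous hφ1 j
  have c2 := pd_compact h2 j
  unfold cu cG
  rw [key (pd j φ) _ _ (bdd_mul_integrable c1 c2 (u_coord_int hu.1 0))
    (bdd_mul_integrable c1 c2 (u_coord_int hu.1 1)),
    key φ _ _ (bdd_mul_integrable h1.continuous h2 (hu.2.1 0 j))
    (bdd_mul_integrable h1.continuous h2 (hu.2.1 1 j))]
  have w : ∀ i, ∫ z in Ω, pd j φ z * u z i = - ∫ z in Ω, φ z * G z i j := by
    intro i
    have := hu.2.2 φ h1 h2 h3 i j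
    simp_rw [mul_comm _ (φ _)] at this
    rw [← this]
    exact integral_congr_ae (ae_of_all _ fun z => mul_comm _ _)
  rw [w 0, w 1]; push_cast; ring

lemma cu_appr {Ω B : Set R2} {u : R2 → R2} {G : R2 → Matrix (Fin 2) (Fin 2) ℝ} (hu : MemW11 Ω u G)
    (hS : SphereValued Ω u) (hΩ : IsOpen Ω) (hB : IsOpen B) {δ : ℝ} (hδ : 0 < δ)
    (hsub : ∀ z ∈ B, closedBall z δ ⊆ Ω) {s : ℝ} (hs : s = 1 ∨ s = -1) :
    Appr B (cu s u) (cG s G) := by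
  refine Appr.of_weak hΩ hB hδ hsub (cu_integrable hu.1 s) ?_ (cG_integrable hu.2.1 s)
    (cu_weak hu s)
  filter_upwards [hS] with z hz
  rw [cu_norm hs, hz]

lemma cu_mul (u : R2 → R2) (z : R2) (h : ‖u z‖ = 1) : cu 1 u z * cu (-1) u z = 1 := by
  rw [EuclideanSpace.norm_eq, Real.sqrt_eq_one, Fin.sum_univ_two, Real.norm_eq_abs,
    Real.norm_eq_abs, sq_abs, sq_abs] at h
  unfold cu
  have : ((u z 0 : ℝ) : ℂ) ^ 2 + ((u z 1 : ℝ) : ℂ) ^ 2 = 1 := by exact_mod_cast h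
  push_cast
  linear_combination this - ((u z 1 : ℝ) : ℂ) ^ 2 * Complex.I_sq

lemma cG_orth {Ω : Set R2} {u : R2 → R2} {G : R2 → Matrix (Fin 2) (Fin 2) ℝ} (hu : MemW11 Ω u G)
    (hS : SphereValued Ω u) (hΩ : IsOpen Ω) (j : Fin 2) :
    ∀ᵐ z ∂(volume.restrict Ω), u z 0 * G z 0 j + u z 1 * G z 1 j = 0 := by
  refine ae_of_local hΩ fun z0 hz0 => ?_
  obtain ⟨R, hR, hRΩ⟩ := Metric.isOpen_iff.1 hΩ z0 hz0
  refine ⟨R / 2, by positivity, ?_⟩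
  have hsub : ∀ z ∈ ball z0 (R / 2), closedBall z (R / 4) ⊆ Ω := by
    intro z hz y hy
    apply hRΩ
    rw [mem_ball] at hz ⊢
    rw [mem_closedBall] at hy
    have := dist_triangle y z z0
    linarith
  have hBΩ : ball z0 (R / 2) ⊆ Ω := fun z hz => hsub z hz (mem_closedBall_self (by positivity))
  have a1 := cu_appr hu hS hΩ isOpen_ball (by positivity) hsub (Or.inl rfl : (1 : ℝ) = 1 ∨ _)
  have a2 := cu_appr hu hS hΩ isOpen_ball (by positivity) hsub (Or.inr rfl : (-1 : ℝ) = 1 ∨ _)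
  have i1 := fun j => (cG_integrable hu.2.1 1 j).mono_set hBΩ
  have i2 := fun j => (cG_integrable hu.2.1 (-1) j).mono_set hBΩ
  have b1 := a1.bdd isOpen_ball
  have b2 := a2.bdd isOpen_ball
  have m1 := a1.aesm isOpen_ball
  have m2 := a2.aesm isOpen_ball
  have hS' : ∀ᵐ z ∂(volume.restrict (ball z0 (R / 2))), ‖u z‖ = 1 :=
    ae_restrict_of_ae_restrict_of_subset hBΩ hS
  have a3 := (Appr.mul isOpen_ball a1 a2 i1 i2).congr (f' := fun _ => 1)
    (by filter_upwards [hS'] with z hz; exact cu_mul u z hz)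
    (fun j => ae_of_all _ fun z => rfl)
  have a4 := a3.grad_zero isOpen_ball (fun j => ?_) j
  · filter_upwards [a4] with z hz
    have := congrArg Complex.re hz
    simp [cu, cG] at this
    linarith
  · exact ((i1 j).mul_bdd m2 b2).add ((i2 j).bdd_mul m1 b1)

lemma cG_eq {Ω : Set R2} {u : R2 → R2} {G : R2 → Matrix (Fin 2) (Fin 2) ℝ} (hu : MemW11 Ω u G)
    (hS : SphereValued Ω u) (hΩ : IsOpen Ω) (j : Fin 2) :
    ∀ᵐ z ∂(volume.restrict Ω), cG 1 G j z = ((gg u G j z : ℝ) : ℂ) * Complex.I * cu 1 u z := by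
  filter_upwards [cG_orth hu hS hΩ j, hS] with z h1 h
  rw [EuclideanSpace.norm_eq, Real.sqrt_eq_one, Fin.sum_univ_two, Real.norm_eq_abs,
    Real.norm_eq_abs, sq_abs, sq_abs] at h
  apply Complex.ext
  · simp [cG, cu, gg]
    linear_combination (-(G z 0 j)) * h + u z 0 * h1
  · simp [cG, cu, gg]
    linear_combination (-(G z 1 j)) * h + u z 1 * h1

lemma gg_sq {Ω : Set R2} {u : R2 → R2} {G : R2 → Matrix (Fin 2) (Fin 2) ℝ} (hu : MemW11 Ω u G)
    (hS : SphereValued Ω u) (hΩ : IsOpen Ω) :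
    ∀ᵐ z ∂(volume.restrict Ω), gg u G 0 z ^ 2 + gg u G 1 z ^ 2 = ∑ i, ∑ j, (G z i j) ^ 2 := by
  filter_upwards [cG_orth hu hS hΩ 0, cG_orth hu hS hΩ 1, hS] with z h1 h2 h
  rw [EuclideanSpace.norm_eq, Real.sqrt_eq_one, Fin.sum_univ_two, Real.norm_eq_abs,
    Real.norm_eq_abs, sq_abs, sq_abs] at h
  simp [Fin.sum_univ_two, gg]
  linear_combination (G z 0 0 ^ 2 + G z 0 1 ^ 2 + G z 1 0 ^ 2 + G z 1 1 ^ 2) * h -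
    (u z 0 * G z 0 0 + u z 1 * G z 1 0) * h1 - (u z 0 * G z 0 1 + u z 1 * G z 1 1) * h2

lemma gg_integrable {Ω : Set R2} {u : R2 → R2} {G : R2 → Matrix (Fin 2) (Fin 2) ℝ}
    (hu : MemW11 Ω u G) (hS : SphereValued Ω u) (j : Fin 2) : IntegrableOn (gg u G j) Ω := by
  have hb : ∀ i, ∀ᵐ z ∂(volume.restrict Ω), ‖u z i‖ ≤ 1 := by
    intro i
    filter_upwards [hS] with z hz
    rw [← hz]; exact PiLp.norm_apply_le (u z) i
  exact ((hu.2.1 1 j).bdd_mul (u_coord_int hu.1 0).aestronglyMeasurable (hb 0)).sub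
    ((hu.2.1 0 j).bdd_mul (u_coord_int hu.1 1).aestronglyMeasurable (hb 1))

lemma Qprod_appr {B : Set R2} (hBo : IsOpen B) (hB : Bornology.IsBounded B) {ι : Type*}
    (t : Finset ι) (P : ι → R2) (s : ι → ℝ) (hs : ∀ i, s i = 1 ∨ s i = -1) :
    Appr B (fun z => ∏ i ∈ t, Q (s i) (P i) z)
      (fun j z => ((∑ i ∈ t, s i * Th j (z - P i) : ℝ) : ℂ) * Complex.I *
        ∏ i ∈ t, Q (s i) (P i) z) := by
  induction t using Finset.induction_on with
  | empty =>
    simp only [Finset.prod_empty, Finset.sum_empty]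
    refine (Appr.of_contDiff (B := B) (f := fun _ => (1 : ℂ)) contDiffOn_const (by simp)).congr
      (ae_of_all _ fun z => rfl) (fun j => ae_of_all _ fun z => ?_)
    simp [pd]
  | insert a t ha ih =>
    refine (Appr.phase_mul hBo (Appr.Q hBo hB (hs a) (P a)) ih
      (fun j => (Th_integrableOn hB (P a) j).const_mul _)
      (fun j => integrable_finsetSum _ fun i _ => (Th_integrableOn hB (P i) j).const_mul _)).congr
      (ae_of_all _ fun z => (by rw [Finset.prod_insert ha]))
      (fun j => ae_of_all _ fun z => (by rw [Finset.prod_insert ha, Finset.sum_insert ha]))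

/-- reduced current -/
def kk (Ω : Set R2) (u : R2 → R2) (G : R2 → Matrix (Fin 2) (Fin 2) ℝ) {ι : Type*} [Fintype ι]
    (P : ι → R2) (s : ι → ℝ) (j : Fin 2) (z : R2) : ℝ :=
  Ω.indicator (fun z => gg u G j z - ∑ i, s i * Th j (z - P i)) z

def ww (u : R2 → R2) {ι : Type*} [Fintype ι]
    (P : ι → R2) (s : ι → ℝ) (z : R2) : ℂ := cu 1 u z * ∏ i, Q (-s i) (P i) z

lemma kk_integrableOn {Ω : Set R2} (hb : Bornology.IsBounded Ω)
    {u : R2 → R2} {G : R2 → Matrix (Fin 2) (Fin 2) ℝ} (hu : MemW11 Ω u G)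
    (hS : SphereValued Ω u) {ι : Type*} [Fintype ι] (P : ι → R2) (s : ι → ℝ) (j : Fin 2) :
    IntegrableOn (fun z => gg u G j z - ∑ i, s i * Th j (z - P i)) Ω :=
  (gg_integrable hu hS j).sub
    (integrable_finsetSum _ fun i _ => (Th_integrableOn hb (P i) j).const_mul _)

lemma kk_integrable {Ω : Set R2} (hΩ : IsOpen Ω) (hb : Bornology.IsBounded Ω)
    {u : R2 → R2} {G : R2 → Matrix (Fin 2) (Fin 2) ℝ} (hu : MemW11 Ω u G)
    (hS : SphereValued Ω u) {ι : Type*} [Fintype ι] (P : ι → R2) (s : ι → ℝ) (j : Fin 2) :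
    Integrable (kk Ω u G P s j) :=
  (integrable_indicator_iff hΩ.measurableSet).2 (kk_integrableOn hb hu hS P s j)

lemma ww_norm {Ω : Set R2} {u : R2 → R2} (hS : SphereValued Ω u) {ι : Type*} [Fintype ι]
    (P : ι → R2) (s : ι → ℝ) (hs : ∀ i, s i = 1 ∨ s i = -1) :
    ∀ᵐ z ∂(volume.restrict Ω), ‖ww u P s z‖ = 1 := by
  have : ∀ i, ∀ᵐ z ∂(volume.restrict Ω), z ≠ P i := fun i =>
    ae_restrict_of_ae (by simp [ae_iff])
  filter_upwards [hS, ae_all_iff.2 this] with z h1 h2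
  unfold ww
  rw [norm_mul, norm_prod, cu_norm (Or.inl rfl), h1, one_mul]
  refine Finset.prod_eq_one fun i _ => Q_norm ?_ (h2 i)
  rcases hs i with h | h <;> simp [h]

lemma ww_appr {Ω : Set R2} (hΩ : IsOpen Ω) (hb : Bornology.IsBounded Ω) {u : R2 → R2}
    {G : R2 → Matrix (Fin 2) (Fin 2) ℝ} (hu : MemW11 Ω u G)
    (hS : SphereValued Ω u) {ι : Type*} [Fintype ι]
    (P : ι → R2) (s : ι → ℝ) (hs : ∀ i, s i = 1 ∨ s i = -1) (p : R2) (R δ : ℝ) (hR : 0 < R)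
    (hδ : 0 < δ) (hsub : ∀ z ∈ ball p R, closedBall z δ ⊆ Ω) :
    Appr (ball p R) (ww u P s) (fun j z => (kk Ω u G P s j z : ℂ) * Complex.I * ww u P s z) := by
  have hBΩ : ball p R ⊆ Ω := fun z hz => hsub z hz (mem_closedBall_self hδ.le)
  have a1 := (cu_appr hu hS hΩ isOpen_ball hδ hsub (Or.inl rfl : (1 : ℝ) = 1 ∨ _)).congr
    (ae_of_all _ fun z => rfl)
    (fun j => ae_restrict_of_ae_restrict_of_subset hBΩ (cG_eq hu hS hΩ j))
  have a2 := Qprod_appr (B := ball p R) isOpen_ball isBounded_ball Finset.univ P (fun i => - s i)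
    (fun i => by rcases hs i with h | h <;> simp [h])
  refine (Appr.phase_mul isOpen_ball a1 a2 (fun j => (gg_integrable hu hS j).mono_set hBΩ)
    (fun j => integrable_finsetSum _ fun i _ =>
      (Th_integrableOn isBounded_ball (P i) j).const_mul _)).congr (ae_of_all _ fun z => rfl)
    (fun j => ?_)
  filter_upwards [ae_restrict_mem measurableSet_ball] with z hz
  unfold kk ww
  rw [indicator_of_mem (hBΩ hz)]
  simp only [neg_mul, Finset.sum_neg_distrib, sub_eq_add_neg]

lemma pd_zero_of_notMem {φ : R2 → ℝ} {Ω : Set R2} (h : tsupport φ ⊆ Ω) {z : R2} (hz : z ∉ Ω)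
    (j : Fin 2) : pd j φ z = 0 := by
  unfold pd
  rw [fderiv_of_notMem_tsupport ℝ (fun h' => hz (h h'))]
  rfl

lemma memLip0_of_test {Ω : Set R2} (hΩ : IsOpen Ω) {φ : R2 → ℝ} (h1 : ContDiff ℝ (⊤ : ℕ∞) φ)
    (h2 : HasCompactSupport φ) (h3 : tsupport φ ⊆ Ω) : MemLip0 Ω φ := by
  refine ⟨?_, fun p hp => ?_⟩
  · obtain ⟨C, hC⟩ := (ContDiff.lipschitzWith_of_hasCompactSupport h2
      (h1.of_le (by exact_mod_cast le_top : (1 : WithTop ℕ∞) ≤ ((⊤ : ℕ∞) : WithTop ℕ∞))) one_ne_zero)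
    exact ⟨C, hC.lipschitzOnWith⟩
  · have : p ∉ Ω := by
      rw [hΩ.frontier_eq] at hp; exact hp.2
    exact image_eq_zero_of_notMem_tsupport fun h => this (h3 h)

lemma kk_closed {Ω : Set R2} (hΩ : IsOpen Ω) (hb : Bornology.IsBounded Ω) {u : R2 → R2}
    {G : R2 → Matrix (Fin 2) (Fin 2) ℝ} (hu : MemW11 Ω u G)
    (hS : SphereValued Ω u) {ι : Type*} [Fintype ι]
    (P : ι → R2) (s : ι → ℝ)
    (hdet : ∀ φ : R2 → ℝ, MemLip0 Ω φ → detPairing Ω u G φ = Real.pi * ∑ i, s i * φ (P i)) :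
    Closed1 Ω (kk Ω u G P s) := by
  intro φ h1 h2 h3
  have hφ1 : ContDiff ℝ 1 φ := h1.of_le (by exact_mod_cast le_top)
  have c := fun j => pd_continuous hφ1 j
  have hc := fun j => pd_compact h2 j
  have ind : ∀ i j, ∫ y, pd i φ y * kk Ω u G P s j y =
      ∫ y in Ω, pd i φ y * (gg u G j y - ∑ i, s i * Th j (y - P i)) := by
    intro i j
    rw [← integral_indicator hΩ.measurableSet]
    refine integral_congr_ae (ae_of_all _ fun y => ?_)
    by_cases hy : y ∈ Ω <;> simp [kk, indicator, hy]
  rw [ind, ind, ← sub_eq_zero, ← integral_sub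
    (bdd_mul_integrable (c 1) (hc 1) (kk_integrableOn hb hu hS P s 0))
    (bdd_mul_integrable (c 0) (hc 0) (kk_integrableOn hb hu hS P s 1))]
  have Ti : ∀ i (m j : Fin 2), IntegrableOn (fun y => pd m φ y * Th j (y - P i)) Ω := fun i m j =>
    bdd_mul_integrable (c m) (hc m) (Th_integrableOn hb (P i) j)
  have A : ∫ y in Ω, (1 / 2 : ℝ) * (pd 1 φ y * gg u G 0 y - pd 0 φ y * gg u G 1 y) =
      Real.pi * ∑ i, s i * φ (P i) := by
    rw [← hdet φ (memLip0_of_test hΩ h1 h2 h3)]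
    unfold detPairing
    refine integral_congr_ae (ae_of_all _ fun y => ?_)
    simp only [Fin.sum_univ_two, lambdaVec, gg]
    simp only [Matrix.cons_val_zero, Matrix.cons_val_one, pd, eb]
    ring
  have Bq : ∀ i, ∫ y in Ω, (pd 1 φ y * Th 0 (y - P i) - pd 0 φ y * Th 1 (y - P i)) =
      2 * Real.pi * φ (P i) := by
    intro i
    have := kerS_div hφ1 h2 (P i)
    rw [setIntegral_eq_integral_of_forall_compl_eq_zero]
    · rw [← neg_eq_iff_eq_neg, ← integral_neg] at this
      rw [← this]
      refine integral_congr_ae (ae_of_all _ fun y => ?_)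
      simp [Th]; ring
    · intro y hy
      simp [pd_zero_of_notMem h3 hy]
  rw [integral_const_mul] at A
  have C : ∫ y in Ω, (∑ i, s i * (pd 1 φ y * Th 0 (y - P i) - pd 0 φ y * Th 1 (y - P i))) =
      2 * Real.pi * ∑ i, s i * φ (P i) := by
    refine (integral_finsetSum _
      fun i _ => ((Ti i 1 0).sub (Ti i 0 1)).const_mul (s i)).trans ?_
    rw [Finset.mul_sum]
    refine Finset.sum_congr rfl fun i _ => ?_
    refine (integral_const_mul (s i) _).trans ?_
    rw [show 2 * Real.pi * (s i * φ (P i)) = s i * (2 * Real.pi * φ (P i)) by ring, ← Bq i]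
    rfl
  have D : ∫ y in Ω, ((pd 1 φ y * gg u G 0 y - pd 0 φ y * gg u G 1 y) -
      (∑ i, s i * (pd 1 φ y * Th 0 (y - P i) - pd 0 φ y * Th 1 (y - P i)))) = 0 := by
    rw [integral_sub, C]
    · linarith
    · exact (bdd_mul_integrable (c 1) (hc 1) (gg_integrable hu hS 0)).sub
        (bdd_mul_integrable (c 0) (hc 0) (gg_integrable hu hS 1))
    · exact integrable_finsetSum _ fun i _ => ((Ti i 1 0).sub (Ti i 0 1)).const_mul (s i)
  rw [← D]
  refine integral_congr_ae (ae_of_all _ fun y => ?_)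
  simp only [mul_sub, Finset.sum_sub_distrib, Finset.mul_sum]
  have e : ∀ (a b : Fin 2), ∑ i, pd a φ y * (s i * Th b (y - P i)) =
    ∑ i, s i * (pd a φ y * Th b (y - P i)) := fun a b => Finset.sum_congr rfl fun i _ => by ring
  rw [e, e]
  ring

/-- average of the translates of `f` along the segment `p + t e` -/
def Seg (f : R2 → ℝ) (p e z : R2) : ℝ := ∫ t in (0 : ℝ)..1, f (z - (p + t • e))

lemma gam_cont (z p e : R2) : Continuous fun t : ℝ => z - (p + t • e) := by fun_prop

lemma Seg_hasFDerivAt {f : R2 → ℝ} (hf : ContDiff ℝ 1 f) (p e z : R2) :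
    HasFDerivAt (Seg f p e) (∫ t in (0 : ℝ)..1, fderiv ℝ f (z - (p + t • e))) z := by
  have hc : Continuous (fderiv ℝ f) := hf.continuous_fderiv (by simp)
  have hc2 : Continuous fun a : R2 × ℝ => ‖fderiv ℝ f (a.1 - (p + a.2 • e))‖ := by
    refine (hc.comp ?_).norm
    fun_prop
  obtain ⟨C, hC⟩ := ((isCompact_closedBall z 1).prod (isCompact_Icc (a := (0 : ℝ)) (b := 1))).bddAbove_image
    hc2.continuousOn
  refine intervalIntegral.hasFDerivAt_integral_of_dominated_of_fderiv_le (𝕜 := ℝ)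
    (F := fun x t => f (x - (p + t • e)))
    (F' := fun x t => fderiv ℝ f (x - (p + t • e))) (bound := fun _ => C)
    (closedBall_mem_nhds z one_pos)
    (Eventually.of_forall fun x => (hf.continuous.comp (gam_cont x p e)).aestronglyMeasurable)
    ((hf.continuous.comp (gam_cont z p e)).intervalIntegrable _ _)
    (hc.comp (gam_cont z p e)).aestronglyMeasurable
    (ae_of_all _ fun t ht x hx => ?_) (by simp) (ae_of_all _ fun t ht x hx => ?_)
  · rw [uIoc_of_le zero_le_one] at ht
    exact hC ⟨(x, t), ⟨hx, ht.1.le, ht.2⟩, rfl⟩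
  · exact ((hf.differentiable one_ne_zero).differentiableAt.hasFDerivAt).comp x
      ((hasFDerivAt_id x).sub_const (p + t • e))

lemma pd_Seg {f : R2 → ℝ} (hf : ContDiff ℝ 1 f) (p e z : R2) (j : Fin 2) :
    pd j (Seg f p e) z = Seg (pd j f) p e z := by
  have hc : Continuous (fderiv ℝ f) := hf.continuous_fderiv (by simp)
  unfold pd
  rw [(Seg_hasFDerivAt hf p e z).fderiv]
  exact (ContinuousLinearMap.intervalIntegral_apply
    ((hc.comp (gam_cont z p e)).intervalIntegrable _ _) (eb j))

lemma Seg_continuous {f : R2 → ℝ} (hf : Continuous f) (p e : R2) : Continuous (Seg f p e) := by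
  unfold Seg
  refine intervalIntegral.continuous_parametric_intervalIntegral_of_continuous' (f := fun x t => f (x - (p + t • e))) ?_ _ _
  exact hf.comp (by fun_prop)

lemma Seg_contDiff {f : R2 → ℝ} (hf : ContDiff ℝ 1 f) (p e : R2) : ContDiff ℝ 1 (Seg f p e) := by
  rw [← contDiffOn_univ]
  refine contDiffOn_one_of_hasFDerivAt isOpen_univ (fun z _ => Seg_hasFDerivAt hf p e z) ?_
  refine (intervalIntegral.continuous_parametric_intervalIntegral_of_continuous' (f := fun x t => fderiv ℝ f (x - (p + t • e))) ?_ _ _).continuousOn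
  exact (hf.continuous_fderiv (by simp)).comp (by fun_prop)

lemma Seg_ftc {f : R2 → ℝ} (hf : ContDiff ℝ 1 f) (p e z : R2) :
    e 0 * Seg (pd 0 f) p e z + e 1 * Seg (pd 1 f) p e z = f (z - p) - f (z - (p + e)) := by
  have h : ∀ t : ℝ, HasDerivAt (fun t : ℝ => - f (z - (p + t • e)))
      (e 0 * pd 0 f (z - (p + t • e)) + e 1 * pd 1 f (z - (p + t • e))) t := by
    intro t
    have h1 : HasDerivAt (fun t : ℝ => z - (p + t • e)) (-e) t := by
      have := (((hasDerivAt_id t).smul_const e).const_add p).const_sub z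
      simpa using this
    have h2 := ((hf.differentiable one_ne_zero).differentiableAt (x := z - (p + t • e))).hasFDerivAt.comp_hasDerivAt t h1
    have h3 := h2.neg
    rw [fderiv_apply_pd] at h3
    refine h3.congr_deriv ?_
    simp only [PiLp.neg_apply]; ring
  have c := fun j => (pd_continuous hf j).comp (gam_cont z p e)
  have := intervalIntegral.integral_eq_sub_of_hasDerivAt (a := 0) (b := 1) (fun t _ => h t)
    ((((c 0).const_mul (e 0)).add ((c 1).const_mul (e 1))).intervalIntegrable _ _)
  have h2 := intervalIntegral.integral_add (((c 0).const_mul (e 0)).intervalIntegrable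
    (μ := volume) 0 1) (((c 1).const_mul (e 1)).intervalIntegrable (μ := volume) 0 1)
  rw [intervalIntegral.integral_const_mul, intervalIntegral.integral_const_mul] at h2
  unfold Seg
  refine h2.symm.trans (this.trans ?_)
  simp; ring

/-- smoothed angle function of the dipole `p`, `p + e` -/
def dip (r : ℝ) (p e z : R2) : ℝ := e 1 * Seg (kerr r 0) p e z - e 0 * Seg (kerr r 1) p e z

lemma kerr_C1 {r : ℝ} (hr : 0 < r) (j : Fin 2) : ContDiff ℝ 1 (kerr r j) :=
  (kerr_contDiff hr j).of_le (by exact_mod_cast le_top)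

lemma dip_contDiff {r : ℝ} (hr : 0 < r) (p e : R2) : ContDiff ℝ 1 (dip r p e) :=
  (contDiff_const.mul (Seg_contDiff (kerr_C1 hr 0) p e)).sub
    (contDiff_const.mul (Seg_contDiff (kerr_C1 hr 1) p e))

lemma Seg_div {r : ℝ} (hr : 0 < r) (p e z : R2) :
    Seg (pd 0 (kerr r 0)) p e z + Seg (pd 1 (kerr r 1)) p e z =
      2 * Real.pi * Seg (eta r) p e z := by
  have c := fun j l => (pd_continuous (kerr_C1 hr j) l).comp (gam_cont z p e)
  unfold Seg
  rw [← intervalIntegral.integral_const_mul]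
  refine (intervalIntegral.integral_add ((c 0 0).intervalIntegrable _ _)
    ((c 1 1).intervalIntegrable _ _)).symm.trans ?_
  refine intervalIntegral.integral_congr fun t _ => kerr_div hr _

lemma pd_dip {r : ℝ} (hr : 0 < r) (p e z : R2) (j : Fin 2) :
    pd j (dip r p e) z = e 1 * Seg (pd j (kerr r 0)) p e z - e 0 * Seg (pd j (kerr r 1)) p e z := by
  have d := fun i => ((Seg_contDiff (kerr_C1 hr i) p e).differentiable one_ne_zero).differentiableAt (x := z)
  rw [← pd_Seg (kerr_C1 hr 0), ← pd_Seg (kerr_C1 hr 1)]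
  unfold pd
  have := ((d 0).hasFDerivAt.const_mul (e 1)).sub ((d 1).hasFDerivAt.const_mul (e 0))
  have h2 : fderiv ℝ (dip r p e) z = _ := this.fderiv
  rw [h2]
  simp

/-- regularised angular kernel -/
def Thr (r : ℝ) (j : Fin 2) (z : R2) : ℝ := ![-kerr r 1 z, kerr r 0 z] j

lemma pd_dip0 {r : ℝ} (hr : 0 < r) (p e z : R2) :
    pd 0 (dip r p e) z = Thr r 0 (z - p) - Thr r 0 (z - (p + e)) +
      2 * Real.pi * (e 1 * Seg (eta r) p e z) := by
  rw [pd_dip hr]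
  have h1 := Seg_div hr p e z
  have h2 := Seg_ftc (kerr_C1 hr 1) p e z
  simp only [Thr, Matrix.cons_val_zero]
  linear_combination e 1 * h1 - h2

lemma pd_dip1 {r : ℝ} (hr : 0 < r) (p e z : R2) :
    pd 1 (dip r p e) z = Thr r 1 (z - p) - Thr r 1 (z - (p + e)) -
      2 * Real.pi * (e 0 * Seg (eta r) p e z) := by
  rw [pd_dip hr]
  have h1 := Seg_div hr p e z
  have h2 := Seg_ftc (kerr_C1 hr 0) p e z
  simp only [Thr, Matrix.cons_val_one, Matrix.cons_val_zero]
  linear_combination (-(e 0)) * h1 + h2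

lemma Seg_eta_nonneg (r : ℝ) (p e z : R2) : 0 ≤ Seg (eta r) p e z :=
  intervalIntegral.integral_nonneg zero_le_one fun t _ => eta_nonneg r _

lemma Seg_eta_lintegral {r : ℝ} (hr : 0 < r) (p e : R2) :
    ∫⁻ z, ENNReal.ofReal (Seg (eta r) p e z) = 1 := by
  have h : ∀ z, ENNReal.ofReal (Seg (eta r) p e z) =
      ∫⁻ t in Ioc (0 : ℝ) 1, ENNReal.ofReal (eta r (z - (p + t • e))) := by
    intro z
    unfold Seg
    rw [intervalIntegral.integral_of_le zero_le_one, ofReal_integral_eq_lintegral_ofReal]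
    · exact (((eta_contDiff r).continuous.comp (gam_cont z p e)).intervalIntegrable
        (μ := volume) 0 1).1
    · exact ae_of_all _ fun t => eta_nonneg r _
  simp_rw [h]
  rw [lintegral_lintegral_swap]
  · have h2 : ∀ t : ℝ, ∫⁻ z : R2, ENNReal.ofReal (eta r (z - (p + t • e))) = 1 := by
      intro t
      rw [lintegral_sub_right_eq_self (fun z => ENNReal.ofReal (eta r z)), ← eta_lintegral hr]
      refine lintegral_congr fun z => ?_
      rw [Real.enorm_of_nonneg (eta_nonneg r z)]
    simp_rw [h2]
    simp
  · refine Measurable.aemeasurable ?_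
    refine ENNReal.measurable_ofReal.comp (Continuous.measurable ?_)
    exact (eta_contDiff r).continuous.comp (by fun_prop)

lemma Thr_diff_le {r : ℝ} (hr : 0 < r) (j : Fin 2) (z : R2) :
    |Thr r j z - Th j z| ≤ (ball (0 : R2) r).indicator (fun z => ‖z‖⁻¹) z := by
  have key : ∀ i, |kerr r i z - kerS i z| ≤ (ball (0 : R2) r).indicator (fun z => ‖z‖⁻¹) z := by
    intro i
    by_cases h : z ∈ ball (0 : R2) r
    · rw [indicator_of_mem h, kerr_eq,
        show cut r z * kerS i z - kerS i z = -((1 - cut r z) * kerS i z) by ring, abs_neg, abs_mul,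
        abs_of_nonneg (by linarith [cut_le_one r z])]
      calc (1 - cut r z) * |kerS i z| ≤ 1 * |kerS i z| := by
            gcongr; linarith [cut_nonneg r z]
        _ ≤ _ := by rw [one_mul]; exact kerS_abs_le i z
    · rw [indicator_of_notMem h, kerr_eq_of_ge hr]
      · simp
      · simpa using h
  fin_cases j
  · simp only [Thr, Th]
    have := key 1
    rw [← abs_neg] at this
    simpa [neg_add_eq_sub] using this
  · simpa [Thr, Th] using key 0

lemma invnorm_lint {r : ℝ} (hr : 0 < r) (p : R2) :
    ∫⁻ z, ENNReal.ofReal ((ball (0 : R2) r).indicator (fun z => ‖z‖⁻¹) (z - p)) =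
      ENNReal.ofReal (2 * Real.pi * r) := by
  rw [lintegral_sub_right_eq_self
    (fun z => ENNReal.ofReal ((ball (0 : R2) r).indicator (fun z => ‖z‖⁻¹) z)),
    ← invnorm_integral hr, ← integral_indicator measurableSet_ball,
    ofReal_integral_eq_lintegral_ofReal]
  · exact (integrable_indicator_iff measurableSet_ball).2 (invnorm_integrableOn r)
  · exact ae_of_all _ fun z => indicator_nonneg (fun z _ => by positivity) z

lemma sqrt_add_le (a b c d : ℝ) :
    Real.sqrt ((a + c) ^ 2 + (b + d) ^ 2) ≤ Real.sqrt (a ^ 2 + b ^ 2) + (|c| + |d|) := by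
  rw [Real.sqrt_le_iff]
  refine ⟨by positivity, ?_⟩
  have h1 := Real.sq_sqrt (show 0 ≤ a ^ 2 + b ^ 2 by positivity)
  have h2 : |a| ≤ Real.sqrt (a ^ 2 + b ^ 2) := Real.abs_le_sqrt (by nlinarith [sq_nonneg b])
  have h3 : |b| ≤ Real.sqrt (a ^ 2 + b ^ 2) := Real.abs_le_sqrt (by nlinarith [sq_nonneg a])
  have h4 : a * c ≤ Real.sqrt (a ^ 2 + b ^ 2) * |c| := by
    calc a * c ≤ |a * c| := le_abs_self _
      _ = |a| * |c| := abs_mul _ _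
      _ ≤ _ := by gcongr
  have h5 : b * d ≤ Real.sqrt (a ^ 2 + b ^ 2) * |d| := by
    calc b * d ≤ |b * d| := le_abs_self _
      _ = |b| * |d| := abs_mul _ _
      _ ≤ _ := by gcongr
  nlinarith [sq_abs c, sq_abs d, mul_nonneg (abs_nonneg c) (abs_nonneg d)]

/-- gradient defect of the smoothed dipole angle -/
def dd (r : ℝ) (p e : R2) (j : Fin 2) (z : R2) : ℝ :=
  pd j (dip r p e) z - Th j (z - p) + Th j (z - (p + e))

lemma dd_lintegral {r : ℝ} (hr : 0 < r) (p e : R2) :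
    ∫⁻ z, ENNReal.ofReal (Real.sqrt (dd r p e 0 z ^ 2 + dd r p e 1 z ^ 2)) ≤
      ENNReal.ofReal (2 * Real.pi * ‖e‖) + ENNReal.ofReal (8 * Real.pi * r) := by
  set I : R2 → ℝ := (ball (0 : R2) r).indicator (fun z => ‖z‖⁻¹) with hI
  have hI0 : ∀ z, 0 ≤ I z := fun z => indicator_nonneg (fun z _ => by positivity) z
  have hIm : Measurable I := by
    refine Measurable.indicator ?_ measurableSet_ball
    fun_prop
  have hd : ∀ j z, |(Thr r j (z - p) - Th j (z - p)) + -(Thr r j (z - (p + e)) - Th j (z - (p + e)))|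
      ≤ I (z - p) + I (z - (p + e)) := by
    intro j z
    refine (abs_add_le _ _).trans ?_
    rw [abs_neg]
    exact add_le_add (Thr_diff_le hr j _) (Thr_diff_le hr j _)
  have pt : ∀ z, Real.sqrt (dd r p e 0 z ^ 2 + dd r p e 1 z ^ 2) ≤
      2 * Real.pi * ‖e‖ * Seg (eta r) p e z + 2 * (I (z - p) + I (z - (p + e))) := by
    intro z
    have e0 : dd r p e 0 z = 2 * Real.pi * (e 1 * Seg (eta r) p e z) +
        ((Thr r 0 (z - p) - Th 0 (z - p)) + -(Thr r 0 (z - (p + e)) - Th 0 (z - (p + e)))) := by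
      unfold dd; rw [pd_dip0 hr]; ring
    have e1 : dd r p e 1 z = - (2 * Real.pi * (e 0 * Seg (eta r) p e z)) +
        ((Thr r 1 (z - p) - Th 1 (z - p)) + -(Thr r 1 (z - (p + e)) - Th 1 (z - (p + e)))) := by
      unfold dd; rw [pd_dip1 hr]; ring
    rw [e0, e1]
    refine (sqrt_add_le _ _ _ _).trans ?_
    have hs : Real.sqrt ((2 * Real.pi * (e 1 * Seg (eta r) p e z)) ^ 2 +
        (-(2 * Real.pi * (e 0 * Seg (eta r) p e z))) ^ 2) = 2 * Real.pi * ‖e‖ * Seg (eta r) p e z := by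
      have hn := R2_normSq e
      rw [show (2 * Real.pi * (e 1 * Seg (eta r) p e z)) ^ 2 +
        (-(2 * Real.pi * (e 0 * Seg (eta r) p e z))) ^ 2 = (2 * Real.pi * ‖e‖ * Seg (eta r) p e z) ^ 2 by
        linear_combination (-((2 * Real.pi * Seg (eta r) p e z) ^ 2)) * hn]
      exact Real.sqrt_sq (by have := Seg_eta_nonneg r p e z; positivity)
    rw [hs]
    have := hd 0 z
    have := hd 1 z
    linarith
  calc ∫⁻ z, ENNReal.ofReal (Real.sqrt (dd r p e 0 z ^ 2 + dd r p e 1 z ^ 2))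
      ≤ ∫⁻ z, (ENNReal.ofReal (2 * Real.pi * ‖e‖) * ENNReal.ofReal (Seg (eta r) p e z) +
        2 * (ENNReal.ofReal (I (z - p)) + ENNReal.ofReal (I (z - (p + e))))) := by
        refine lintegral_mono fun z => ?_
        refine (ENNReal.ofReal_le_ofReal (pt z)).trans (ENNReal.ofReal_add_le.trans ?_)
        rw [ENNReal.ofReal_mul (p := 2 * Real.pi * ‖e‖) (by positivity),
          ENNReal.ofReal_mul (p := 2) (q := I (z - p) + I (z - (p + e))) (by norm_num),
          ENNReal.ofReal_add (hI0 _) (hI0 _), ENNReal.ofReal_ofNat]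
    _ = ENNReal.ofReal (2 * Real.pi * ‖e‖) + 2 * (ENNReal.ofReal (2 * Real.pi * r) +
        ENNReal.ofReal (2 * Real.pi * r)) := by
        rw [lintegral_add_left, lintegral_const_mul, Seg_eta_lintegral hr, mul_one,
          lintegral_const_mul, lintegral_add_left, invnorm_lint hr, invnorm_lint hr]
        · exact ENNReal.measurable_ofReal.comp (hIm.comp (measurable_id.sub_const p))
        · exact (ENNReal.measurable_ofReal.comp (hIm.comp (measurable_id.sub_const p))).add
            (ENNReal.measurable_ofReal.comp (hIm.comp (measurable_id.sub_const (p + e))))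
        · exact (ENNReal.measurable_ofReal.comp
            (Seg_continuous (eta_contDiff r).continuous p e).measurable)
        · exact (ENNReal.measurable_ofReal.comp
            (Seg_continuous (eta_contDiff r).continuous p e).measurable).const_mul _
    _ ≤ _ := by
        refine add_le_add le_rfl (le_of_eq ?_)
        rw [← ENNReal.ofReal_add (by positivity) (by positivity), two_mul,
          ← ENNReal.ofReal_add (by positivity) (by positivity)]
        congr 1; ring

lemma ex_hasDerivAt {A : ℝ → ℝ} {a t : ℝ} (h : HasDerivAt A a t) :
    HasDerivAt (fun t => ex (A t)) ((a : ℂ) * Complex.I * ex (A t)) t := by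
  unfold ex
  have := (h.ofReal_comp.mul_const Complex.I).cexp
  refine this.congr_deriv ?_
  ring

lemma Q_shift (s : ℝ) (p z : R2) : Q s p z = Q s 0 (z - p) := by simp [Q]

lemma Q_mul_inv {s : ℝ} (hs : s = 1 ∨ s = -1) {p z : R2} (h : z ≠ p) :
    Q s p z * Q (-s) p z = 1 := by
  have hp : ‖z - p‖ ≠ 0 := norm_ne_zero_iff.2 (sub_ne_zero.2 h)
  have hn := R2_normSq (z - p)
  simp only [PiLp.sub_apply] at hn
  have hs2 : s ^ 2 = 1 := by rw [sq]; exact sq_one_of hs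
  have hn' : ((‖z - p‖ : ℝ) : ℂ) ^ 2 = ((z 0 - p 0 : ℝ) : ℂ) ^ 2 + ((z 1 - p 1 : ℝ) : ℂ) ^ 2 := by
    exact_mod_cast hn
  have hs' : (s : ℂ) ^ 2 = 1 := by exact_mod_cast hs2
  have hp' : ((‖z - p‖ : ℝ) : ℂ) ≠ 0 := by exact_mod_cast hp
  unfold Q
  rw [Complex.ofReal_inv]
  field_simp
  rw [hn']
  push_cast
  linear_combination ((z 1 : ℂ) - p 1) ^ 2 * hs' - (s : ℂ) ^ 2 * ((z 1 : ℂ) - p 1) ^ 2 * Complex.I_sq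

lemma line_null (p e : R2) : ∀ᵐ z : R2, ∀ t : ℝ, z - (p + t • e) ≠ 0 := by
  have h1 : (AffineSubspace.mk' p (Submodule.span ℝ {e})) ≠ ⊤ := by
    intro h
    have h2 := congrArg AffineSubspace.direction h
    rw [AffineSubspace.direction_mk', AffineSubspace.direction_top] at h2
    have h3 := finrank_span_le_card (R := ℝ) ({e} : Set R2)
    rw [h2, finrank_top, finrank_R2] at h3
    simp at h3
  have h2 := Measure.addHaar_affineSubspace (volume : Measure R2) _ h1
  rw [ae_iff]
  refine measure_mono_null (fun z hz => ?_) h2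
  simp only [mem_ofPred_eq, not_forall, not_not] at hz
  obtain ⟨t, ht⟩ := hz
  rw [sub_eq_zero] at ht
  rw [SetLike.mem_coe, AffineSubspace.mem_mk', ht]
  simp [Submodule.mem_span_singleton]

lemma ex_dip_eq {p e z : R2} (hz : ∀ t : ℝ, z - (p + t • e) ≠ 0) :
    ∃ δ > 0, ∀ r, 0 < r → r < δ → ex (dip r p e z) = Q 1 p z * Q (-1) (p + e) z := by
  obtain ⟨t0, -, ht0⟩ := (isCompact_Icc (a := (0 : ℝ)) (b := 1)).exists_isMinOn
    ⟨0, by simp⟩ (gam_cont z p e).norm.continuousOn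
  refine ⟨‖z - (p + t0 • e)‖, norm_pos_iff.2 (hz t0), fun r hr hrδ => ?_⟩
  set α : ℝ → ℝ := fun t => e 1 * kerS 0 (z - (p + t • e)) - e 0 * kerS 1 (z - (p + t • e)) with hα
  have kc : ∀ j, Continuous fun t : ℝ => kerS j (z - (p + t • e)) := by
    intro j
    unfold kerS
    refine Continuous.div ?_ ?_ ?_
    · exact (coord_contDiff (n := 0) j).continuous.comp (gam_cont z p e)
    · exact (gam_cont z p e).norm.pow 2
    · intro t
      exact pow_ne_zero 2 (norm_ne_zero_iff.2 (hz t))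
  have αc : Continuous α := ((kc 0).const_mul _).sub ((kc 1).const_mul _)
  have h1 : dip r p e z = ∫ t in (0 : ℝ)..1, α t := by
    have hs : ∀ j, Seg (kerr r j) p e z = ∫ t in (0 : ℝ)..1, kerS j (z - (p + t • e)) := by
      intro j
      refine intervalIntegral.integral_congr fun t ht => ?_
      rw [uIcc_of_le zero_le_one] at ht
      exact kerr_eq_of_ge hr j (hrδ.le.trans (ht0 ht))
    unfold dip
    rw [hs, hs, ← intervalIntegral.integral_const_mul, ← intervalIntegral.integral_const_mul,
      ← intervalIntegral.integral_sub (((kc 0).const_mul _).intervalIntegrable _ _)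
        (((kc 1).const_mul _).intervalIntegrable _ _)]
  set A : ℝ → ℝ := fun s => ∫ t in (0 : ℝ)..s, α t with hA
  have hAd : ∀ t, HasDerivAt A (α t) t := fun t =>
    intervalIntegral.integral_hasDerivAt_right (αc.intervalIntegrable _ _)
      (αc.stronglyMeasurableAtFilter _ _) αc.continuousAt
  have hQd : ∀ t : ℝ, HasDerivAt (fun t : ℝ => Q 1 0 (z - (p + t • e)))
      (-((α t : ℂ) * Complex.I * Q 1 0 (z - (p + t • e)))) t := by
    intro t
    have h1 : HasDerivAt (fun t : ℝ => z - (p + t • e)) (-e) t := by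
      have := (((hasDerivAt_id t).smul_const e).const_add p).const_sub z
      simpa using this
    have h2 := ((Q_contDiffAt 1 (hz t)).differentiableAt (by simp)).hasFDerivAt.comp_hasDerivAt t h1
    refine h2.congr_deriv ?_
    have h3 : fderiv ℝ (Q 1 0) (z - (p + t • e)) (-e) =
        -(e 0 • pd 0 (Q 1 0) (z - (p + t • e)) + e 1 • pd 1 (Q 1 0) (z - (p + t • e))) := by
      generalize z - (p + t • e) = y
      conv_lhs => rw [R2_decomp e]
      simp only [map_neg, map_add, map_smul, pd]
    rw [h3, pd_Q (Or.inl rfl) (hz t), pd_Q (Or.inl rfl) (hz t), hα]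
    simp only [Th, sub_zero, one_mul, Matrix.cons_val_zero, Matrix.cons_val_one, Complex.real_smul]
    push_cast; ring
  have hconst : ∀ t, HasDerivAt (fun t => ex (A t) * Q 1 0 (z - (p + t • e))) 0 t := by
    intro t
    refine ((ex_hasDerivAt (hAd t)).mul (hQd t)).congr_deriv ?_
    ring
  have h2 := is_const_of_deriv_eq_zero (fun t => (hconst t).differentiableAt)
    (fun t => (hconst t).deriv) 1 0
  simp only [hA, intervalIntegral.integral_same, ex_zero, one_mul, one_smul, zero_smul, add_zero]
    at h2
  have hz1 : z ≠ p + e := by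
    have := hz 1
    rw [one_smul] at this
    exact sub_ne_zero.1 this
  rw [h1, Q_shift 1 p, ← h2, ← Q_shift 1 (p + e), mul_assoc, Q_mul_inv (Or.inl rfl) hz1, mul_one]

/-- Euclidean norm of the vector `(a, b)` -/
def vn (a b : ℝ) : ℝ := Real.sqrt (a ^ 2 + b ^ 2)

lemma vn_eq (a b : ℝ) : vn a b = ‖((a : ℂ) + (b : ℂ) * Complex.I)‖ := by
  rw [Complex.norm_add_mul_I, vn]

lemma vn_nonneg (a b : ℝ) : 0 ≤ vn a b := Real.sqrt_nonneg _

lemma vn_le (a b : ℝ) : vn a b ≤ |a| + |b| := by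
  rw [vn_eq]
  refine (norm_add_le _ _).trans ?_
  simp

lemma vn_add (a b c d : ℝ) : vn (a + c) (b + d) ≤ vn a b + vn c d := by
  simp only [vn_eq]
  refine le_trans (le_of_eq ?_) (norm_add_le _ _)
  congr 1; push_cast; ring

lemma vn_sum {ι : Type*} (t : Finset ι) (a b : ι → ℝ) :
    vn (∑ i ∈ t, a i) (∑ i ∈ t, b i) ≤ ∑ i ∈ t, vn (a i) (b i) := by
  simp only [vn_eq]
  refine le_trans (le_of_eq ?_) (norm_sum_le _ _)
  rw [Finset.sum_add_distrib, ← Finset.sum_mul]; push_cast; rfl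

lemma vn_measurable {f g : R2 → ℝ} (hf : Measurable f) (hg : Measurable g) :
    Measurable fun z => ENNReal.ofReal (vn (f z) (g z)) := by
  unfold vn; fun_prop

lemma dd_measurable {r : ℝ} (hr : 0 < r) (p e : R2) (j : Fin 2) : Measurable (dd r p e j) := by
  have h := Th_measurable j
  unfold dd
  exact (((pd_continuous (dip_contDiff hr p e) j).measurable).sub
    (h.comp (measurable_id.sub_const p))).add (h.comp (measurable_id.sub_const (p + e)))

section stage
variable {ι κ : Type} [Fintype ι] [Fintype κ]

def poleP (p e : ι → R2) (a : κ → R2) : (ι ⊕ ι) ⊕ κ → R2 :=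
  Sum.elim (Sum.elim p (fun i => p i + e i)) a

def poleS (σ : κ → ℝ) : (ι ⊕ ι) ⊕ κ → ℝ :=
  Sum.elim (Sum.elim (fun _ => 1) (fun _ => -1)) σ

/-- reduced current after removing the isolated poles only -/
def k1 (u : R2 → R2) (G : R2 → Matrix (Fin 2) (Fin 2) ℝ) (a : κ → R2) (σ : κ → ℝ)
    (j : Fin 2) (z : R2) : ℝ := gg u G j z - ∑ i, σ i * Th j (z - a i)

lemma kk_split (Ω : Set R2) (u : R2 → R2) (G : R2 → Matrix (Fin 2) (Fin 2) ℝ)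
    (p e : ι → R2) (a : κ → R2) (σ : κ → ℝ) (j : Fin 2) {z : R2} (hz : z ∈ Ω) :
    kk Ω u G (poleP p e a) (poleS σ) j z =
      k1 u G a σ j z - ∑ i, (Th j (z - p i) - Th j (z - (p i + e i))) := by
  unfold kk k1
  rw [indicator_of_mem hz]
  simp [poleP, poleS, Fintype.sum_sum_type]
  ring

lemma ww_split (u : R2 → R2) (p e : ι → R2) (a : κ → R2) (σ : κ → ℝ) (z : R2) :
    ww u (poleP p e a) (poleS σ) z =
      (cu 1 u z * ∏ i, Q (-σ i) (a i) z) * ∏ i, (Q (-1) (p i) z * Q 1 (p i + e i) z) := by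
  unfold ww
  simp [poleP, poleS, Fintype.prod_sum_type, Finset.prod_mul_distrib]
  ring

lemma stage1 {Ω : Set R2} (hΩ : IsOpen Ω) (hb : Bornology.IsBounded Ω) {u : R2 → R2}
    {G : R2 → Matrix (Fin 2) (Fin 2) ℝ} (hu : MemW11 Ω u G) (hS : SphereValued Ω u)
    (p e : ι → R2) (a : κ → R2) (σ : κ → ℝ) (hσ : ∀ i, σ i = 1 ∨ σ i = -1)
    (hdet : ∀ φ : R2 → ℝ, MemLip0 Ω φ → detPairing Ω u G φ =
      Real.pi * (∑ i, (φ (p i) - φ (p i + e i)) + ∑ i, σ i * φ (a i)))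
    {ε : ℝ≥0∞} (hε : ε ≠ 0) :
    ∃ (F : R2 → ℂ) (τ : Fin 2 → R2 → ℝ), ContDiffOn ℝ 1 F Ω ∧ (∀ z ∈ Ω, ‖F z‖ = 1) ∧
      (∀ z ∈ Ω, ∀ j, pd j F z = (τ j z : ℂ) * Complex.I * F z) ∧
      (∀ j, ContinuousOn (τ j) Ω) ∧
      ∫⁻ z in Ω, ‖F z - cu 1 u z * ∏ i, Q (-σ i) (a i) z‖ₑ ≤ ε ∧
      ∫⁻ z in Ω, ENNReal.ofReal (vn (τ 0 z - k1 u G a σ 0 z) (τ 1 z - k1 u G a σ 1 z)) ≤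
        ENNReal.ofReal (2 * Real.pi * ∑ i, ‖e i‖) + ε := by
  have hs : ∀ i, poleS (ι := ι) σ i = 1 ∨ poleS (ι := ι) σ i = -1 := by
    rintro ((i | i) | i)
    · exact Or.inl rfl
    · exact Or.inr rfl
    · exact hσ i
  have hε4 : ε / 4 ≠ 0 := (ENNReal.div_pos hε (by simp)).ne'
  obtain ⟨F, τ, F1, F2, F3, F4, F5, F6⟩ := smoothing hΩ hb
    (fun j => kk_integrable hΩ hb hu hS (poleP p e a) (poleS σ) j)
    (kk_closed hΩ hb hu hS _ _ (fun φ hφ => by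
      rw [hdet φ hφ]; simp [poleP, poleS, Fintype.sum_sum_type, sub_eq_add_neg, Finset.sum_add_distrib]))
    (ww_norm hS _ _ hs) (fun q R δ => ww_appr hΩ hb hu hS _ _ hs q R δ) hε4
  set w := ww u (poleP p e a) (poleS (ι := ι) σ) with hw
  set W : R2 → ℂ := fun z => cu 1 u z * ∏ i, Q (-σ i) (a i) z with hW
  set rn : ℕ → ℝ := fun n => 1 / ((n : ℝ) + 1) with hrn
  have rpos : ∀ n, 0 < rn n := fun n => by positivity
  have rlim : Tendsto rn atTop (𝓝 0) := tendsto_one_div_add_atTop_nhds_zero_nat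
  set Ψ : ℕ → R2 → ℝ := fun n z => ∑ i, dip (rn n) (p i) (e i) z with hΨ
  have Ψc : ∀ n, ContDiff ℝ 1 (Ψ n) := fun n =>
    ContDiff.sum fun i _ => dip_contDiff (rpos n) (p i) (e i)
  have Ψd : ∀ n j z, pd j (Ψ n) z = ∑ i, pd j (dip (rn n) (p i) (e i)) z := by
    intro n j z
    unfold pd
    have : HasFDerivAt (Ψ n) (∑ i, fderiv ℝ (dip (rn n) (p i) (e i)) z) z :=
      HasFDerivAt.fun_sum fun i _ =>
        (((dip_contDiff (rpos n) (p i) (e i)).differentiable one_ne_zero).differentiableAt).hasFDerivAt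
    rw [this.fderiv, sum_apply]
  have wm : AEStronglyMeasurable w (volume.restrict Ω) := by
    refine (cu_integrable hu.1 1).aestronglyMeasurable.mul ?_
    exact (Finset.measurable_prod _ fun i _ => Q_measurable _ _).aestronglyMeasurable
  have Wm : AEStronglyMeasurable W (volume.restrict Ω) := by
    refine (cu_integrable hu.1 1).aestronglyMeasurable.mul ?_
    exact (Finset.measurable_prod _ fun i _ => Q_measurable _ _).aestronglyMeasurable
  have Wn : ∀ᵐ z ∂(volume.restrict Ω), ‖W z‖ ≤ 1 := by
    filter_upwards [hS] with z hz
    rw [hW]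
    simp only [norm_mul, norm_prod]
    rw [cu_norm (Or.inl rfl), hz, one_mul]
    refine Finset.prod_le_one (fun i _ => norm_nonneg _) fun i _ => Q_norm_le ?_ _ _
    rcases hσ i with h | h <;> simp [h]
  have wlim : Tendsto (fun n => ∫⁻ z in Ω, ‖w z * ex (Ψ n z) - W z‖ₑ) atTop (𝓝 0) := by
    have h := tendsto_lintegral_of_dominated_convergence' (μ := volume.restrict Ω)
      (F := fun n z => ‖w z * ex (Ψ n z) - W z‖ₑ) (f := fun _ => 0) (fun _ => 2) ?_ ?_ ?_ ?_
    · simpa using h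
    · intro n
      exact ((wm.mul ((ex_contDiff (n := 0)).continuous.comp
        (Ψc n).continuous).aestronglyMeasurable).sub Wm).enorm
    · intro n
      filter_upwards [ww_norm hS (poleP p e a) (poleS (ι := ι) σ) hs, Wn] with z h1 h2
      rw [← ofReal_norm]
      refine ENNReal.ofReal_le_of_le_toReal ?_
      refine (norm_sub_le _ _).trans ?_
      rw [norm_mul, ex_norm, h1]
      simp; linarith
    · rw [lintegral_const]
      exact (ENNReal.mul_lt_top (by simp) (by
        rw [Measure.restrict_apply_univ]; exact hb.measure_lt_top)).ne
    · have hl : ∀ᵐ z ∂(volume.restrict Ω), ∀ i, ∀ t : ℝ, z - (p i + t • e i) ≠ 0 :=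
        ae_restrict_of_ae (ae_all_iff.2 fun i => line_null (p i) (e i))
      filter_upwards [hl] with z hz
      have hz0 : ∀ i, z ≠ p i := fun i => by
        have := hz i 0
        rw [zero_smul, add_zero] at this
        exact sub_ne_zero.1 this
      have hz1 : ∀ i, z ≠ p i + e i := fun i => by
        have := hz i 1
        rw [one_smul] at this
        exact sub_ne_zero.1 this
      choose δ δ0 hδ using fun i => ex_dip_eq (hz i)
      have hev : ∀ᶠ n in atTop, ∀ i, rn n < δ i :=
        eventually_all.2 fun i => rlim.eventually_lt_const (δ0 i)
      refine tendsto_const_nhds.congr' ?_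
      filter_upwards [hev] with n hn
      have exs : ∀ t : Finset ι, ex (∑ i ∈ t, dip (rn n) (p i) (e i) z) =
          ∏ i ∈ t, (Q 1 (p i) z * Q (-1) (p i + e i) z) := by
        intro t
        induction t using Finset.induction_on with
        | empty => simp [ex_zero]
        | insert b t hb ih =>
          rw [Finset.sum_insert hb, Finset.prod_insert hb, ex_add, ih,
            hδ b _ (rpos n) (hn b)]
      have : w z * ex (Ψ n z) = W z := by
        rw [hw, ww_split, hΨ]
        simp only [exs]
        have hone : (∏ i, (Q (-1) (p i) z * Q 1 (p i + e i) z)) *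
            ∏ i, (Q 1 (p i) z * Q (-1) (p i + e i) z) = 1 := by
          rw [← Finset.prod_mul_distrib]
          refine Finset.prod_eq_one fun i _ => ?_
          have q1 := Q_mul_inv (Or.inl rfl) (hz0 i)
          have q2 := Q_mul_inv (Or.inl rfl) (hz1 i)
          linear_combination Q (1) (p i + e i) z * Q (-1) (p i + e i) z * q1 + q2
        rw [mul_assoc (cu 1 u z * ∏ i, Q (-σ i) (a i) z), hone, mul_one]
      rw [this]; simp
  have rlim2 : Tendsto (fun n => ∑ _i : ι, ENNReal.ofReal (8 * Real.pi * rn n)) atTop (𝓝 0) := by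
    have : Tendsto (fun n => ENNReal.ofReal (8 * Real.pi * rn n)) atTop (𝓝 0) := by
      have := ENNReal.tendsto_ofReal (rlim.const_mul (8 * Real.pi))
      simpa using this
    have h2 := tendsto_finsetSum (Finset.univ : Finset ι) fun i _ => this
    simpa using h2
  have hε2 : 0 < ε / 2 := ENNReal.div_pos hε (by simp)
  obtain ⟨n, hn1, hn2⟩ := ((wlim.eventually_le_const hε2).and
    (rlim2.eventually_le_const hε2)).exists
  have e42 : ε / 4 + ε / 4 = ε / 2 := by
    have h4 : (4 : ℝ≥0∞) = 2 * 2 := by norm_num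
    rw [h4, ENNReal.div_eq_inv_mul, ENNReal.mul_inv (by simp) (by simp), mul_assoc,
      ← ENNReal.div_eq_inv_mul, ← ENNReal.div_eq_inv_mul, ENNReal.add_halves]
  have e4 : ε / 4 ≤ ε / 2 := by rw [← e42]; exact le_self_add
  have pdΨc : ∀ j, Continuous (pd j (Ψ n)) := fun j => pd_continuous (Ψc n) j
  refine ⟨fun z => F z * ex (Ψ n z), fun j z => τ j z + pd j (Ψ n) z,
    F1.mul (ex_contDiff.comp (Ψc n)).contDiffOn, fun z hz => ?_, fun z hz j => ?_,
    fun j => (F4 j).add (pdΨc j).continuousOn, ?_, ?_⟩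
  · rw [norm_mul, F2 z hz, ex_norm, one_mul]
  · have d1 : DifferentiableAt ℝ (Ψ n) z := ((Ψc n).differentiable one_ne_zero).differentiableAt
    have d2 : DifferentiableAt ℝ F z :=
      (F1.differentiableOn one_ne_zero).differentiableAt (hΩ.mem_nhds hz)
    have d3 : DifferentiableAt ℝ (fun z => ex (Ψ n z)) z :=
      ((ex_contDiff.comp (Ψc n)).differentiable one_ne_zero).differentiableAt
    rw [pd_mul d2 d3, F3 z hz j, pd_ex d1 j]
    push_cast; ring
  · calc ∫⁻ z in Ω, ‖F z * ex (Ψ n z) - W z‖ₑ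
        ≤ ∫⁻ z in Ω, (‖w z * ex (Ψ n z) - W z‖ₑ + ‖F z - w z‖ₑ) := by
          refine lintegral_mono fun z => ?_
          have : F z * ex (Ψ n z) - W z = (w z * ex (Ψ n z) - W z) + (F z - w z) * ex (Ψ n z) := by
            ring
          simp only [this]
          refine (enorm_add_le _ _).trans (add_le_add le_rfl ?_)
          rw [enorm_mul, ← ofReal_norm (ex _), ex_norm]; simp
      _ = (∫⁻ z in Ω, ‖w z * ex (Ψ n z) - W z‖ₑ) + ∫⁻ z in Ω, ‖F z - w z‖ₑ := by
          refine lintegral_add_left' ?_ _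
          exact ((wm.mul ((ex_contDiff (n := 0)).continuous.comp
            (Ψc n).continuous).aestronglyMeasurable).sub Wm).enorm
      _ ≤ ε / 2 + ε / 2 := add_le_add hn1 (F5.trans e4)
      _ = ε := ENNReal.add_halves ε
  · have pt : ∀ z ∈ Ω, ENNReal.ofReal (vn (τ 0 z + pd 0 (Ψ n) z - k1 u G a σ 0 z)
        (τ 1 z + pd 1 (Ψ n) z - k1 u G a σ 1 z)) ≤
        (∑ i, ENNReal.ofReal (vn (dd (rn n) (p i) (e i) 0 z) (dd (rn n) (p i) (e i) 1 z))) +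
        (‖τ 0 z - kk Ω u G (poleP p e a) (poleS σ) 0 z‖ₑ +
          ‖τ 1 z - kk Ω u G (poleP p e a) (poleS σ) 1 z‖ₑ) := by
      intro z hz
      have hj : ∀ j, τ j z + pd j (Ψ n) z - k1 u G a σ j z =
          (∑ i, dd (rn n) (p i) (e i) j z) + (τ j z - kk Ω u G (poleP p e a) (poleS σ) j z) := by
        intro j
        rw [kk_split Ω u G p e a σ j hz, Ψd]
        simp only [dd, Finset.sum_add_distrib, Finset.sum_sub_distrib]
        ring
      rw [hj, hj]
      have h1 : vn ((∑ i, dd (rn n) (p i) (e i) 0 z) + (τ 0 z - kk Ω u G (poleP p e a) (poleS σ) 0 z))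
          ((∑ i, dd (rn n) (p i) (e i) 1 z) + (τ 1 z - kk Ω u G (poleP p e a) (poleS σ) 1 z)) ≤
          (∑ i, vn (dd (rn n) (p i) (e i) 0 z) (dd (rn n) (p i) (e i) 1 z)) +
          (|τ 0 z - kk Ω u G (poleP p e a) (poleS σ) 0 z| +
          |τ 1 z - kk Ω u G (poleP p e a) (poleS σ) 1 z|) :=
        (vn_add _ _ _ _).trans (add_le_add (vn_sum _ _ _) (vn_le _ _))
      refine (ENNReal.ofReal_le_ofReal h1).trans ?_
      rw [ENNReal.ofReal_add (Finset.sum_nonneg fun i _ => vn_nonneg _ _) (by positivity),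
        ENNReal.ofReal_add (abs_nonneg _) (abs_nonneg _),
        ENNReal.ofReal_sum_of_nonneg fun i _ => vn_nonneg _ _,
        Real.enorm_eq_ofReal_abs, Real.enorm_eq_ofReal_abs]
    have hdm : ∀ i, Measurable fun z =>
        ENNReal.ofReal (vn (dd (rn n) (p i) (e i) 0 z) (dd (rn n) (p i) (e i) 1 z)) := fun i =>
      vn_measurable (dd_measurable (rpos n) _ _ 0) (dd_measurable (rpos n) _ _ 1)
    refine (setLIntegral_mono' hΩ.measurableSet pt).trans ?_
    rw [lintegral_add_left (Finset.measurable_sum _ fun i _ => hdm i),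
      lintegral_finsetSum _ fun i _ => hdm i]
    have h1 : ∑ i, ∫⁻ z in Ω,
        ENNReal.ofReal (vn (dd (rn n) (p i) (e i) 0 z) (dd (rn n) (p i) (e i) 1 z)) ≤
        ENNReal.ofReal (2 * Real.pi * ∑ i, ‖e i‖) + ε / 2 := by
      calc _ ≤ ∑ i, (ENNReal.ofReal (2 * Real.pi * ‖e i‖) + ENNReal.ofReal (8 * Real.pi * rn n)) :=
            Finset.sum_le_sum fun i _ =>
              (setLIntegral_le_lintegral _ _).trans (dd_lintegral (rpos n) (p i) (e i))
        _ = ENNReal.ofReal (2 * Real.pi * ∑ i, ‖e i‖) + ∑ _i : ι, ENNReal.ofReal (8 * Real.pi * rn n) := by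
            rw [Finset.sum_add_distrib, ← ENNReal.ofReal_sum_of_nonneg fun i _ => by positivity,
              ← Finset.mul_sum]
        _ ≤ _ := by gcongr
    have h2 : ∫⁻ z in Ω, (‖τ 0 z - kk Ω u G (poleP p e a) (poleS σ) 0 z‖ₑ +
          ‖τ 1 z - kk Ω u G (poleP p e a) (poleS σ) 1 z‖ₑ) ≤ ε / 2 := by
      rw [lintegral_add_left', ← e42]
      · exact add_le_add (F6 0) (F6 1)
      · exact ((F4 0).aestronglyMeasurable hΩ.measurableSet).sub
          (kk_integrable hΩ hb hu hS _ _ 0).aestronglyMeasurable.restrict |>.enorm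
    calc _ ≤ (ENNReal.ofReal (2 * Real.pi * ∑ i, ‖e i‖) + ε / 2) + ε / 2 := add_le_add h1 h2
      _ = _ := by rw [add_assoc, ENNReal.add_halves]

end stage

section kant
variable {n : ℕ}

/-- value of the finite dual problem -/
def kval (φ : Fin n ⊕ Fin n → ℝ) : ℝ := ∑ i, φ (Sum.inl i) - ∑ i, φ (Sum.inr i)

def KSet (D : Fin n ⊕ Fin n → Fin n ⊕ Fin n → ℝ) (c : Fin n ⊕ Fin n → ℝ) :
    Set (Fin n ⊕ Fin n → ℝ) :=
  {φ | (∀ a b, φ a - φ b ≤ D a b) ∧ ∀ a, |φ a| ≤ c a}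

lemma kant_improve [NeZero n] {D : Fin n ⊕ Fin n → Fin n ⊕ Fin n → ℝ} {c : Fin n ⊕ Fin n → ℝ}
    (hD0 : ∀ a, D a a = 0) (hs : ∀ a b, D a b = D b a) (ht : ∀ a b d, D a d ≤ D a b + D b d)
    (hc : ∀ a b, D a b ≤ c a + c b) (α β : Fin n → ℝ)
    (h : ∀ i j, α i - β j ≤ D (Sum.inl i) (Sum.inr j)) :
    ∃ φ ∈ KSet D c, ∑ i, α i - ∑ i, β i ≤ kval φ := by
  have hne : (Finset.univ : Finset (Fin n)).Nonempty := Finset.univ_nonempty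
  have hne' : (Finset.univ : Finset (Fin n ⊕ Fin n)).Nonempty := Finset.univ_nonempty
  set f : Fin n ⊕ Fin n → ℝ := fun a => Finset.univ.inf' hne fun j => β j + D a (Sum.inr j) with hf
  have f1 : ∀ a b, f a - f b ≤ D a b := by
    intro a b
    rw [sub_le_iff_le_add]
    obtain ⟨j, -, hj⟩ := Finset.exists_mem_eq_inf' hne fun j => β j + D b (Sum.inr j)
    have h1 : f a ≤ β j + D a (Sum.inr j) := Finset.inf'_le _ (Finset.mem_univ j)
    have h2 : f b = β j + D b (Sum.inr j) := hj
    have := ht a b (Sum.inr j)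
    linarith
  have f2 : ∀ i, α i ≤ f (Sum.inl i) := by
    intro i
    refine Finset.le_inf' _ _ fun j _ => ?_
    have := h i j
    linarith
  have f3 : ∀ j, f (Sum.inr j) ≤ β j := by
    intro j
    have h1 : f (Sum.inr j) ≤ β j + D (Sum.inr j) (Sum.inr j) :=
      Finset.inf'_le _ (Finset.mem_univ j)
    rw [hD0] at h1
    linarith
  set t : ℝ := Finset.univ.sup' hne' fun a => f a - c a with htt
  have t1 : ∀ a, f a - c a ≤ t := fun a => Finset.le_sup' (fun a => f a - c a) (Finset.mem_univ a)
  have t2 : ∀ a, t ≤ f a + c a := by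
    intro a
    refine Finset.sup'_le _ _ fun b _ => ?_
    have := f1 b a
    have := hc b a
    linarith
  refine ⟨fun a => f a - t, ⟨fun a b => ?_, fun a => abs_le.2 ⟨?_, ?_⟩⟩, ?_⟩
  · have := f1 a b
    simp only; linarith
  · have := t2 a; linarith
  · have := t1 a; linarith
  · unfold kval
    simp only [Finset.sum_sub_distrib]
    have := Finset.sum_le_sum fun i (_ : i ∈ Finset.univ) => f2 i
    have := Finset.sum_le_sum fun i (_ : i ∈ Finset.univ) => f3 i
    linarith

lemma kant {D : Fin n ⊕ Fin n → Fin n ⊕ Fin n → ℝ} {c : Fin n ⊕ Fin n → ℝ}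
    (hD0 : ∀ a, D a a = 0) (hs : ∀ a b, D a b = D b a) (ht : ∀ a b d, D a d ≤ D a b + D b d)
    (hc : ∀ a b, D a b ≤ c a + c b) :
    ∃ φ ∈ KSet D c, ∃ σ : Equiv.Perm (Fin n),
      ∀ i, φ (Sum.inl i) - φ (Sum.inr (σ i)) = D (Sum.inl i) (Sum.inr (σ i)) := by
  have hc0 : ∀ a, 0 ≤ c a := fun a => by have := hc a a; rw [hD0] at this; linarith
  have hDn : ∀ a b, 0 ≤ D a b := fun a b => by
    have := ht a b a; rw [hD0, hs b a] at this; linarith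
  have hK0 : (fun _ => 0) ∈ KSet D c := ⟨fun a b => by simpa using hDn a b, fun a => by simpa using hc0 a⟩
  have hKcl : IsClosed (KSet D c) := by
    unfold KSet
    simp only [Set.setOf_and, Set.setOf_forall]
    refine IsClosed.inter (isClosed_iInter fun a => isClosed_iInter fun b => ?_)
      (isClosed_iInter fun a => ?_)
    · exact isClosed_le (by fun_prop) continuous_const
    · exact isClosed_le (by fun_prop) continuous_const
  have hK : IsCompact (KSet D c) := by
    refine (isCompact_univ_pi fun a => isCompact_Icc (a := -c a) (b := c a)).of_isClosed_subset hKcl ?_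
    intro φ hφ a _
    exact abs_le.1 (hφ.2 a)
  obtain ⟨φ, hφ, hmax⟩ := hK.exists_isMaxOn ⟨_, hK0⟩ (f := kval) (by unfold kval; fun_prop)
  refine ⟨φ, hφ, ?_⟩
  set N : Fin n → Finset (Fin n) := fun i =>
    Finset.univ.filter fun j => φ (Sum.inl i) - φ (Sum.inr j) = D (Sum.inl i) (Sum.inr j) with hN
  suffices hH : ∃ f : Fin n → Fin n, Function.Injective f ∧ ∀ i, f i ∈ N i by
    obtain ⟨f, f1, f2⟩ := hH
    refine ⟨Equiv.ofBijective f (Finite.injective_iff_bijective.1 f1), fun i => ?_⟩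
    have := f2 i
    simpa [hN] using this
  rw [← Finset.all_card_le_biUnion_card_iff_exists_injective]
  intro A
  by_contra hA
  push Not at hA
  have hn : NeZero n := ⟨by
    rintro rfl
    have : A = ∅ := Finset.eq_empty_of_isEmpty A
    simp [this] at hA⟩
  have hε : ∀ᶠ ε : ℝ in 𝓝[>] 0, ∀ i j, φ (Sum.inl i) - φ (Sum.inr j) < D (Sum.inl i) (Sum.inr j) →
      φ (Sum.inl i) - φ (Sum.inr j) + ε < D (Sum.inl i) (Sum.inr j) := by
    refine eventually_all.2 fun i => eventually_all.2 fun j => ?_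
    by_cases hlt : φ (Sum.inl i) - φ (Sum.inr j) < D (Sum.inl i) (Sum.inr j)
    · have : Tendsto (fun ε : ℝ => φ (Sum.inl i) - φ (Sum.inr j) + ε) (𝓝[>] 0)
          (𝓝 (φ (Sum.inl i) - φ (Sum.inr j) + 0)) :=
        (Continuous.tendsto (by fun_prop) 0).mono_left nhdsWithin_le_nhds
      rw [add_zero] at this
      filter_upwards [this.eventually_lt_const hlt] with ε hε _ using hε
    · exact Eventually.of_forall fun _ h => absurd h hlt
  obtain ⟨ε, hε1, hε0⟩ := (hε.and self_mem_nhdsWithin).exists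
  replace hε0 : 0 < ε := hε0
  obtain ⟨ψ, hψ, hval⟩ := kant_improve hD0 hs ht hc
    (fun i => φ (Sum.inl i) + if i ∈ A then ε else 0)
    (fun j => φ (Sum.inr j) + if j ∈ A.biUnion N then ε else 0) (by
      intro i j
      have h0 := hφ.1 (Sum.inl i) (Sum.inr j)
      by_cases hi : i ∈ A
      · by_cases hj : j ∈ A.biUnion N
        · simp only [hi, hj, if_true]; linarith
        · have hjN : j ∉ N i := fun h => hj (Finset.mem_biUnion.2 ⟨i, hi, h⟩)
          have : φ (Sum.inl i) - φ (Sum.inr j) ≠ D (Sum.inl i) (Sum.inr j) := by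
            simpa [hN] using hjN
          have := hε1 i j (lt_of_le_of_ne h0 this)
          simp only [hi, hj, if_true, if_false]; linarith
      · by_cases hj : j ∈ A.biUnion N
        · simp only [hi, hj, if_true, if_false]; linarith
        · simp only [hi, hj, if_false]; linarith)
  have hm : kval ψ ≤ kval φ := hmax hψ
  have e1 : ∀ B : Finset (Fin n), ∑ i, (if i ∈ B then ε else 0) = B.card * ε := by
    intro B
    simp [Finset.sum_ite_mem]
  rw [Finset.sum_add_distrib, Finset.sum_add_distrib, e1, e1] at hval
  unfold kval at hval hm
  have : ((A.biUnion N).card : ℝ) < A.card := by exact_mod_cast hA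
  nlinarith

end kant

section blocks

/-- weight of a point: truncated double distance to the boundary -/
def cw (Ω : Set R2) (z : R2) : ℝ := min 1 (2 * Metric.infDist z (frontier Ω))

def Dw (Ω : Set R2) (z w : R2) : ℝ := min (2 * dist z w) (cw Ω z + cw Ω w)

lemma cw_nonneg (Ω : Set R2) (z : R2) : 0 ≤ cw Ω z :=
  le_min zero_le_one (mul_nonneg zero_le_two Metric.infDist_nonneg)

lemma cw_le (Ω : Set R2) (z w : R2) : cw Ω z ≤ cw Ω w + 2 * dist z w := by
  have h : Metric.infDist z (frontier Ω) ≤ Metric.infDist w (frontier Ω) + dist z w :=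
    Metric.infDist_le_infDist_add_dist
  have hd : 0 ≤ dist z w := dist_nonneg
  unfold cw
  rcases le_total 1 (2 * Metric.infDist w (frontier Ω)) with h1 | h1
  · rw [min_eq_left h1]
    exact (min_le_left _ _).trans (by linarith)
  · rw [min_eq_right h1]
    exact (min_le_right _ _).trans (by linarith)

lemma cw_frontier {Ω : Set R2} {z : R2} (hz : z ∈ frontier Ω) : cw Ω z = 0 := by
  simp [cw, Metric.infDist_zero_of_mem hz]

lemma cw_lip (Ω : Set R2) : LipschitzWith 2 (cw Ω) := by
  refine LipschitzWith.of_le_add_mul 2 fun z w => ?_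
  exact cw_le Ω z w

lemma Dw_self (Ω : Set R2) (z : R2) : Dw Ω z z = 0 := by
  unfold Dw
  rw [dist_self, mul_zero]
  exact min_eq_left (add_nonneg (cw_nonneg Ω z) (cw_nonneg Ω z))

lemma Dw_comm (Ω : Set R2) (z w : R2) : Dw Ω z w = Dw Ω w z := by
  unfold Dw
  rw [dist_comm, add_comm]

lemma Dw_tri (Ω : Set R2) (z w v : R2) : Dw Ω z v ≤ Dw Ω z w + Dw Ω w v := by
  unfold Dw
  have h1 := cw_le Ω z w
  have h2 := cw_le Ω v w
  have h3 := cw_nonneg Ω w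
  have h4 := dist_triangle z w v
  rw [dist_comm v w] at h2
  have h6 := cw_nonneg Ω v
  have h7 := cw_nonneg Ω z
  rcases min_cases (2 * dist z w) (cw Ω z + cw Ω w) with ⟨a, _⟩ | ⟨a, _⟩ <;>
  rcases min_cases (2 * dist w v) (cw Ω w + cw Ω v) with ⟨b, _⟩ | ⟨b, _⟩ <;> rw [a, b]
  · exact (min_le_left _ _).trans (by linarith)
  · exact (min_le_right _ _).trans (by linarith)
  · exact (min_le_right _ _).trans (by linarith)
  · exact (min_le_right _ _).trans (by linarith)

/-- extension of finite data to an admissible test function -/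
lemma flat_extend {S : Type} (Ω : Set R2) (P : S → R2) (φ : S → ℝ)
    (h1 : ∀ a b, φ a - φ b ≤ Dw Ω (P a) (P b)) (h2 : ∀ a, |φ a| ≤ cw Ω (P a)) :
    ∃ f : R2 → ℝ, FlatAdmissible Ω (frontier Ω) 2 f ∧ ∀ a, f (P a) = φ a := by
  have hφ : ∀ a b, P a = P b → φ a = φ b := by
    intro a b hab
    have e1 := h1 a b
    have e2 := h1 b a
    rw [hab, Dw_self] at e1
    rw [hab, Dw_self] at e2
    linarith
  set f0 : R2 → ℝ := fun z => if h : ∃ a, P a = z then φ h.choose else 0 with hf0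
  have f0P : ∀ a, f0 (P a) = φ a := by
    intro a
    have h : ∃ b, P b = P a := ⟨a, rfl⟩
    rw [hf0]
    simp only [h, dite_true]
    exact hφ _ _ h.choose_spec
  have f0L : LipschitzOnWith 2 f0 (range P) := by
    refine LipschitzOnWith.of_le_add_mul 2 ?_
    rintro _ ⟨a, rfl⟩ _ ⟨b, rfl⟩
    rw [f0P, f0P]
    have := h1 a b
    have : Dw Ω (P a) (P b) ≤ 2 * dist (P a) (P b) := min_le_left _ _
    simp only [NNReal.coe_ofNat]
    linarith
  obtain ⟨g, gL, gE⟩ := f0L.extend_real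
  have cL := cw_lip Ω
  have cLn : LipschitzWith 2 (fun z => - cw Ω z) := cL.neg
  have L1 : LipschitzWith 2 fun z => max (- cw Ω z) (min (cw Ω z) (g z)) := by
    have := cLn.max (cL.min gL)
    simpa using this
  have hb : ∀ z, |max (- cw Ω z) (min (cw Ω z) (g z))| ≤ cw Ω z := by
    intro z
    have := cw_nonneg Ω z
    exact abs_le.2 ⟨le_max_left _ _, max_le (by linarith) (min_le_left _ _)⟩
  refine ⟨_, ⟨L1.lipschitzOnWith, fun p hp => ?_, fun p _ => (hb p).trans (min_le_left _ _)⟩, ?_⟩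
  · have := hb p
    rw [cw_frontier hp] at this
    exact abs_nonpos_iff.1 (by rw [cw_frontier hp]; exact this)
  · intro a
    have e : g (P a) = φ a := by rw [← gE ⟨a, rfl⟩, f0P]
    have := abs_le.1 (h2 a)
    simp only [e]
    rw [min_eq_right this.2, max_eq_right this.1]

lemma blocks {Ω : Set R2} {n : ℕ} {x y : Fin n → R2} (hPf : SatisfiesPf Ω x y)
    (hgen : InteriorPointsGeneric Ω x y) {L : (R2 → ℝ) → ℝ}
    (hdet : ∀ φ : R2 → ℝ, MemLip0 Ω φ → L φ = Real.pi * ∑ i, (φ (x i) - φ (y i))) :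
    ∃ (ι κ : Type) (_ : Fintype ι) (_ : Fintype κ) (p e : ι → R2) (a : κ → R2) (s : κ → ℝ),
      (∀ k, s k = 1 ∨ s k = -1) ∧ (∀ k, a k ∈ Ω) ∧ Function.Injective a ∧
      (∀ φ : R2 → ℝ, (∀ q ∈ frontier Ω, φ q = 0) → ∑ i, (φ (x i) - φ (y i)) =
        ∑ i, (φ (p i) - φ (p i + e i)) + ∑ k, s k * φ (a k)) ∧
      ENNReal.ofReal (2 * Real.pi * ∑ i, ‖e i‖ + Real.pi * Fintype.card κ) ≤ flatNorm Ω 2 L := by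
  set P : Fin n ⊕ Fin n → R2 := Sum.elim x y with hP
  obtain ⟨φ, hφ, σ, hσ⟩ := kant (n := n) (D := fun a b => Dw Ω (P a) (P b))
    (c := fun a => cw Ω (P a)) (fun a => Dw_self _ _) (fun a b => Dw_comm _ _ _)
    (fun a b d => Dw_tri _ _ _ _) (fun a b => min_le_right _ _)
  obtain ⟨f, fA, fE⟩ := flat_extend Ω P φ hφ.1 hφ.2
  -- the cost
  have hflat : ENNReal.ofReal (Real.pi * ∑ i, Dw Ω (x i) (y (σ i))) ≤ flatNorm Ω 2 L := by
    have e1 : L f = Real.pi * ∑ i, Dw Ω (x i) (y (σ i)) := by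
      rw [hdet f ⟨⟨2, fA.1⟩, fA.2.1⟩, Finset.sum_sub_distrib,
        ← Equiv.sum_comp σ (fun i => f (y i)), ← Finset.sum_sub_distrib]
      congr 1
      refine Finset.sum_congr rfl fun i _ => ?_
      have h1 := fE (Sum.inl i)
      have h2 := fE (Sum.inr (σ i))
      have h3 := hσ i
      simp only [hP, Sum.elim_inl, Sum.elim_inr] at h1 h2 h3
      rw [h1, h2, h3]
    rw [← e1]
    unfold flatNorm flatNormOn
    exact le_iSup₂_of_le f fA le_rfl
  set P' : Fin n ⊕ Fin n → R2 := Sum.elim x (y ∘ σ) with hP'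
  set idx : Fin n ⊕ Fin n → Fin n := Sum.elim id id with hidx
  set T : Fin n → Prop := fun i => 2 * dist (x i) (y (σ i)) ≤ cw Ω (x i) + cw Ω (y (σ i)) with hT
  have hfr : ∀ _i : Fin n, (frontier Ω).Nonempty := by
    intro i
    rcases hPf.1 i with h | h
    · exact ⟨_, h.2.1⟩
    · exact ⟨_, h.2.1⟩
  have hb : ∀ a, ∃ b ∈ frontier Ω, Metric.infDist (P' a) (frontier Ω) = dist (P' a) b := fun a =>
    isClosed_frontier.exists_infDist_eq_dist (hfr (idx a)) _
  choose b hbF hbd using hb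
  have hPΩ : ∀ a, P a ∈ Ω ∨ P a ∈ frontier Ω := by
    rintro (i | i)
    · rcases hPf.1 i with h | h
      · exact Or.inl h.1
      · exact Or.inr h.2.1
    · rcases hPf.1 i with h | h
      · exact Or.inr h.2.1
      · exact Or.inl h.1
  set τ : Fin n ⊕ Fin n → Fin n ⊕ Fin n := Sum.map id σ with hτ
  have τinj : Function.Injective τ := Sum.map_injective.2 ⟨Function.injective_id, σ.injective⟩
  have hPP : ∀ a, P' a = P (τ a) := by rintro (i | i) <;> rfl
  set isoP : Fin n ⊕ Fin n → Prop := fun a => ¬ T (idx a) ∧ cw Ω (P' a) = 1 with hiso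
  have isoΩ : ∀ a, isoP a → P' a ∈ Ω := by
    intro a ha
    rw [hPP]
    rcases hPΩ (τ a) with h | h
    · exact h
    · have := cw_frontier h
      rw [← hPP, ha.2] at this
      exact absurd this one_ne_zero
  set sg : Fin n ⊕ Fin n → ℝ := Sum.elim (fun _ => 1) (fun _ => -1) with hsg
  set p : Fin n ⊕ (Fin n ⊕ Fin n) → R2 :=
    Sum.elim x (Sum.elim x (fun i => b (Sum.inr i))) with hp
  set e : Fin n ⊕ (Fin n ⊕ Fin n) → R2 := Sum.elim (fun i => if T i then y (σ i) - x i else 0)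
    (Sum.elim (fun i => if ¬ T i ∧ cw Ω (x i) ≠ 1 then b (Sum.inl i) - x i else 0)
      (fun i => if ¬ T i ∧ cw Ω (y (σ i)) ≠ 1 then y (σ i) - b (Sum.inr i) else 0)) with he
  have ksum : ∀ g : Fin n ⊕ Fin n → ℝ, ∑ k : {a // isoP a}, g k =
      ∑ i, ((if isoP (Sum.inl i) then g (Sum.inl i) else 0) +
        (if isoP (Sum.inr i) then g (Sum.inr i) else 0)) := by
    intro g
    rw [← Finset.sum_subtype (Finset.univ.filter isoP) (by simp) g, Finset.sum_filter,
      Fintype.sum_sum_type, Finset.sum_add_distrib]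
  refine ⟨Fin n ⊕ (Fin n ⊕ Fin n), {a // isoP a}, inferInstance, inferInstance, p, e,
    fun k => P' k, fun k => sg k, ?_, fun k => isoΩ _ k.2, ?_, ?_, ?_⟩
  · rintro ⟨i | i, _⟩
    · exact Or.inl rfl
    · exact Or.inr rfl
  · rintro ⟨k, hk⟩ ⟨l, hl⟩ hkl
    simp only [hPP] at hkl
    refine Subtype.ext ?_
    by_contra hne
    have h1 := isoΩ k hk
    have h2 := isoΩ l hl
    rw [hPP] at h1 h2
    exact hgen.1 _ _ h1 h2 (fun h => hne (τinj h)) hkl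
  · intro φ hφ0
    rw [ksum fun a => sg a * φ (P' a), Fintype.sum_sum_type, Fintype.sum_sum_type,
      Finset.sum_sub_distrib, ← Equiv.sum_comp σ (fun i => φ (y i)),
      ← Finset.sum_sub_distrib, ← Finset.sum_add_distrib, ← Finset.sum_add_distrib,
      ← Finset.sum_add_distrib]
    refine Finset.sum_congr rfl fun i _ => ?_
    have b1 := hφ0 _ (hbF (Sum.inl i))
    have b2 := hφ0 _ (hbF (Sum.inr i))
    simp only [hp, he, hiso, hidx, hsg, hP', Sum.elim_inl, Sum.elim_inr, id, Function.comp]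
    by_cases hTi : T i
    · simp [hTi]
    · by_cases c1 : cw Ω (x i) = 1 <;> by_cases c2 : cw Ω (y (σ i)) = 1 <;>
        simp [hTi, c1, c2, b1, b2] <;> ring
  · refine le_trans (ENNReal.ofReal_le_ofReal (le_of_eq ?_)) hflat
    have hcard : (Fintype.card {a // isoP a} : ℝ) = ∑ k : {a // isoP a}, (fun _ => (1:ℝ)) k.1 := by
      simp
    rw [hcard, ksum fun _ => 1, Fintype.sum_sum_type, Fintype.sum_sum_type]
    have : ∀ A B : ℝ, 2 * Real.pi * A + Real.pi * B = Real.pi * (2 * A + B) := fun A B => by ring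
    rw [this, ← Finset.sum_add_distrib, ← Finset.sum_add_distrib, Finset.mul_sum,
      ← Finset.sum_add_distrib]
    congr 1
    refine Finset.sum_congr rfl fun i _ => ?_
    have b1 := hbd (Sum.inl i)
    have b2 := hbd (Sum.inr i)
    simp only [hP', Sum.elim_inl, Sum.elim_inr, Function.comp] at b1 b2
    rw [dist_comm, dist_eq_norm] at b1
    rw [dist_eq_norm] at b2
    have cc : ∀ z, cw Ω z ≠ 1 → cw Ω z = 2 * Metric.infDist z (frontier Ω) := by
      intro z hz
      rcases min_choice 1 (2 * Metric.infDist z (frontier Ω)) with h | h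
      · exact absurd h hz
      · exact h
    simp only [he, hiso, hidx, hP', Sum.elim_inl, Sum.elim_inr, id, Function.comp]
    unfold Dw
    by_cases hTi : T i
    · have : 2 * dist (x i) (y (σ i)) ≤ cw Ω (x i) + cw Ω (y (σ i)) := hTi
      rw [min_eq_left this]
      have hd : dist (x i) (y (σ i)) = ‖y (σ i) - x i‖ := by rw [dist_comm, dist_eq_norm]
      simp [hTi, hd]
    · have : cw Ω (x i) + cw Ω (y (σ i)) ≤ 2 * dist (x i) (y (σ i)) := le_of_lt (not_le.1 hTi)
      rw [min_eq_right this]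
      by_cases c1 : cw Ω (x i) = 1 <;> by_cases c2 : cw Ω (y (σ i)) = 1 <;>
        simp [hTi, c1, c2, ← b1, ← b2]
      · have := cc _ c2; linarith
      · have := cc _ c1; linarith
      · rw [cc _ c1, cc _ c2]; ring

end blocks

section final

/-- complex plane to `R2` -/
def toR2 : ℂ ≃ₗᵢ[ℝ] R2 := Complex.orthonormalBasisOneI.repr

lemma toR2_zero (w : ℂ) : toR2 w 0 = w.re := by
  unfold toR2; rw [Complex.orthonormalBasisOneI_repr_apply]; rfl

lemma toR2_one (w : ℂ) : toR2 w 1 = w.im := by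
  unfold toR2; rw [Complex.orthonormalBasisOneI_repr_apply]; rfl

lemma toR2_cu (u : R2 → R2) (z : R2) : toR2 (cu 1 u z) = u z := by
  ext i
  fin_cases i
  · simp [toR2_zero, cu]
  · simp [toR2_one, cu]

lemma jac_toR2 (V : R2 → ℂ) (z : R2) (i j : Fin 2) :
    jacobianMatrix (fun z => toR2 (V z)) z i j = toR2 (pd j V z) i := by
  unfold jacobianMatrix pd eb
  have : fderiv ℝ (fun z => toR2 (V z)) z = (toR2 : ℂ →L[ℝ] R2).comp (fderiv ℝ V z) :=
    toR2.comp_fderiv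
  rw [Matrix.of_apply, this]; rfl

lemma area_pt {V : R2 → ℂ} {z : R2} {α X : Fin 2 → ℝ} {ρ : ℝ} {ω : ℂ} (hω : ‖ω‖ = 1)
    (h0 : 0 ≤ ρ) (h1 : ρ ≤ 1)
    (hd : ∀ j, pd j V z = ((α j : ℂ) + ((ρ * X j : ℝ) : ℂ) * Complex.I) * ω) :
    Real.sqrt (1 + (∑ i, ∑ j, (jacobianMatrix (fun z => toR2 (V z)) z i j) ^ 2) +
      (jacobianMatrix (fun z => toR2 (V z)) z).det ^ 2) ≤
      Real.sqrt (1 + (X 0 ^ 2 + X 1 ^ 2)) + ((|α 0| + |α 1|) + ρ * |α 0 * X 1 - α 1 * X 0|) := by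
  have hw : ω.re ^ 2 + ω.im ^ 2 = 1 := by
    have := Complex.sq_norm ω
    rw [hω, Complex.normSq_apply] at this
    linarith
  have e : ∀ i j, jacobianMatrix (fun z => toR2 (V z)) z i j =
      ![α j * ω.re - ρ * X j * ω.im, α j * ω.im + ρ * X j * ω.re] i := by
    intro i j
    rw [jac_toR2, hd]
    fin_cases i
    · simp [toR2_zero]
    · simp [toR2_one]
  have e1 : ∑ i, ∑ j, (jacobianMatrix (fun z => toR2 (V z)) z i j) ^ 2 =
      α 0 ^ 2 + α 1 ^ 2 + ρ ^ 2 * (X 0 ^ 2 + X 1 ^ 2) := by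
    simp only [e, Fin.sum_univ_two]
    simp
    linear_combination (α 0 ^ 2 + α 1 ^ 2 + ρ ^ 2 * (X 0 ^ 2 + X 1 ^ 2)) * hw
  have e2 : (jacobianMatrix (fun z => toR2 (V z)) z).det = ρ * (α 0 * X 1 - α 1 * X 0) := by
    rw [Matrix.det_fin_two]
    simp only [e]
    simp
    linear_combination (ρ * (α 0 * X 1 - α 1 * X 0)) * hw
  rw [e1, e2, Real.sqrt_le_iff]
  set J := α 0 * X 1 - α 1 * X 0
  have hs := Real.sq_sqrt (show 0 ≤ 1 + (X 0 ^ 2 + X 1 ^ 2) by positivity)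
  set S := Real.sqrt (1 + (X 0 ^ 2 + X 1 ^ 2))
  have hS : 0 ≤ S := Real.sqrt_nonneg _
  refine ⟨by positivity, ?_⟩
  have r1 : ρ ^ 2 * (X 0 ^ 2 + X 1 ^ 2) ≤ X 0 ^ 2 + X 1 ^ 2 := by
    have : ρ ^ 2 ≤ 1 := by nlinarith
    nlinarith [sq_nonneg (X 0), sq_nonneg (X 1)]
  have q0 := sq_abs (α 0)
  have q1 := sq_abs (α 1)
  have q2 := sq_abs J
  have p0 := abs_nonneg (α 0)
  have p1 := abs_nonneg (α 1)
  have p2 : 0 ≤ ρ * |J| := by positivity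
  have p3 : (ρ * J) ^ 2 = (ρ * |J|) ^ 2 := by rw [mul_pow, mul_pow, q2]
  rw [p3]
  have m1 := mul_nonneg p0 p1
  have m2 := mul_nonneg p0 p2
  have m3 := mul_nonneg p1 p2
  have m4 := mul_nonneg hS (add_nonneg (add_nonneg p0 p1) p2)
  nlinarith

lemma sqrt_one_add (a b c d : ℝ) : Real.sqrt (1 + ((a + c) ^ 2 + (b + d) ^ 2)) ≤
    Real.sqrt (1 + (a ^ 2 + b ^ 2)) + vn c d := by
  unfold vn
  rw [Real.sqrt_le_iff]
  refine ⟨by positivity, ?_⟩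
  have h1 := Real.sq_sqrt (show 0 ≤ 1 + (a ^ 2 + b ^ 2) by positivity)
  have h2 := Real.sq_sqrt (show 0 ≤ c ^ 2 + d ^ 2 by positivity)
  have h3 : a * c + b * d ≤ Real.sqrt (1 + (a ^ 2 + b ^ 2)) * Real.sqrt (c ^ 2 + d ^ 2) := by
    rw [← Real.sqrt_mul (by positivity)]
    refine Real.le_sqrt_of_sq_le ?_
    nlinarith [sq_nonneg (a * d - b * c), sq_nonneg c, sq_nonneg d]
  nlinarith

variable {κ : Type} [Fintype κ]

lemma om_pd {Ω : Set R2} (hΩ : IsOpen Ω) {F : R2 → ℂ} {τ : Fin 2 → R2 → ℝ}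
    (F1 : ContDiffOn ℝ 1 F Ω) (F3 : ∀ z ∈ Ω, ∀ j, pd j F z = (τ j z : ℂ) * Complex.I * F z)
    {a : κ → R2} {s : κ → ℝ} (hs : ∀ k, s k = 1 ∨ s k = -1) {z : R2} (hz : z ∈ Ω)
    (hza : ∀ k, z ≠ a k) (t : Finset κ) :
    DifferentiableAt ℝ (fun z => F z * ∏ k ∈ t, Q (s k) (a k) z) z ∧
    ∀ j, pd j (fun z => F z * ∏ k ∈ t, Q (s k) (a k) z) z =
      ((τ j z + ∑ k ∈ t, s k * Th j (z - a k) : ℝ) : ℂ) * Complex.I *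
        (F z * ∏ k ∈ t, Q (s k) (a k) z) := by
  induction t using Finset.induction_on with
  | empty =>
    refine ⟨by simpa using (F1.differentiableOn one_ne_zero).differentiableAt (hΩ.mem_nhds hz), ?_⟩
    intro j
    simpa using F3 z hz j
  | insert b t hb ih =>
    have e : (fun z => F z * ∏ k ∈ insert b t, Q (s k) (a k) z) =
        fun z => (F z * ∏ k ∈ t, Q (s k) (a k) z) * Q (s b) (a b) z := by
      funext z
      rw [Finset.prod_insert hb]; ring
    have dQ : DifferentiableAt ℝ (Q (s b) (a b)) z :=
      (Q_contDiffAt (s b) (hza b)).differentiableAt (by simp)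
    rw [e]
    refine ⟨ih.1.mul dQ, fun j => ?_⟩
    rw [pd_mul ih.1 dQ, ih.2 j, pd_Q (hs b) (hza b) j, Finset.sum_insert hb,
      Finset.prod_insert hb]
    push_cast
    ring

lemma rho_pd (a : κ → R2) (r : ℝ) (z : R2) :
    DifferentiableAt ℝ (fun z => ∏ k, cut r (z - a k)) z ∧
    ∀ j, pd j (fun z => ∏ k, cut r (z - a k)) z =
      ∑ k, (∏ l ∈ Finset.univ.erase k, cut r (z - a l)) * pd j (cut r) (z - a k) := by
  have hd : ∀ k, HasFDerivAt (fun z => cut r (z - a k)) (fderiv ℝ (fun z => cut r (z - a k)) z) z := by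
    intro k
    refine DifferentiableAt.hasFDerivAt ?_
    exact (((cut_contDiff r).comp (contDiff_id.sub contDiff_const)).differentiable
      (by simp)).differentiableAt
  have h := HasFDerivAt.finsetProd (u := Finset.univ) (fun k _ => hd k)
  refine ⟨h.differentiableAt, fun j => ?_⟩
  unfold pd
  rw [h.fderiv, sum_apply]
  refine Finset.sum_congr rfl fun k _ => ?_
  rw [smul_apply, smul_eq_mul]
  congr 1
  exact pd_sub_const (cut r) z (a k) j

end final

section final2

def jacw (r : ℝ) (z : R2) : ℝ := cut r z * (deriv nn (‖z‖ ^ 2 / r ^ 2) * (2 / r ^ 2))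

lemma jacw_nonneg (r : ℝ) (z : R2) : 0 ≤ jacw r z := by
  have := cut_nonneg r z
  have := nn'_nonneg (‖z‖ ^ 2 / r ^ 2)
  unfold jacw; positivity

lemma jacw_measurable (r : ℝ) : Measurable (jacw r) := by
  unfold jacw
  have h1 : Continuous (cut r) := (cut_contDiff r).continuous
  have h2 : Continuous (deriv nn) := nn'_contDiff.continuous
  refine Continuous.measurable ?_
  fun_prop

lemma jacw_lintegral {r : ℝ} (hr : 0 < r) (p : R2) :
    ∫⁻ z, ENNReal.ofReal (jacw r (z - p)) = ENNReal.ofReal Real.pi := by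
  rw [lintegral_sub_right_eq_self (fun z => ENNReal.ofReal (jacw r z)) p]
  have h : ∫ z, jacw r z = Real.pi := cut_jac_integral hr
  have hi : Integrable (jacw r) := by
    by_contra hn
    rw [integral_undef hn] at h
    exact Real.pi_ne_zero h.symm
  rw [← h, ofReal_integral_eq_lintegral_ofReal hi (Eventually.of_forall (jacw_nonneg r))]

lemma jac_id (r : ℝ) {z : R2} (hz : z ≠ 0) :
    pd 0 (cut r) z * Th 1 z - pd 1 (cut r) z * Th 0 z =
      deriv nn (‖z‖ ^ 2 / r ^ 2) * (2 / r ^ 2) := by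
  rw [pd_cut, pd_cut]
  have hn : ‖z‖ ≠ 0 := norm_ne_zero_iff.2 hz
  have h := R2_normSq z
  have e : z 0 * (z 0 / ‖z‖ ^ 2) + z 1 * (z 1 / ‖z‖ ^ 2) = 1 := by
    field_simp
    linarith
  simp only [Th, kerS, Matrix.cons_val_zero, Matrix.cons_val_one]
  linear_combination (deriv nn (‖z‖ ^ 2 / r ^ 2) * (2 / r ^ 2)) * e

lemma pd_cut_zero {r : ℝ} (hr : 0 < r) (j : Fin 2) {z : R2} (h : r < ‖z‖) : pd j (cut r) z = 0 := by
  have h1 := pd_cut_abs hr j z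
  rw [eta_of_gt hr h, mul_zero] at h1
  exact abs_nonpos_iff.1 h1

variable {κ : Type} [Fintype κ]

/-- the current with pole `k` removed -/
def Rk (τ : Fin 2 → R2 → ℝ) (a : κ → R2) (s : κ → ℝ) (k : κ) (j : Fin 2) (z : R2) : ℝ :=
  τ j z + ∑ l ∈ Finset.univ.erase k, s l * Th j (z - a l)

lemma Th_continuousAt (j : Fin 2) {z : R2} (hz : z ≠ 0) : ContinuousAt (Th j) z := by
  have hk : ∀ i, ContinuousAt (kerS i) z := by
    intro i
    unfold kerS
    refine ContinuousAt.div ?_ ?_ ?_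
    · exact (coord_contDiff (n := 0) i).continuous.continuousAt
    · fun_prop
    · have := norm_ne_zero_iff.2 hz
      positivity
  fin_cases j
  · exact (hk 1).neg
  · exact hk 0

lemma Rk_bdd {Ω : Set R2} (hΩ : IsOpen Ω) {τ : Fin 2 → R2 → ℝ}
    (F4 : ∀ j, ContinuousOn (τ j) Ω) {a : κ → R2} {s : κ → ℝ} (ha : ∀ k, a k ∈ Ω)
    (hinj : Function.Injective a) :
    ∃ M R : ℝ, 0 ≤ M ∧ 0 < R ∧ ∀ k j z, ‖z - a k‖ < R → |Rk τ a s k j z| ≤ M := by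
  have hc : ∀ k j, ContinuousAt (Rk τ a s k j) (a k) := by
    intro k j
    unfold Rk
    refine ((F4 j).continuousAt (hΩ.mem_nhds (ha k))).add ?_
    refine tendsto_finsetSum _ fun l hl => ?_
    refine ContinuousAt.mul continuousAt_const ?_
    have hne : a k - a l ≠ 0 := sub_ne_zero.2 fun h => (Finset.mem_erase.1 hl).1 (hinj h).symm
    exact ContinuousAt.comp (f := fun z => z - a l) (g := Th j) (Th_continuousAt j hne) (by fun_prop)
  have hev : ∀ k j, ∃ R > 0, ∀ z, ‖z - a k‖ < R → |Rk τ a s k j z| ≤ |Rk τ a s k j (a k)| + 1 := by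
    intro k j
    have := (hc k j).abs.eventually_le_const (lt_add_one _)
    obtain ⟨R, R0, hR⟩ := Metric.eventually_nhds_iff.1 this
    exact ⟨R, R0, fun z hz => hR (by rwa [dist_eq_norm])⟩
  choose R R0 hR using hev
  have hRe : ∀ᶠ x : ℝ in 𝓝[>] 0, ∀ k j, x < R k j := eventually_all.2 fun k => eventually_all.2 fun j =>
    (tendsto_id.mono_left nhdsWithin_le_nhds).eventually_lt_const (R0 k j)
  obtain ⟨x, hx, hx0⟩ := (hRe.and self_mem_nhdsWithin).exists
  refine ⟨∑ k, ∑ j, (|Rk τ a s k j (a k)| + 1), x, by positivity, hx0, fun k j z hz => ?_⟩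
  refine (hR k j z (hz.trans (hx k j))).trans ?_
  calc |Rk τ a s k j (a k)| + 1 ≤ ∑ j, (|Rk τ a s k j (a k)| + 1) :=
        Finset.single_le_sum (f := fun j => |Rk τ a s k j (a k)| + 1) (fun j _ => by positivity) (Finset.mem_univ j)
    _ ≤ _ := Finset.single_le_sum (f := fun k => ∑ j, (|Rk τ a s k j (a k)| + 1))
        (fun k _ => by positivity) (Finset.mem_univ k)

/-- the recovery map -/
def Vr (F : R2 → ℂ) (a : κ → R2) (s : κ → ℝ) (r : ℝ) (z : R2) : ℂ :=
  F z * ∏ k, cQ r (s k) (a k) z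

lemma Vr_contDiff {Ω : Set R2} {F : R2 → ℂ} (F1 : ContDiffOn ℝ 1 F Ω) (a : κ → R2) (s : κ → ℝ)
    {r : ℝ} (hr : 0 < r) : ContDiffOn ℝ 1 (Vr F a s r) Ω := by
  refine F1.mul (ContDiff.contDiffOn ?_)
  exact contDiff_prod fun k _ => (cQ_contDiff hr (s k) (a k)).of_le (by simp)

lemma Vr_eq (F : R2 → ℂ) (a : κ → R2) (s : κ → ℝ) (r : ℝ) (z : R2) :
    Vr F a s r z = ((∏ k, cut r (z - a k) : ℝ) : ℂ) * (F z * ∏ k, Q (s k) (a k) z) := by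
  unfold Vr cQ
  rw [Finset.prod_mul_distrib]
  push_cast
  ring

set_option maxHeartbeats 1000000 in
lemma area_bound {Ω : Set R2} (hΩ : IsOpen Ω) {F : R2 → ℂ} {τ : Fin 2 → R2 → ℝ}
    (F1 : ContDiffOn ℝ 1 F Ω) (F2 : ∀ z ∈ Ω, ‖F z‖ = 1)
    (F3 : ∀ z ∈ Ω, ∀ j, pd j F z = (τ j z : ℂ) * Complex.I * F z)
    {a : κ → R2} {s : κ → ℝ} (hs : ∀ k, s k = 1 ∨ s k = -1) {M R r : ℝ} (hM : 0 ≤ M)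
    (hr : 0 < r) (hrR : r < R)
    (hMR : ∀ k j z, ‖z - a k‖ < R → |Rk τ a s k j z| ≤ M)
    (g : Fin 2 → ℝ) {z : R2} (hz : z ∈ Ω) (hza : ∀ k, z ≠ a k) :
    Real.sqrt (1 + (∑ i, ∑ j, (jacobianMatrix (fun z => toR2 (Vr F a s r z)) z i j) ^ 2) +
      (jacobianMatrix (fun z => toR2 (Vr F a s r z)) z).det ^ 2) ≤
      Real.sqrt (1 + (g 0 ^ 2 + g 1 ^ 2)) +
      (vn (τ 0 z - (g 0 - ∑ k, s k * Th 0 (z - a k))) (τ 1 z - (g 1 - ∑ k, s k * Th 1 (z - a k))) +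
      ∑ k, (jacw r (z - a k) + (1 + M) * (|pd 0 (cut r) (z - a k)| + |pd 1 (cut r) (z - a k)|))) := by
  set X : Fin 2 → ℝ := fun j => τ j z + ∑ k, s k * Th j (z - a k) with hX
  set ρ : ℝ := ∏ k, cut r (z - a k) with hρ
  set α : Fin 2 → ℝ := fun j => pd j (fun z => ∏ k, cut r (z - a k)) z with hα
  set ω : ℂ := F z * ∏ k, Q (s k) (a k) z with hω
  have ρ0 : 0 ≤ ρ := Finset.prod_nonneg fun k _ => cut_nonneg _ _
  have ρ1 : ρ ≤ 1 := Finset.prod_le_one (fun k _ => cut_nonneg _ _) fun k _ => cut_le_one _ _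
  have ωn : ‖ω‖ = 1 := by
    rw [hω, norm_mul, norm_prod, F2 z hz, one_mul]
    exact Finset.prod_eq_one fun k _ => Q_norm (hs k) (hza k)
  obtain ⟨od, op⟩ := om_pd hΩ F1 F3 hs hz hza Finset.univ
  obtain ⟨rd, rp⟩ := rho_pd a r z
  have hd : ∀ j, pd j (Vr F a s r) z = ((α j : ℂ) + ((ρ * X j : ℝ) : ℂ) * Complex.I) * ω := by
    intro j
    have e : Vr F a s r = fun z => ((∏ k, cut r (z - a k) : ℝ) : ℂ) * (F z * ∏ k, Q (s k) (a k) z) :=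
      funext fun z => Vr_eq F a s r z
    have rdc : DifferentiableAt ℝ (fun z => ((∏ k, cut r (z - a k) : ℝ) : ℂ)) z :=
      Complex.ofRealCLM.differentiableAt.comp z rd
    rw [e, pd_mul rdc od, op j, pd_ofReal rd]
    simp only [hα, hX, hρ, hω]
    push_cast
    ring
  have main := area_pt ωn ρ0 ρ1 hd
  have hX2 : Real.sqrt (1 + (X 0 ^ 2 + X 1 ^ 2)) ≤ Real.sqrt (1 + (g 0 ^ 2 + g 1 ^ 2)) +
      vn (τ 0 z - (g 0 - ∑ k, s k * Th 0 (z - a k))) (τ 1 z - (g 1 - ∑ k, s k * Th 1 (z - a k))) := by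
    have := sqrt_one_add (g 0) (g 1) (τ 0 z - (g 0 - ∑ k, s k * Th 0 (z - a k)))
      (τ 1 z - (g 1 - ∑ k, s k * Th 1 (z - a k)))
    refine le_trans (le_of_eq ?_) this
    congr 2
    simp only [hX]
    ring
  set m : κ → ℝ := fun k => ∏ l ∈ Finset.univ.erase k, cut r (z - a l) with hm
  have m0 : ∀ k, 0 ≤ m k := fun k => Finset.prod_nonneg fun _ _ => cut_nonneg _ _
  have m1 : ∀ k, m k ≤ 1 := fun k => Finset.prod_le_one (fun _ _ => cut_nonneg _ _) fun _ _ => cut_le_one _ _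
  have ρm : ∀ k, ρ = cut r (z - a k) * m k := fun k =>
    (Finset.mul_prod_erase Finset.univ (fun l => cut r (z - a l)) (Finset.mem_univ k)).symm
  have αe : ∀ j, α j = ∑ k, m k * pd j (cut r) (z - a k) := rp
  have hαb : ∀ j, |α j| ≤ ∑ k, |pd j (cut r) (z - a k)| := by
    intro j
    rw [αe]
    refine (Finset.abs_sum_le_sum_abs _ _).trans (Finset.sum_le_sum fun k _ => ?_)
    rw [abs_mul, abs_of_nonneg (m0 k)]
    exact mul_le_of_le_one_left (abs_nonneg _) (m1 k)
  have hJk : ∀ k, cut r (z - a k) * |pd 0 (cut r) (z - a k) * X 1 - pd 1 (cut r) (z - a k) * X 0| ≤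
      jacw r (z - a k) + M * (|pd 0 (cut r) (z - a k)| + |pd 1 (cut r) (z - a k)|) := by
    intro k
    have hjn := jacw_nonneg r (z - a k)
    by_cases hk : r < ‖z - a k‖
    · rw [pd_cut_zero hr 0 hk, pd_cut_zero hr 1 hk]
      simpa using hjn
    · have hkR : ‖z - a k‖ < R := lt_of_le_of_lt (not_lt.1 hk) hrR
      have b0 := hMR k 0 z hkR
      have b1 := hMR k 1 z hkR
      have hXk : ∀ j, X j = s k * Th j (z - a k) + Rk τ a s k j z := by
        intro j
        simp only [hX, Rk]
        rw [← Finset.add_sum_erase Finset.univ (fun l => s l * Th j (z - a l)) (Finset.mem_univ k)]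
        ring
      have hid := jac_id r (sub_ne_zero.2 (hza k))
      set P0 := pd 0 (cut r) (z - a k)
      set P1 := pd 1 (cut r) (z - a k)
      set N := deriv nn (‖z - a k‖ ^ 2 / r ^ 2) * (2 / r ^ 2) with hN
      have hN0 : 0 ≤ N := by
        have := nn'_nonneg (‖z - a k‖ ^ 2 / r ^ 2)
        positivity
      have e : P0 * X 1 - P1 * X 0 = s k * N + (P0 * Rk τ a s k 1 z - P1 * Rk τ a s k 0 z) := by
        rw [hXk, hXk, ← hid]; ring
      have hsN : |s k * N| = N := by
        rw [abs_mul, abs_of_nonneg hN0]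
        rcases hs k with h | h <;> simp [h]
      have c0 := cut_nonneg r (z - a k)
      have c1 := cut_le_one r (z - a k)
      have t1 : |P0 * X 1 - P1 * X 0| ≤ N + M * (|P0| + |P1|) := by
        rw [e]
        refine (abs_add_le _ _).trans ?_
        rw [hsN]
        have : |P0 * Rk τ a s k 1 z - P1 * Rk τ a s k 0 z| ≤ |P0| * M + |P1| * M := by
          refine (abs_sub _ _).trans ?_
          rw [abs_mul, abs_mul]
          gcongr
        linarith
      calc _ ≤ cut r (z - a k) * (N + M * (|P0| + |P1|)) := by gcongr
        _ = jacw r (z - a k) + cut r (z - a k) * (M * (|P0| + |P1|)) := by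
          unfold jacw; rw [← hN]; ring
        _ ≤ _ := by
          exact add_le_add le_rfl (mul_le_of_le_one_left (by positivity) c1)
  have hJ : ρ * |α 0 * X 1 - α 1 * X 0| ≤
      ∑ k, (jacw r (z - a k) + M * (|pd 0 (cut r) (z - a k)| + |pd 1 (cut r) (z - a k)|)) := by
    have e : α 0 * X 1 - α 1 * X 0 =
        ∑ k, m k * (pd 0 (cut r) (z - a k) * X 1 - pd 1 (cut r) (z - a k) * X 0) := by
      rw [αe, αe, Finset.sum_mul, Finset.sum_mul, ← Finset.sum_sub_distrib]
      exact Finset.sum_congr rfl fun k _ => by ring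
    rw [e]
    calc _ ≤ ρ * ∑ k, |m k * (pd 0 (cut r) (z - a k) * X 1 - pd 1 (cut r) (z - a k) * X 0)| := by
          exact mul_le_mul_of_nonneg_left (Finset.abs_sum_le_sum_abs _ _) ρ0
      _ ≤ ∑ k, cut r (z - a k) * |pd 0 (cut r) (z - a k) * X 1 - pd 1 (cut r) (z - a k) * X 0| := by
          rw [Finset.mul_sum]
          refine Finset.sum_le_sum fun k _ => ?_
          rw [abs_mul, abs_of_nonneg (m0 k), ρm k, ← mul_assoc]
          refine mul_le_mul_of_nonneg_right ?_ (abs_nonneg _)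
          have c0 := cut_nonneg r (z - a k)
          exact (mul_le_of_le_one_right (mul_nonneg c0 (m0 k)) (m1 k)).trans
            (mul_le_of_le_one_right c0 (m1 k))
      _ ≤ _ := Finset.sum_le_sum fun k _ => hJk k
  have e : ∑ k, (jacw r (z - a k) + (1 + M) * (|pd 0 (cut r) (z - a k)| + |pd 1 (cut r) (z - a k)|)) =
      ∑ k, (jacw r (z - a k) + M * (|pd 0 (cut r) (z - a k)| + |pd 1 (cut r) (z - a k)|)) +
      (∑ k, |pd 0 (cut r) (z - a k)| + ∑ k, |pd 1 (cut r) (z - a k)|) := by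
    rw [← Finset.sum_add_distrib, ← Finset.sum_add_distrib]
    exact Finset.sum_congr rfl fun k _ => by ring
  rw [e]
  have := hαb 0
  have := hαb 1
  linarith

end final2

section final3

lemma sqrtG_integrable {Ω : Set R2} (hb : Bornology.IsBounded Ω)
    {G : R2 → Matrix (Fin 2) (Fin 2) ℝ} (hG : ∀ i j : Fin 2, IntegrableOn (fun x => G x i j) Ω) :
    IntegrableOn (fun z => Real.sqrt (1 + ∑ i, ∑ j, (G z i j) ^ 2)) Ω := by
  have h1 : IntegrableOn (fun z => 1 + ∑ i, ∑ j, |G z i j|) Ω := by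
    refine Integrable.add (integrableOn_const hb.measure_lt_top.ne) ?_
    exact integrable_finsetSum _ fun i _ => integrable_finsetSum _ fun j _ => (hG i j).abs
  refine Integrable.mono' h1 ?_ (Eventually.of_forall fun z => ?_)
  · have m : ∀ i j, AEMeasurable (fun x => G x i j) (volume.restrict Ω) := fun i j =>
      (hG i j).aestronglyMeasurable.aemeasurable
    refine AEMeasurable.aestronglyMeasurable ?_
    refine Real.continuous_sqrt.measurable.comp_aemeasurable ?_
    refine aemeasurable_const.add ?_
    exact Finset.aemeasurable_fun_sum _ fun i _ => Finset.aemeasurable_fun_sum _ fun j _ =>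
      (m i j).pow_const 2
  · rw [Real.norm_of_nonneg (Real.sqrt_nonneg _), Real.sqrt_le_iff]
    refine ⟨by positivity, ?_⟩
    simp only [Fin.sum_univ_two]
    have q := fun i j => sq_abs (G z i j)
    rw [← q 0 0, ← q 0 1, ← q 1 0, ← q 1 1]
    have p := fun i j => abs_nonneg (G z i j)
    have p00 := p 0 0
    have p01 := p 0 1
    have p10 := p 1 0
    have p11 := p 1 1
    generalize |G z 0 0| = A at *
    generalize |G z 0 1| = B at *
    generalize |G z 1 0| = C at *
    generalize |G z 1 1| = D at *
    nlinarith [mul_nonneg p00 p01, mul_nonneg p00 p10, mul_nonneg p00 p11, mul_nonneg p01 p10,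
      mul_nonneg p01 p11, mul_nonneg p10 p11]

variable {ι κ : Type} [Fintype ι] [Fintype κ]

lemma Vr_L1 {Ω : Set R2} {u : R2 → R2} (hu : IntegrableOn u Ω) (hS : SphereValued Ω u)
    {F : R2 → ℂ} (Fm : AEStronglyMeasurable F (volume.restrict Ω))
    {a : κ → R2} {s : κ → ℝ} (hs : ∀ k, s k = 1 ∨ s k = -1) {r : ℝ} (hr : 0 < r) :
    ∫⁻ z in Ω, ‖Vr F a s r z - cu 1 u z‖ₑ ≤
      (∫⁻ z in Ω, ‖F z - cu 1 u z * ∏ k, Q (-s k) (a k) z‖ₑ) + ∑ k, volume (ball (a k) r) := by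
  have hz : ∀ᵐ z ∂(volume.restrict Ω), ∀ k, z ≠ a k :=
    ae_restrict_of_ae (ae_all_iff.2 fun k => by
      rw [ae_iff]; simp)
  have hpt : ∀ᵐ z ∂(volume.restrict Ω), ‖Vr F a s r z - cu 1 u z‖ₑ ≤
      ‖F z - cu 1 u z * ∏ k, Q (-s k) (a k) z‖ₑ + ∑ k, (ball (a k) r).indicator 1 z := by
    filter_upwards [hz, hS] with z hz hS
    set W := cu 1 u z * ∏ k, Q (-s k) (a k) z with hW
    set q : ℂ := ∏ k, Q (s k) (a k) z with hq
    have hq1 : ‖q‖ = 1 := by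
      rw [hq, norm_prod]; exact Finset.prod_eq_one fun k _ => Q_norm (hs k) (hz k)
    have hWq : W * q = cu 1 u z := by
      rw [hW, hq, mul_assoc, ← Finset.prod_mul_distrib, Finset.prod_eq_one, mul_one]
      intro k _
      rw [mul_comm]
      exact Q_mul_inv (hs k) (hz k)
    set ρ : ℝ := ∏ k, cut r (z - a k) with hρ
    have ρ0 : 0 ≤ ρ := Finset.prod_nonneg fun k _ => cut_nonneg _ _
    have ρ1 : ρ ≤ 1 := Finset.prod_le_one (fun k _ => cut_nonneg _ _) fun k _ => cut_le_one _ _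
    have e : Vr F a s r z - cu 1 u z = (ρ : ℂ) * q * (F z - W) + ((ρ - 1 : ℝ) : ℂ) * cu 1 u z := by
      have e0 : Vr F a s r z = (ρ : ℂ) * (F z * q) := by
        rw [Vr_eq]
      rw [e0, ← hWq]; simp only [Complex.ofReal_sub, Complex.ofReal_one]; ring
    rw [e]
    refine (enorm_add_le _ _).trans (add_le_add ?_ ?_)
    · rw [← ofReal_norm, ← ofReal_norm]
      refine ENNReal.ofReal_le_ofReal ?_
      rw [norm_mul, norm_mul, hq1, mul_one, Complex.norm_real, Real.norm_of_nonneg ρ0]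
      exact mul_le_of_le_one_left (norm_nonneg _) ρ1
    · have hn : ‖((ρ - 1 : ℝ) : ℂ) * cu 1 u z‖ = |ρ - 1| := by
        rw [norm_mul, cu_norm (Or.inl rfl), hS, mul_one, Complex.norm_real, Real.norm_eq_abs]
      rw [← ofReal_norm, hn]
      by_cases hex : ∃ k, z ∈ ball (a k) r
      · obtain ⟨k, hk⟩ := hex
        calc ENNReal.ofReal |ρ - 1| ≤ 1 := by
              rw [ENNReal.ofReal_le_one, abs_le]; constructor <;> linarith
          _ = (ball (a k) r).indicator 1 z := by rw [indicator_of_mem hk]; rfl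
          _ ≤ _ := Finset.single_le_sum (f := fun k => (ball (a k) r).indicator (1 : R2 → ℝ≥0∞) z)
            (fun _ _ => zero_le) (Finset.mem_univ k)
      · push Not at hex
        have : ρ = 1 := by
          refine Finset.prod_eq_one fun k _ => cut_of_ge hr ?_
          have := hex k
          rw [mem_ball, not_lt, dist_eq_norm] at this
          exact this
        rw [this]; simp
  refine (lintegral_mono_ae hpt).trans ?_
  have Wm : AEStronglyMeasurable (fun z => cu 1 u z * ∏ i, Q (-s i) (a i) z) (volume.restrict Ω) := by
    refine (cu_integrable hu 1).aestronglyMeasurable.mul ?_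
    exact (Finset.measurable_fun_prod _ fun i _ => Q_measurable _ _).aestronglyMeasurable
  have hm : AEMeasurable (fun z => ‖F z - cu 1 u z * ∏ k, Q (-s k) (a k) z‖ₑ)
      (volume.restrict Ω) := (Fm.sub Wm).enorm
  rw [lintegral_add_left' hm, lintegral_finsetSum _ fun k _ =>
    measurable_one.indicator measurableSet_ball]
  refine add_le_add le_rfl (Finset.sum_le_sum fun k _ => ?_)
  refine (setLIntegral_le_lintegral _ _).trans ?_
  rw [lintegral_indicator_one measurableSet_ball]

lemma recovery {Ω : Set R2} (hΩ : IsOpen Ω) (hb : Bornology.IsBounded Ω) {u : R2 → R2}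
    {G : R2 → Matrix (Fin 2) (Fin 2) ℝ} (hu : MemW11 Ω u G) (hS : SphereValued Ω u)
    (p e : ι → R2) (a : κ → R2) (s : κ → ℝ) (hs : ∀ i, s i = 1 ∨ s i = -1)
    (ha : ∀ k, a k ∈ Ω) (hinj : Function.Injective a)
    (hdet : ∀ φ : R2 → ℝ, MemLip0 Ω φ → detPairing Ω u G φ =
      Real.pi * (∑ i, (φ (p i) - φ (p i + e i)) + ∑ i, s i * φ (a i)))
    {ε : ℝ≥0∞} (hε : ε ≠ 0) :
    ∃ V : R2 → ℂ, ContDiffOn ℝ 1 V Ω ∧ ∫⁻ z in Ω, ‖V z - cu 1 u z‖ₑ ≤ ε ∧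
      classicalArea Ω (fun z => toR2 (V z)) ≤
        ENNReal.ofReal (∫ z in Ω, Real.sqrt (1 + ∑ i, ∑ j, (G z i j) ^ 2)) +
        ENNReal.ofReal (2 * Real.pi * ∑ i, ‖e i‖ + Real.pi * Fintype.card κ) + ε := by
  have hε2 : ε / 2 ≠ 0 := (ENNReal.div_pos hε (by simp)).ne'
  obtain ⟨F, τ, F1, F2, F3, F4, F5, F6⟩ := stage1 hΩ hb hu hS p e a s hs hdet hε2
  obtain ⟨M, R, hM, hR, hMR⟩ := Rk_bdd (s := s) hΩ F4 ha hinj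
  have Fm : AEStronglyMeasurable F (volume.restrict Ω) :=
    F1.continuousOn.aestronglyMeasurable hΩ.measurableSet
  -- choose r
  have id0 : Tendsto (fun r : ℝ => r) (𝓝[>] 0) (𝓝 0) := tendsto_id.mono_left nhdsWithin_le_nhds
  have l1 : Tendsto (fun r : ℝ => ∑ k, volume (ball (a k) r)) (𝓝[>] 0) (𝓝 0) := by
    have : ∀ k, Tendsto (fun r : ℝ => volume (ball (a k) r)) (𝓝[>] 0) (𝓝 0) := by
      intro k
      have h : Tendsto (fun r : ℝ => ENNReal.ofReal (r ^ 2 * Real.pi)) (𝓝[>] 0) (𝓝 0) := by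
        have := ENNReal.tendsto_ofReal ((id0.pow 2).mul_const Real.pi)
        simpa using this
      refine h.congr' ?_
      filter_upwards [self_mem_nhdsWithin] with r hr
      have hr0 : 0 ≤ r := le_of_lt hr
      rw [EuclideanSpace.volume_ball_fin_two, ENNReal.ofReal_mul (by positivity),
        ENNReal.ofReal_pow hr0]
    simpa using tendsto_finsetSum (Finset.univ : Finset κ) fun k _ => this k
  have l2 : Tendsto (fun r : ℝ => ∑ _k : κ, ENNReal.ofReal ((1 + M) * (4 * Real.pi * r)))
      (𝓝[>] 0) (𝓝 0) := by
    have h : Tendsto (fun r : ℝ => ENNReal.ofReal ((1 + M) * (4 * Real.pi * r))) (𝓝[>] 0) (𝓝 0) := by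
      have := ENNReal.tendsto_ofReal ((id0.const_mul (4 * Real.pi)).const_mul (1 + M))
      simpa using this
    simpa using tendsto_finsetSum (Finset.univ : Finset κ) fun k _ => h
  have hε2' : 0 < ε / 2 := pos_iff_ne_zero.2 hε2
  obtain ⟨r, ⟨⟨hr1, hr2⟩, hrR⟩, hr⟩ := (((l1.eventually_le_const hε2').and
    (l2.eventually_le_const hε2')).and (id0.eventually_lt_const hR)).and self_mem_nhdsWithin |>.exists
  replace hr : 0 < r := hr
  refine ⟨Vr F a s r, Vr_contDiff F1 a s hr, ?_, ?_⟩
  · refine (Vr_L1 hu.1 hS Fm hs hr).trans ?_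
    calc _ ≤ ε / 2 + ε / 2 := add_le_add F5 hr1
      _ = ε := ENNReal.add_halves ε
  · have hz : ∀ᵐ z ∂(volume.restrict Ω), ∀ k, z ≠ a k :=
      ae_restrict_of_ae (ae_all_iff.2 fun k => by
        rw [ae_iff]; simp)
    have hzΩ : ∀ᵐ z ∂(volume.restrict Ω), z ∈ Ω := ae_restrict_mem hΩ.measurableSet
    set A : R2 → ℝ := fun z => Real.sqrt (1 + ∑ i, ∑ j, (G z i j) ^ 2) with hA
    set B : R2 → ℝ := fun z => vn (τ 0 z - k1 u G a s 0 z) (τ 1 z - k1 u G a s 1 z) with hB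
    have pdc : ∀ j, Continuous (pd j (cut r)) := fun j =>
      pd_continuous ((cut_contDiff r).of_le (by simp)) j
    set C : κ → R2 → ℝ≥0∞ := fun k z => ENNReal.ofReal (jacw r (z - a k)) +
      ENNReal.ofReal (1 + M) * (‖pd 0 (cut r) (z - a k)‖ₑ + ‖pd 1 (cut r) (z - a k)‖ₑ) with hC
    have hj : ∀ k, Measurable fun z => ENNReal.ofReal (jacw r (z - a k)) := fun k =>
      ((jacw_measurable r).comp (measurable_id.sub_const (a k))).ennreal_ofReal
    have hpm : ∀ j k, Measurable fun z => ‖pd j (cut r) (z - a k)‖ₑ := fun j k =>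
      ((pdc j).measurable.comp (measurable_id.sub_const (a k))).enorm
    have Cm : ∀ k, Measurable (C k) := fun k =>
      (hj k).add (((hpm 0 k).add (hpm 1 k)).const_mul _)
    have hpt : ∀ᵐ z ∂(volume.restrict Ω), ENNReal.ofReal
        (Real.sqrt (1 + (∑ i, ∑ j, (jacobianMatrix (fun z => toR2 (Vr F a s r z)) z i j) ^ 2) +
        (jacobianMatrix (fun z => toR2 (Vr F a s r z)) z).det ^ 2)) ≤
        ENNReal.ofReal (A z) + (ENNReal.ofReal (B z) + ∑ k, C k z) := by
      filter_upwards [hz, hzΩ, gg_sq hu hS hΩ] with z h1 h2 h3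
      have h := area_bound hΩ F1 F2 F3 hs hM hr hrR hMR (fun j => gg u G j z) h2 h1
      refine (ENNReal.ofReal_le_ofReal h).trans ?_
      rw [h3]
      refine (ENNReal.ofReal_add_le).trans (add_le_add le_rfl ?_)
      refine (ENNReal.ofReal_add_le).trans (add_le_add le_rfl ?_)
      rw [ENNReal.ofReal_sum_of_nonneg fun k _ => by
        have := jacw_nonneg r (z - a k); positivity]
      refine Finset.sum_le_sum fun k _ => ?_
      refine (ENNReal.ofReal_add_le).trans (add_le_add le_rfl ?_)
      rw [ENNReal.ofReal_mul (by positivity), ENNReal.ofReal_add (abs_nonneg _) (abs_nonneg _),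
        Real.enorm_eq_ofReal_abs, Real.enorm_eq_ofReal_abs]
    have hAi : IntegrableOn A Ω := sqrtG_integrable hb hu.2.1
    unfold classicalArea
    refine (lintegral_mono_ae hpt).trans ?_
    rw [lintegral_add_left' hAi.aestronglyMeasurable.aemeasurable.ennreal_ofReal,
      lintegral_add_right _ (Finset.measurable_fun_sum _ fun k _ => Cm k),
      lintegral_finsetSum _ fun k _ => Cm k,
      ← ofReal_integral_eq_lintegral_ofReal hAi (Eventually.of_forall fun z => Real.sqrt_nonneg _)]
    have hCk : ∀ k, ∫⁻ z in Ω, C k z ≤ ENNReal.ofReal Real.pi +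
        ENNReal.ofReal ((1 + M) * (4 * Real.pi * r)) := by
      intro k
      refine (setLIntegral_le_lintegral _ _).trans ?_
      have hpp : Measurable fun z => ‖pd 0 (cut r) (z - a k)‖ₑ + ‖pd 1 (cut r) (z - a k)‖ₑ :=
        (hpm 0 k).add (hpm 1 k)
      rw [hC]
      simp only
      rw [lintegral_add_left (hj k), jacw_lintegral hr, lintegral_const_mul _ hpp,
        lintegral_add_left (hpm 0 k), ENNReal.ofReal_mul (by positivity)]
      refine add_le_add le_rfl ?_
      gcongr
      refine (add_le_add (pd_cut_lintegral hr 0 (a k)) (pd_cut_lintegral hr 1 (a k))).trans ?_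
      rw [← ENNReal.ofReal_add (by positivity) (by positivity)]
      exact ENNReal.ofReal_le_ofReal (by linarith)
    have hCs : ∑ k, ∫⁻ z in Ω, C k z ≤ ENNReal.ofReal (Real.pi * Fintype.card κ) + ε / 2 := by
      refine (Finset.sum_le_sum fun k _ => hCk k).trans ?_
      rw [Finset.sum_add_distrib]
      refine add_le_add (le_of_eq ?_) hr2
      rw [Finset.sum_const, Finset.card_univ, mul_comm, ENNReal.ofReal_mul (by positivity), nsmul_eq_mul]
      simp
    rw [add_assoc (ENNReal.ofReal _)]
    refine add_le_add le_rfl ?_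
    refine (add_le_add F6 hCs).trans (le_of_eq ?_)
    rw [ENNReal.ofReal_add (by positivity) (by positivity)]
    conv_rhs => rw [← ENNReal.add_halves ε]
    ring

end final3

/-- **Theorem 6.1.** If `(1/π)Det(∇u)` is represented by a finite family of dipoles
satisfying `(P_f)`, with distinct, three-by-three non-collinear interior points, and
`u` is a standard vortex near each interior point, then
`𝒜(u,Ω) ≤ ∫_Ω √(1+|∇u|²) dx + ‖Det(∇u)‖_{flat,α}`. -/
theorem relaxedArea_le_of_vortex_structure (Ω : Set R2) (hΩo : IsOpen Ω)
    (hΩb : Bornology.IsBounded Ω) (hΩc : IsConnected Ω) (hΩl : HasLipschitzBoundary Ω)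
    (u : R2 → R2) (G : R2 → Matrix (Fin 2) (Fin 2) ℝ)
    (hu : MemW11 Ω u G) (hS : SphereValued Ω u)
    (n : ℕ) (x y : Fin n → R2)
    (hPf : SatisfiesPf Ω x y)
    (hgen : InteriorPointsGeneric Ω x y)
    (hdet : ∀ φ : R2 → ℝ, MemLip0 Ω φ →
      detPairing Ω u G φ = Real.pi * ∑ i, (φ (x i) - φ (y i)))
    (hρ : ∃ ρ0 : ℝ, 0 < ρ0 ∧ VortexAt Ω u x y fun _ => ρ0) :
    relaxedArea u Ω ≤
      ENNReal.ofReal (∫ z in Ω, Real.sqrt (1 + ∑ i, ∑ j, (G z i j) ^ 2)) +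
        flatNorm Ω 2 (detPairing Ω u G) := by
  obtain ⟨ι, κ, _, _, p, e, a, s, hs, ha, hinj, hid, hle⟩ :=
    blocks hPf hgen (L := detPairing Ω u G) hdet
  have hdet' : ∀ φ : R2 → ℝ, MemLip0 Ω φ → detPairing Ω u G φ =
      Real.pi * (∑ i, (φ (p i) - φ (p i + e i)) + ∑ i, s i * φ (a i)) := fun φ hφ => by
    rw [hdet φ hφ, hid φ hφ.2]
  have hε : ∀ k : ℕ, ENNReal.ofReal (1 / ((k : ℝ) + 1)) ≠ 0 := fun k => by
    rw [Ne, ENNReal.ofReal_eq_zero, not_le]; positivity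
  choose V V1 V2 V3 using fun k : ℕ =>
    recovery hΩo hΩb hu hS p e a s hs ha hinj hdet' (hε k)
  have hnorm : ∀ k z, ‖toR2 (V k z) - u z‖ₑ = ‖V k z - cu 1 u z‖ₑ := fun k z => by
    rw [← toR2_cu u z, ← map_sub, ← ofReal_norm, ← ofReal_norm, LinearIsometryEquiv.norm_map]
  have hL : ∀ k, ∫⁻ z in Ω, ‖toR2 (V k z) - u z‖ₑ ≤ ENNReal.ofReal (1 / ((k : ℝ) + 1)) := fun k => by
    rw [lintegral_congr (hnorm k)]; exact V2 k
  have hC : ∀ k, ContDiffOn ℝ 1 (fun z => toR2 (V k z)) Ω := fun k =>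
    toR2.contDiff.comp_contDiffOn (V1 k)
  have hm : ∀ k, AEStronglyMeasurable (fun z => toR2 (V k z) - u z) (volume.restrict Ω) := fun k =>
    ((hC k).continuousOn.aestronglyMeasurable hΩo.measurableSet).sub hu.1.aestronglyMeasurable
  have hlim : Tendsto (fun k : ℕ => 1 / ((k : ℝ) + 1)) atTop (𝓝 0) :=
    tendsto_one_div_add_atTop_nhds_zero_nat
  have hmem : relaxedArea u Ω ≤
      Filter.liminf (fun k => classicalArea Ω (fun z => toR2 (V k z))) atTop := by
    refine sInf_le ⟨fun k z => toR2 (V k z), hC, fun k => ⟨hm k, ?_⟩, ?_, rfl⟩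
    · exact (hL k).trans_lt ENNReal.ofReal_lt_top
    · refine squeeze_zero (fun k => integral_nonneg fun z => norm_nonneg _) (fun k => ?_) hlim
      rw [integral_norm_eq_lintegral_enorm (hm k)]
      exact ENNReal.toReal_le_of_le_ofReal (by positivity) (hL k)
  refine hmem.trans ((liminf_le_liminf (Eventually.of_forall V3)).trans ?_)
  have hT := (ENNReal.tendsto_ofReal hlim).const_add
    (ENNReal.ofReal (∫ z in Ω, Real.sqrt (1 + ∑ i, ∑ j, (G z i j) ^ 2)) +
      ENNReal.ofReal (2 * Real.pi * ∑ i, ‖e i‖ + Real.pi * Fintype.card κ))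
  rw [hT.liminf_eq, ENNReal.ofReal_zero, add_zero]
  exact add_le_add le_rfl hle
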